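/- arXiv:1109.6470 — 2 statements merged into one kernel-verified Lean document; each statement's English description precedes it below -/
import Mathlib

section
/- There exists a sequence of positive reals (γ_m)_{m≥7} with limsup_{m→∞} γ_m/((m+1)·ln(m+1)) ≤ 1/(4 ln 2) such that for every integer m ≥ 7 and every integer n ≥ m, H(n,m) ≥ (ln(m+2)/(2 ln 2) − 1/3)·n − γ_m. -/
open Filter Polynomial

/-- `Γ` is a periodic orbit of the planar vector field `V`: the image of a
nonconstant periodic solution of `γ' = V ∘ γ`. -/
def IsPeriodicOrbit (V : ℝ × ℝ → ℝ × ℝ) (Γ : Set (ℝ × ℝ)) : Prop :=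
  ∃ γ : ℝ → ℝ × ℝ,
    (∀ t : ℝ, HasDerivAt γ (V (γ t)) t) ∧
    (∃ T : ℝ, 0 < T ∧ Function.Periodic γ T) ∧
    (∃ t₁ t₂ : ℝ, γ t₁ ≠ γ t₂) ∧
    Γ = Set.range γ

/-- `Γ` is a limit cycle of `V`: a periodic orbit which is isolated among
periodic orbits. -/
def IsLimitCycle (V : ℝ × ℝ → ℝ × ℝ) (Γ : Set (ℝ × ℝ)) : Prop :=
  IsPeriodicOrbit V Γ ∧
  ∃ U : Set (ℝ × ℝ), IsOpen U ∧ Γ ⊆ U ∧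
    ∀ Γ' : Set (ℝ × ℝ), IsPeriodicOrbit V Γ' → Γ' ⊆ U → Γ' = Γ

/-- The Liénard vector field `ẋ = y, ẏ = -g(x) - ε f(x) y`. -/
def lienard (f g : Polynomial ℝ) (ε : ℝ) : ℝ × ℝ → ℝ × ℝ :=
  fun p => (p.2, -(g.eval p.1) - ε * (f.eval p.1) * p.2)

/-- `HGe n m c` formalizes `H(n,m) ≥ c`: there are polynomials `f, g` with
`deg f ≤ n`, `deg g ≤ m` and `ε₀ > 0` such that for every `0 < ε ≤ ε₀` the
Liénard system has at least `c` pairwise distinct limit cycles. -/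
def HGe (n m : ℕ) (c : ℝ) : Prop :=
  ∃ f g : Polynomial ℝ, f.natDegree ≤ n ∧ g.natDegree ≤ m ∧
    ∃ ε₀ : ℝ, 0 < ε₀ ∧ ∀ ε : ℝ, 0 < ε → ε ≤ ε₀ →
      ∃ S : Finset (Set (ℝ × ℝ)),
        (∀ Γ ∈ S, IsLimitCycle (lienard f g ε) Γ) ∧ c ≤ (S.card : ℝ)

namespace LienardCycles

open Topology

/-- The Banach algebra of continuous real functions on `[0, 1]`. -/
abbrev Curve := C(unitInterval, ℝ)

/-- Extension of a continuous function on `[0, 1]` to the line by constants. -/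
noncomputable def extend (u : Curve) : ℝ → ℝ := Set.IccExtend zero_le_one u

lemma continuous_extend (u : Curve) : Continuous (extend u) :=
  u.continuous.Icc_extend'

lemma extend_of_mem (u : Curve) {t : ℝ} (ht : t ∈ Set.Icc (0 : ℝ) 1) : extend u t = u ⟨t, ht⟩ :=
  Set.IccExtend_of_mem _ _ ht

lemma extend_add (u v : Curve) (t : ℝ) : extend (u + v) t = extend u t + extend v t := rfl

lemma extend_smul (c : ℝ) (u : Curve) (t : ℝ) : extend (c • u) t = c * extend u t := rfl

/-- The function `t ↦ ∫₀ᵗ u`. -/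
noncomputable def primitiveFun (u : Curve) : Curve where
  toFun t := ∫ s in (0 : ℝ)..t, extend u s
  continuous_toFun := by
    have := intervalIntegral.continuous_primitive (μ := MeasureTheory.volume)
      (fun a b => (continuous_extend u).intervalIntegrable a b) 0
    exact this.comp continuous_subtype_val

lemma primitiveFun_apply (u : Curve) (t : unitInterval) :
    primitiveFun u t = ∫ s in (0 : ℝ)..t, extend u s := rfl

lemma abs_primitiveFun_le (u : Curve) {c : ℝ} (n : ℕ)
    (hu : ∀ t : unitInterval, |u t| ≤ c * (t : ℝ) ^ n) (t : unitInterval) :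
    |primitiveFun u t| ≤ c * ((t : ℝ) ^ (n + 1) / (n + 1)) := by
  have h := intervalIntegral.norm_integral_le_of_norm_le (μ := MeasureTheory.volume)
    (f := extend u) (g := fun s => c * s ^ n) t.2.1 (Filter.Eventually.of_forall fun s hs => by
      have hs' : s ∈ Set.Icc (0 : ℝ) 1 := ⟨hs.1.le, hs.2.trans t.2.2⟩
      rw [extend_of_mem u hs']
      exact hu ⟨s, hs'⟩)
    ((continuous_const.mul (continuous_pow n)).intervalIntegrable _ _)
  rw [intervalIntegral.integral_const_mul, integral_pow] at h
  simpa [primitiveFun_apply] using h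

/-- Integration from `0`, as a continuous linear operator. -/
noncomputable def primitive : Curve →L[ℝ] Curve :=
  LinearMap.mkContinuous
    { toFun := primitiveFun
      map_add' := fun u v => by
        ext t
        simp only [primitiveFun_apply, ContinuousMap.add_apply, extend_add]
        exact intervalIntegral.integral_add ((continuous_extend u).intervalIntegrable _ _)
          ((continuous_extend v).intervalIntegrable _ _)
      map_smul' := fun c u => by
        ext t
        simp only [primitiveFun_apply, ContinuousMap.smul_apply, extend_smul, RingHom.id_apply,
          smul_eq_mul]
        exact intervalIntegral.integral_const_mul _ _ } 1 (fun u => by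
    rw [one_mul, ContinuousMap.norm_le _ (norm_nonneg _)]
    intro t
    have := abs_primitiveFun_le u (c := ‖u‖) 0 (fun t => by simpa using u.norm_coe_le_norm t) t
    refine this.trans ?_
    have h1 := t.2.2
    simp only [zero_add, pow_one, CharP.cast_eq_zero, div_one]
    exact mul_le_of_le_one_right (norm_nonneg _) h1)

lemma primitive_apply (u : Curve) (t : unitInterval) :
    primitive u t = ∫ s in (0 : ℝ)..t, extend u s := rfl

/-- The Volterra operator of a planar linear system `u' = T v`, `v' = -b u`. -/
noncomputable def volterra (T : ℝ) (b : Curve) : Curve × Curve →L[ℝ] Curve × Curve :=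
  (T • primitive.comp (ContinuousLinearMap.snd ℝ Curve Curve)).prod
    (-(primitive.comp ((ContinuousLinearMap.mul ℝ Curve b).comp
      (ContinuousLinearMap.fst ℝ Curve Curve))))

lemma volterra_apply (T : ℝ) (b : Curve) (p : Curve × Curve) :
    volterra T b p = (T • primitive p.2, -primitive (b * p.1)) := rfl

lemma volterra_pow_bound (T : ℝ) (b : Curve) (p : Curve × Curve) (n : ℕ) (t : unitInterval) :
    |((volterra T b ^ n) p).1 t| ≤ ‖p‖ * ((|T| + ‖b‖) ^ n / n.factorial) * (t : ℝ) ^ n ∧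
    |((volterra T b ^ n) p).2 t| ≤ ‖p‖ * ((|T| + ‖b‖) ^ n / n.factorial) * (t : ℝ) ^ n := by
  induction n generalizing t with
  | zero =>
    simp only [pow_zero, one_apply_eq_self, Nat.factorial_zero, Nat.cast_one, div_one,
      mul_one]
    exact ⟨(p.1.norm_coe_le_norm t).trans (norm_fst_le p),
      (p.2.norm_coe_le_norm t).trans (norm_snd_le p)⟩
  | succ n ih =>
    rw [pow_succ', mul_apply_eq_comp, volterra_apply]
    set q := (volterra T b ^ n) p
    set c := ‖p‖ * ((|T| + ‖b‖) ^ n / n.factorial) with hc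
    have hc0 : 0 ≤ c := by positivity
    have ht0 : (0 : ℝ) ≤ t := t.2.1
    have key : ‖p‖ * ((|T| + ‖b‖) ^ (n + 1) / (n + 1).factorial) * (t : ℝ) ^ (n + 1)
        = (|T| + ‖b‖) * (c * ((t : ℝ) ^ (n + 1) / (n + 1))) := by
      rw [hc, Nat.factorial_succ]
      push_cast
      field_simp
      ring
    have hpos : 0 ≤ c * ((t : ℝ) ^ (n + 1) / (n + 1)) := by positivity
    rw [key]
    constructor
    · have := abs_primitiveFun_le q.2 (c := c) n (fun s => (ih s).2) t
      have h2 : |(T • primitive q.2) t| = |T| * |primitiveFun q.2 t| := abs_mul _ _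
      rw [h2]
      have := mul_le_mul_of_nonneg_left this (abs_nonneg T)
      nlinarith [mul_nonneg (norm_nonneg b) hpos]
    · have := abs_primitiveFun_le (b * q.1) (c := ‖b‖ * c) n (fun s => by
        rw [ContinuousMap.mul_apply, abs_mul, mul_assoc]
        exact mul_le_mul (b.norm_coe_le_norm s) (ih s).1 (abs_nonneg _) (norm_nonneg _)) t
      have h2 : |(-primitive (b * q.1)) t| = |primitiveFun (b * q.1) t| := abs_neg _
      rw [h2]
      nlinarith [mul_nonneg (abs_nonneg T) hpos]

lemma isUnit_one_sub_volterra (T : ℝ) (b : Curve) : IsUnit (1 - volterra T b) := by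
  have hlim := FloorSemiring.tendsto_pow_div_factorial_atTop (|T| + ‖b‖)
  obtain ⟨n, hn⟩ := (hlim.eventually_lt_const (zero_lt_one (α := ℝ))).exists
  have hnorm : ‖volterra T b ^ n‖ < 1 := by
    refine lt_of_le_of_lt (ContinuousLinearMap.opNorm_le_bound _ (by positivity) fun p => ?_) hn
    have hle : ∀ t : unitInterval, ‖p‖ * ((|T| + ‖b‖) ^ n / n.factorial) * (t : ℝ) ^ n
        ≤ (|T| + ‖b‖) ^ n / n.factorial * ‖p‖ := fun t => by
      rw [mul_comm ‖p‖]
      exact mul_le_of_le_one_right (by positivity) (pow_le_one₀ t.2.1 t.2.2)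
    refine max_le ?_ ?_ <;> refine (ContinuousMap.norm_le _ (by positivity)).2 fun t => ?_
    · exact (volterra_pow_bound T b p n t).1.trans (hle t)
    · exact (volterra_pow_bound T b p n t).2.trans (hle t)
  have hu : IsUnit (1 - volterra T b ^ n) :=
    (Units.oneSub (R := Curve × Curve →L[ℝ] Curve × Curve) _ hnorm).isUnit
  have h1 := mul_neg_geom_sum (volterra T b) n
  have hcomm : Commute (1 - volterra T b) (∑ i ∈ Finset.range n, volterra T b ^ i) :=
    Finset.sum_induction _ (fun y => Commute (1 - volterra T b) y) (fun _ _ => Commute.add_right)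
      (Commute.zero_right _) fun i _ =>
        ((Commute.one_left _).sub_left (Commute.refl _)).pow_right i
  rw [← h1] at hu
  exact (hcomm.isUnit_mul_iff.1 hu).1

lemma contDiff_aeval_curve (g : ℝ[X]) (k : WithTop ℕ∞) :
    ContDiff ℝ k (fun x : Curve => aeval x g) := by
  induction g using Polynomial.induction_on' with
  | add p q hp hq => simpa using hp.add hq
  | monomial i a =>
    simp only [aeval_monomial]
    exact contDiff_const.mul (contDiff_id.pow i)

lemma hasFDerivAt_aeval_curve (g : ℝ[X]) (x : Curve) :
    HasFDerivAt (fun x : Curve => aeval x g)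
      (ContinuousLinearMap.mul ℝ Curve (aeval x (derivative g))) x := by
  induction g using Polynomial.induction_on' with
  | add p q hp hq =>
    have := hp.add hq
    simp only [map_add]
    exact this
  | monomial i a =>
    have h := ((hasFDerivAt_id (𝕜 := ℝ) x).pow i).const_mul (algebraMap ℝ Curve a)
    simp only [aeval_monomial, derivative_monomial]
    refine h.congr_fderiv ?_
    ext v : 1
    simp [mul_assoc, mul_comm, Algebra.smul_def]

lemma primitive_eq_sub {W : ℝ → ℝ} {u : Curve} (h : ∀ t : unitInterval, HasDerivAt W (u t) t)
    (t : unitInterval) : primitive u t = W t - W 0 := by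
  rw [primitive_apply]
  refine intervalIntegral.integral_eq_sub_of_hasDerivAt (fun s hs => ?_)
    ((continuous_extend u).intervalIntegrable _ _)
  rw [Set.uIcc_of_le t.2.1] at hs
  have hs' : s ∈ Set.Icc (0 : ℝ) 1 := ⟨hs.1, hs.2.trans t.2.2⟩
  rw [extend_of_mem u hs']
  exact h ⟨s, hs'⟩

/-- The defining equation of an arc of the Liénard system on the rescaled time interval `[0, 1]`,
starting at `(a, 0)` and ending on the axis `y = 0`. -/
noncomputable def arcMap (f g : ℝ[X]) (p : (ℝ × ℝ) × ((Curve × Curve) × ℝ)) :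
    (Curve × Curve) × ℝ :=
  ((p.2.1.1 - algebraMap ℝ Curve p.1.1 - p.2.2 • primitive p.2.1.2,
    p.2.1.2 + p.2.2 • primitive (aeval p.2.1.1 g + p.1.2 • (aeval p.2.1.1 f * p.2.1.2))),
    p.2.1.2 1)

/-- Evaluation at the end point `1`. -/
noncomputable def evalOne : Curve →L[ℝ] ℝ := ContinuousMap.evalCLM ℝ (1 : unitInterval)

lemma evalOne_apply (u : Curve) : evalOne u = u 1 := rfl

lemma contDiff_arcMap (f g : ℝ[X]) : ContDiff ℝ 1 (arcMap f g) := by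
  have hx : ContDiff ℝ 1 (fun p : (ℝ × ℝ) × ((Curve × Curve) × ℝ) => p.2.1.1) := by fun_prop
  have hy : ContDiff ℝ 1 (fun p : (ℝ × ℝ) × ((Curve × Curve) × ℝ) => p.2.1.2) := by fun_prop
  have hT : ContDiff ℝ 1 (fun p : (ℝ × ℝ) × ((Curve × Curve) × ℝ) => p.2.2) := by fun_prop
  have he : ContDiff ℝ 1 (fun p : (ℝ × ℝ) × ((Curve × Curve) × ℝ) => p.1.2) := by fun_prop
  have ha : ContDiff ℝ 1 (fun p : (ℝ × ℝ) × ((Curve × Curve) × ℝ) =>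
      algebraMap ℝ Curve p.1.1) :=
    (algebraMapCLM ℝ Curve).contDiff.comp (contDiff_fst.comp contDiff_fst)
  have hg := (contDiff_aeval_curve g 1).comp hx
  have hf := (contDiff_aeval_curve f 1).comp hx
  have hJ := (primitive.contDiff (n := 1)).comp hy
  have hJ' := (primitive.contDiff (n := 1)).comp (hg.add (he.smul (hf.mul hy)))
  exact (((hx.sub ha).sub (hT.smul hJ)).prodMk (hy.add (hT.smul hJ'))).prodMk
    ((evalOne.contDiff (n := 1)).comp hy)

lemma hasFDerivAt_arcMap_zero (f g : ℝ[X]) (a : ℝ) (x y : Curve) (T : ℝ) :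
    HasFDerivAt (fun z => arcMap f g ((a, 0), z))
      (((((1 : Curve × Curve →L[ℝ] Curve × Curve) - volterra T (T • aeval x (derivative g))).comp
          (ContinuousLinearMap.fst ℝ (Curve × Curve) ℝ)) -
        (ContinuousLinearMap.snd ℝ (Curve × Curve) ℝ).smulRight
          (primitive y, -primitive (aeval x g))).prod
        (evalOne.comp ((ContinuousLinearMap.snd ℝ Curve Curve).comp
          (ContinuousLinearMap.fst ℝ (Curve × Curve) ℝ)))) ((x, y), T) := by
  have hx : HasFDerivAt (fun z : (Curve × Curve) × ℝ => z.1.1)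
      ((ContinuousLinearMap.fst ℝ Curve Curve).comp
        (ContinuousLinearMap.fst ℝ (Curve × Curve) ℝ)) ((x, y), T) :=
    ((ContinuousLinearMap.fst ℝ Curve Curve).comp
        (ContinuousLinearMap.fst ℝ (Curve × Curve) ℝ)).hasFDerivAt
  have hy : HasFDerivAt (fun z : (Curve × Curve) × ℝ => z.1.2)
      ((ContinuousLinearMap.snd ℝ Curve Curve).comp
        (ContinuousLinearMap.fst ℝ (Curve × Curve) ℝ)) ((x, y), T) :=
    ((ContinuousLinearMap.snd ℝ Curve Curve).comp
        (ContinuousLinearMap.fst ℝ (Curve × Curve) ℝ)).hasFDerivAt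
  have hT : HasFDerivAt (fun z : (Curve × Curve) × ℝ => z.2)
      (ContinuousLinearMap.snd ℝ (Curve × Curve) ℝ) ((x, y), T) :=
    (ContinuousLinearMap.snd ℝ (Curve × Curve) ℝ).hasFDerivAt
  have hg := (hasFDerivAt_aeval_curve g x).comp ((x, y), T) hx
  have hJ := (primitive.hasFDerivAt (x := y)).comp ((x, y), T) hy
  have hJ' := (primitive.hasFDerivAt (x := aeval x g)).comp ((x, y), T) hg
  have hev := (evalOne.hasFDerivAt (x := y)).comp ((x, y), T) hy
  have h := (((hx.sub_const (algebraMap ℝ Curve a)).sub (hT.smul hJ)).prodMk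
    (hy.add (hT.smul hJ'))).prodMk hev
  have hfun : (fun z => arcMap f g ((a, 0), z)) = fun z : (Curve × Curve) × ℝ =>
      ((z.1.1 - algebraMap ℝ Curve a - z.2 • primitive z.1.2,
        z.1.2 + z.2 • primitive (aeval z.1.1 g)), evalOne z.1.2) := by
    funext z
    simp [arcMap, evalOne_apply]
  rw [hfun]
  refine h.congr_fderiv ?_
  refine ContinuousLinearMap.ext fun v => ?_
  obtain ⟨⟨v₁, v₂⟩, τ⟩ := v
  refine Prod.ext (Prod.ext ?_ ?_) ?_
  · simp [volterra_apply, Function.comp_def]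
    abel
  · simp [volterra_apply, Function.comp_def]
    abel
  · simp [Function.comp_def]

/-- A closed orbit of the Hamiltonian system, with time rescaled so that `1` is a period (`T` may be
negative). -/
structure IsLoop (g : ℝ[X]) (X Y : ℝ → ℝ) (T : ℝ) : Prop where
  hasDerivAt_fst : ∀ t, HasDerivAt X (T * Y t) t
  hasDerivAt_snd : ∀ t, HasDerivAt Y (-(T * g.eval (X t))) t
  fst_one : X 1 = X 0
  snd_zero : Y 0 = 0
  snd_one : Y 1 = 0

/-- The restriction of a continuous function to `[0, 1]`. -/
def restr (X : ℝ → ℝ) (hX : Continuous X) : Curve := ⟨fun t => X t, by fun_prop⟩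

section

variable {g : ℝ[X]} {X Y : ℝ → ℝ} {T : ℝ}

lemma IsLoop.continuous_fst (h : IsLoop g X Y T) : Continuous X :=
  continuous_iff_continuousAt.2 fun t => (h.hasDerivAt_fst t).continuousAt

lemma IsLoop.continuous_snd (h : IsLoop g X Y T) : Continuous Y :=
  continuous_iff_continuousAt.2 fun t => (h.hasDerivAt_snd t).continuousAt

/-- The arcs of the Liénard system from the axis `y = 0` to itself near a closed orbit of the
Hamiltonian system form a `C¹` family. -/
theorem exists_arc_family (f : ℝ[X]) (h : IsLoop g X Y T) (hg : g.eval (X 0) ≠ 0) :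
    ∃ S : ℝ × ℝ → (Curve × Curve) × ℝ,
      ContDiffAt ℝ 1 S (X 0, 0) ∧
      S (X 0, 0) = ((restr X h.continuous_fst, restr Y h.continuous_snd), T) ∧
      ∀ᶠ p in 𝓝 ((X 0, 0) : ℝ × ℝ), arcMap f g (p, S p) = 0 := by
  set x := restr X h.continuous_fst with hx
  set y := restr Y h.continuous_snd with hy
  set u : (ℝ × ℝ) × ((Curve × Curve) × ℝ) := ((X 0, 0), ((x, y), T)) with hu
  have hJy : ∀ t : unitInterval, T * primitive y t = X t - X 0 := fun t => by
    have := primitive_eq_sub (W := X) (u := T • y) (fun t => h.hasDerivAt_fst t) t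
    rw [← this, map_smul]
    rfl
  have hJg : ∀ t : unitInterval, T * primitive (aeval x g) t = - Y t := fun t => by
    have := primitive_eq_sub (W := Y) (u := -(T • aeval x g)) (fun t => by
      have := h.hasDerivAt_snd t
      simpa [x, restr, Polynomial.aeval_continuousMap_apply] using this) t
    rw [h.snd_zero, sub_zero] at this
    rw [← this, map_neg, map_smul]
    simp
  have hu0 : arcMap f g u = 0 := by
    refine Prod.ext (Prod.ext ?_ ?_) ?_
    · ext t
      have := hJy t
      simp only [arcMap, u, ContinuousMap.sub_apply, ContinuousMap.smul_apply, smul_eq_mul, this,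
        Prod.fst_zero, ContinuousMap.zero_apply]
      simp [x, restr]
    · ext t
      have := hJg t
      simp only [arcMap, u, zero_smul, add_zero, ContinuousMap.add_apply, ContinuousMap.smul_apply,
        smul_eq_mul, this, Prod.snd_zero, Prod.fst_zero, ContinuousMap.zero_apply]
      simp [y, restr]
    · simp [arcMap, u, y, restr, h.snd_one]
  set b : Curve := T • aeval x (derivative g) with hb
  obtain ⟨R, hR⟩ := isUnit_one_sub_volterra T b
  set L := (((((1 : Curve × Curve →L[ℝ] Curve × Curve) - volterra T b).comp
          (ContinuousLinearMap.fst ℝ (Curve × Curve) ℝ)) -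
        (ContinuousLinearMap.snd ℝ (Curve × Curve) ℝ).smulRight
          (primitive y, -primitive (aeval x g))).prod
        (evalOne.comp ((ContinuousLinearMap.snd ℝ Curve Curve).comp
          (ContinuousLinearMap.fst ℝ (Curve × Curve) ℝ)))) with hL
  have hLapply : ∀ v : (Curve × Curve) × ℝ, L v =
      (R.1 v.1 - v.2 • (primitive y, -primitive (aeval x g)), v.1.2 1) := fun v => by
    rw [hR]; rfl
  have hfd : fderiv ℝ (arcMap f g) u ∘L .inr ℝ (ℝ × ℝ) ((Curve × Curve) × ℝ) = L := by
    have h1 : HasFDerivAt (fun z => arcMap f g ((X 0, 0), z))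
        (fderiv ℝ (arcMap f g) u ∘L .inr ℝ (ℝ × ℝ) ((Curve × Curve) × ℝ)) ((x, y), T) :=
      (((contDiff_arcMap f g).differentiable one_ne_zero) u).hasFDerivAt.comp ((x, y), T)
        (hasFDerivAt_prodMk_right (X 0, 0) ((x, y), T))
    exact h1.unique (hasFDerivAt_arcMap_zero f g (X 0) x y T)
  let ι : Curve := ⟨fun t => t, continuous_subtype_val⟩
  set w : Curve × Curve := (ι * y, -(ι * aeval x g)) with hw
  have hRw : R.1 w = (primitive y, -primitive (aeval x g)) := by
    rw [hR]
    have e1 : primitive (y + T • (ι * -aeval x g)) = ι * y := by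
      ext t
      rw [primitive_eq_sub (W := fun t => t * Y t)]
      · simp [ι, y, restr]
      · intro s
        have := (hasDerivAt_id (s : ℝ)).mul (h.hasDerivAt_snd s)
        refine this.congr_deriv ?_
        simp [ι, x, y, restr, Polynomial.aeval_continuousMap_apply]
        ring
    have e2 : primitive (aeval x g + b * (ι * y)) = ι * aeval x g := by
      ext t
      rw [primitive_eq_sub (W := fun t => t * g.eval (X t))]
      · simp [ι, x, restr, Polynomial.aeval_continuousMap_apply]
      · intro s
        have := (hasDerivAt_id (s : ℝ)).mul
          ((g.hasDerivAt (X s)).comp (s : ℝ) (h.hasDerivAt_fst s))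
        refine this.congr_deriv ?_
        simp [ι, b, x, y, restr, Polynomial.aeval_continuousMap_apply, Function.comp]
        ring
    refine Prod.ext ?_ ?_
    · simp only [sub_apply, one_apply_eq_self, volterra_apply, hw, Prod.fst_sub]
      rw [← e1, map_add, map_smul, mul_neg]
      simp
    · simp only [sub_apply, one_apply_eq_self, volterra_apply, hw, Prod.snd_sub]
      rw [← e2, map_add]
      simp
  have hw1 : w.2 1 = -g.eval (X 0) := by
    simp [hw, ι, x, restr, Polynomial.aeval_continuousMap_apply, h.fst_one]
  have hw1' : w.2 1 ≠ 0 := by rw [hw1]; simpa using hg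
  have hRR : ∀ p, R.1 ((R⁻¹).1 p) = p := fun p => by
    rw [← mul_apply_eq_comp, ← Units.val_mul]; simp
  have hRR' : ∀ p, (R⁻¹).1 (R.1 p) = p := fun p => by
    rw [← mul_apply_eq_comp, ← Units.val_mul]; simp
  let τ : (Curve × Curve) × ℝ →L[ℝ] ℝ := (w.2 1)⁻¹ • (ContinuousLinearMap.snd ℝ (Curve × Curve) ℝ -
    evalOne.comp ((ContinuousLinearMap.snd ℝ Curve Curve).comp
      ((R⁻¹).1.comp (ContinuousLinearMap.fst ℝ (Curve × Curve) ℝ))))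
  have hτ : ∀ q, τ q = (w.2 1)⁻¹ * (q.2 - ((R⁻¹).1 q.1).2 1) := fun q => rfl
  have hinv : (fderiv ℝ (arcMap f g) u ∘L .inr ℝ (ℝ × ℝ) ((Curve × Curve) × ℝ)).IsInvertible := by
    rw [hfd]
    refine ContinuousLinearMap.IsInvertible.of_inverse
      (g := (((R⁻¹).1.comp (ContinuousLinearMap.fst ℝ (Curve × Curve) ℝ)) + τ.smulRight w).prod τ)
      ?_ ?_
    · refine ContinuousLinearMap.ext fun q => ?_
      change L ((R⁻¹).1 q.1 + τ q • w, τ q) = q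
      rw [hLapply]
      refine Prod.ext ?_ ?_
      · simp only [map_add, map_smul, hRR, hRw]
        simp
      · simp only [hτ, Prod.snd_add, Prod.smul_snd, ContinuousMap.add_apply,
          ContinuousMap.smul_apply, smul_eq_mul]
        field_simp
        ring
    · refine ContinuousLinearMap.ext fun v => ?_
      change ((R⁻¹).1 (L v).1 + τ (L v) • w, τ (L v)) = v
      have h2 : τ (L v) = v.2 := by
        rw [hτ, hLapply, ← hRw]
        simp only [map_sub, map_smul, hRR', Prod.snd_sub, Prod.smul_snd, ContinuousMap.sub_apply,
          ContinuousMap.smul_apply, smul_eq_mul]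
        field_simp
        ring
      rw [h2, hLapply, ← hRw]
      simp [map_sub, map_smul, hRR']
  have hcd : ContDiffAt ℝ 1 (arcMap f g) u := (contDiff_arcMap f g).contDiffAt
  refine ⟨hcd.implicitFunction one_ne_zero hinv, hcd.contDiffAt_implicitFunction one_ne_zero hinv,
    hcd.implicitFunction_apply_self one_ne_zero hinv, ?_⟩
  simpa only [hu0] using hcd.eventually_apply_implicitFunction one_ne_zero hinv

end

/-- The interval `[l, r]` is the projection of a closed level curve `y² / 2 + G(x) = G(r)`. -/
structure IsOval (G : ℝ[X]) (l r : ℝ) : Prop where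
  lt : l < r
  eval_eq : G.eval l = G.eval r
  eval_lt : ∀ x ∈ Set.Ioo l r, G.eval x < G.eval r
  deriv_left : (derivative G).eval l < 0
  deriv_right : 0 < (derivative G).eval r

/-- The Melnikov integral of `F` over the upper half of the closed level curve over `[l, r]`. -/
noncomputable def mel (G F : ℝ[X]) (l r : ℝ) : ℝ :=
  ∫ x in l..r, F.eval x * √(G.eval r - G.eval x)

lemma IsOval.exists_factor {G : ℝ[X]} {l r : ℝ} (h : IsOval G l r) :
    ∃ Q : ℝ[X], (∀ x, G.eval r - G.eval x = (r - x) * (x - l) * Q.eval x) ∧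
      ∀ x ∈ Set.Icc l r, 0 < Q.eval x := by
  obtain ⟨Q₁, hQ₁⟩ : X - C r ∣ C (G.eval r) - G := by
    rw [dvd_iff_isRoot]; simp
  have hne : l - r ≠ 0 := (sub_neg.2 h.lt).ne
  obtain ⟨Q₂, hQ₂⟩ : X - C l ∣ Q₁ := by
    rw [dvd_iff_isRoot]
    have := congrArg (Polynomial.eval l) hQ₁
    simp only [eval_sub, eval_C, h.eval_eq, sub_self, eval_mul, eval_X] at this
    exact (mul_eq_zero.1 this.symm).resolve_left hne
  have hfac : C (G.eval r) - G = (X - C r) * ((X - C l) * Q₂) := by rw [hQ₁, hQ₂]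
  have hval : ∀ x, G.eval r - G.eval x = (r - x) * (x - l) * (-Q₂).eval x := fun x => by
    have := congrArg (Polynomial.eval x) hfac
    simp only [eval_sub, eval_C, eval_mul, eval_X] at this
    rw [this, eval_neg]; ring
  have hder := congrArg derivative hfac
  simp only [derivative_sub, derivative_C, derivative_mul, derivative_X] at hder
  refine ⟨-Q₂, hval, fun x hx => ?_⟩
  rcases hx.1.eq_or_lt with rfl | hl
  · have := congrArg (Polynomial.eval l) hder
    simp only [eval_sub, eval_C, eval_mul, eval_X, eval_add, eval_zero, eval_one] at this
    have h1 := h.deriv_left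
    have h2 := h.lt
    rw [eval_neg]
    by_contra hc
    nlinarith
  rcases hx.2.eq_or_lt with rfl | hr
  · have := congrArg (Polynomial.eval x) hder
    simp only [eval_sub, eval_C, eval_mul, eval_X, eval_add, eval_zero, eval_one] at this
    have h1 := h.deriv_right
    rw [eval_neg]
    by_contra hc
    nlinarith
  · have h1 := h.eval_lt x ⟨hl, hr⟩
    have h2 := hval x
    have h3 : 0 < (r - x) * (x - l) := mul_pos (by linarith) (by linarith)
    by_contra hc
    nlinarith

/-- A smooth positive periodic vector field on the line has a flow winding around. -/
lemma exists_angle {s : ℝ → ℝ} (hs : Continuous s) (hpos : ∀ θ, 0 < s θ)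
    (hper : Function.Periodic s (2 * Real.pi)) :
    ∃ φ : ℝ → ℝ, StrictMono φ ∧ φ 0 = 0 ∧ (∀ t, HasDerivAt φ (s (φ t)) t) ∧
      Function.Surjective φ := by
  obtain ⟨M, hM⟩ : ∃ M, ∀ θ, s θ ≤ M := by
    obtain ⟨M, hM⟩ := (isCompact_Icc.image (s := Set.Icc 0 (0 + 2 * Real.pi)) hs).bddAbove
    refine ⟨M, fun θ => ?_⟩
    obtain ⟨y, hy, hy'⟩ := hper.exists_mem_Ico₀ Real.two_pi_pos θ
    rw [hy']
    exact hM ⟨y, ⟨hy.1, by linarith [hy.2]⟩, rfl⟩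
  have hMpos : 0 < M := (hpos 0).trans_le (hM 0)
  have hc : Continuous fun θ => (s θ)⁻¹ := hs.inv₀ fun θ => (hpos θ).ne'
  set τ : ℝ → ℝ := fun θ => ∫ u in (0 : ℝ)..θ, (s u)⁻¹ with hτ
  have hτ0 : τ 0 = 0 := by simp [hτ]
  have hd : ∀ θ, HasDerivAt τ (s θ)⁻¹ θ := fun θ =>
    intervalIntegral.integral_hasDerivAt_right (hc.intervalIntegrable _ _)
      (hc.stronglyMeasurableAtFilter _ _) hc.continuousAt
  have hmono : StrictMono τ := strictMono_of_deriv_pos fun θ => by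
    rw [(hd θ).deriv]; exact inv_pos.2 (hpos θ)
  have hcont : Continuous τ := continuous_iff_continuousAt.2 fun θ => (hd θ).continuousAt
  have hgrow : Monotone fun θ => τ θ - M⁻¹ * θ := by
    refine monotone_of_deriv_nonneg ?_ fun θ => ?_
    · exact fun θ => ((hd θ).sub ((hasDerivAt_id θ).const_mul M⁻¹)).differentiableAt
    · have := ((hd θ).sub ((hasDerivAt_id θ).const_mul M⁻¹)).deriv
      change 0 ≤ deriv (τ - fun y => M⁻¹ * id y) θ
      rw [this]
      have := inv_anti₀ (hpos θ) (hM θ)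
      simpa using this
  have htop : Tendsto τ atTop atTop := by
    refine tendsto_atTop_mono' _ ?_ (tendsto_id.const_mul_atTop (inv_pos.2 hMpos))
    filter_upwards [eventually_ge_atTop 0] with θ hθ
    have := hgrow hθ
    simp only [hτ0] at this
    simp only [id]
    linarith
  have hbot : Tendsto τ atBot atBot := by
    refine tendsto_atBot_mono' _ ?_ (tendsto_id.const_mul_atBot (inv_pos.2 hMpos))
    filter_upwards [eventually_le_atBot 0] with θ hθ
    have := hgrow hθ
    simp only [hτ0] at this
    simp only [id]
    linarith
  have hsurj : Function.Surjective τ := hcont.surjective htop hbot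
  set e := hmono.orderIsoOfSurjective τ hsurj with he
  have heτ : ∀ θ, e θ = τ θ := fun θ => rfl
  refine ⟨e.symm, e.symm.strictMono, ?_, fun t => ?_, e.symm.surjective⟩
  · rw [e.symm_apply_eq, heτ, hτ0]
  · have h1 : HasDerivAt τ (s (e.symm t))⁻¹ (e.symm t) := hd _
    have := HasDerivAt.of_local_left_inverse (f := τ) (g := e.symm) (a := t)
      e.symm.continuous.continuousAt h1 (inv_ne_zero (hpos _).ne')
      (Eventually.of_forall fun y => e.apply_symm_apply y)
    simpa using this

lemma integral_even_periodic {h : ℝ → ℝ} (hc : Continuous h)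
    (hper : Function.Periodic h (2 * Real.pi)) (heven : ∀ θ, h (-θ) = h θ) (k : ℤ) :
    ∫ θ in (0 : ℝ)..(k * (2 * Real.pi)), h θ = 2 * k * ∫ θ in (0 : ℝ)..Real.pi, h θ := by
  have hi : ∀ a b, IntervalIntegrable h MeasureTheory.volume a b := hc.intervalIntegrable
  have h1 := hper.intervalIntegral_add_zsmul_eq k 0 hi
  simp only [zero_add, zsmul_eq_mul] at h1
  rw [h1, ← intervalIntegral.integral_add_adjacent_intervals (hi 0 Real.pi) (hi _ _)]
  have h2 := intervalIntegral.integral_comp_sub_left (a := 0) (b := Real.pi) h (2 * Real.pi)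
  have h3 : ∀ θ, h (2 * Real.pi - θ) = h θ := fun θ => by
    rw [← heven θ, ← hper (-θ)]; congr 1; ring
  simp only [h3, sub_zero] at h2
  have h4 : 2 * Real.pi - Real.pi = Real.pi := by ring
  rw [h4] at h2
  rw [← h2]; ring

/-- The closed orbit over an oval and the Melnikov integral along it. -/
theorem IsOval.exists_loop {G : ℝ[X]} {l r : ℝ} (h : IsOval G l r) :
    ∃ X Y : ℝ → ℝ, ∃ T₀ T₁ : ℝ, 0 < T₀ ∧ T₁ < 0 ∧ (∀ t, HasDerivAt X (Y t) t) ∧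
      (∀ t, HasDerivAt Y (-(derivative G).eval (X t)) t) ∧ X 0 = r ∧ Y 0 = 0 ∧
      X T₀ = r ∧ Y T₀ = 0 ∧ X T₁ = r ∧ Y T₁ = 0 ∧
      (∀ t, X t ∈ Set.Icc l r ∧ Y t ^ 2 / 2 + G.eval (X t) = G.eval r) ∧
      ∀ T, T ≠ 0 → X T = r → Y T = 0 → ∃ κ : ℝ, 0 < κ ∧ ∀ F : ℝ[X],
        ∫ t in (0 : ℝ)..1, F.eval (X (T * t)) * Y (T * t) ^ 2 = κ * mel G F l r := by
  obtain ⟨Q, hQ, hQpos⟩ := h.exists_factor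
  set c := (l + r) / 2 with hc
  set w := (r - l) / 2 with hw
  have hw0 : 0 < w := by have := h.lt; rw [hw]; linarith
  set p : ℝ → ℝ := fun θ => c + w * Real.cos θ with hp
  have hpc : Continuous p := by fun_prop
  have hpd : ∀ θ, HasDerivAt p (-(w * Real.sin θ)) θ := fun θ => by
    have := ((Real.hasDerivAt_cos θ).const_mul w).const_add c
    exact this.congr_deriv (by ring)
  have hpmem : ∀ θ, p θ ∈ Set.Icc l r := fun θ => by
    have h1 := Real.neg_one_le_cos θ
    have h2 := Real.cos_le_one θ
    constructor <;> simp only [hp, hc, hw] at * <;> nlinarith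
  set s : ℝ → ℝ := fun θ => √(2 * Q.eval (p θ)) with hs
  have hQp : ∀ θ, 0 < 2 * Q.eval (p θ) := fun θ => by linarith [hQpos _ (hpmem θ)]
  have hsc : Continuous s := (continuous_const.mul (Q.continuous.comp hpc)).sqrt
  have hspos : ∀ θ, 0 < s θ := fun θ => Real.sqrt_pos.2 (hQp θ)
  have hssq : ∀ θ, s θ ^ 2 = 2 * Q.eval (p θ) := fun θ => Real.sq_sqrt (hQp θ).le
  have hpper : Function.Periodic p (2 * Real.pi) := fun θ => by simp [hp]
  have hsper : Function.Periodic s (2 * Real.pi) := fun θ => by simp only [hs, hpper θ]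
  have hsd : ∀ θ, HasDerivAt s
      ((2 * ((derivative Q).eval (p θ) * -(w * Real.sin θ))) / (2 * s θ)) θ := fun θ =>
    (((Q.hasDerivAt (p θ)).comp θ (hpd θ)).const_mul 2).sqrt (hQp θ).ne'
  have hG : ∀ x, (derivative G).eval x =
      -((l + r - 2 * x) * Q.eval x + (r - x) * (x - l) * (derivative Q).eval x) := fun x => by
    have h1 := (G.hasDerivAt x).const_sub (G.eval r)
    have h2 : HasDerivAt (fun x => (r - x) * (x - l) * Q.eval x)
        ((-1 * (x - l) + (r - x) * 1) * Q.eval x + (r - x) * (x - l) * (derivative Q).eval x) x :=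
      (((hasDerivAt_id x).const_sub r).mul ((hasDerivAt_id x).sub_const l)).mul (Q.hasDerivAt x)
    have h3 : (fun x => G.eval r - G.eval x) = fun x => (r - x) * (x - l) * Q.eval x := funext hQ
    rw [h3] at h1
    have := h1.unique h2
    linarith
  have hsc2 : ∀ θ, Real.cos θ ^ 2 = 1 - Real.sin θ ^ 2 := fun θ => by
    rw [← Real.sin_sq_add_cos_sq θ]; ring
  have hprod : ∀ θ, (r - p θ) * (p θ - l) = w ^ 2 * Real.sin θ ^ 2 := fun θ => by
    have h1 : r - p θ = w * (1 - Real.cos θ) := by simp only [hp, hc, hw]; ring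
    have h2 : p θ - l = w * (1 + Real.cos θ) := by simp only [hp, hc, hw]; ring
    rw [h1, h2]
    linear_combination -w ^ 2 * hsc2 θ
  have hlin : ∀ θ, l + r - 2 * p θ = -(2 * w * Real.cos θ) := fun θ => by
    simp only [hp, hc]; ring
  obtain ⟨φ, hφmono, hφ0, hφd, hφsurj⟩ := exists_angle hsc hspos hsper
  have hφc : Continuous φ := continuous_iff_continuousAt.2 fun t => (hφd t).continuousAt
  set Y : ℝ → ℝ := fun t => -(w * Real.sin (φ t)) * s (φ t) with hY
  have hp0 : p 0 = r := by simp [hp, hc, hw]; ring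
  have hppi : p Real.pi = l := by simp [hp, hc, hw]; ring
  have hXd : ∀ t, HasDerivAt (fun t => p (φ t)) (Y t) t := fun t => (hpd (φ t)).comp t (hφd t)
  have hYd : ∀ t, HasDerivAt Y (-(derivative G).eval (p (φ t))) t := fun t => by
    have h1 := (((Real.hasDerivAt_sin (φ t)).comp t (hφd t)).const_mul w).neg.mul
      ((hsd (φ t)).comp t (hφd t))
    refine h1.congr_deriv ?_
    have h2 := (hspos (φ t)).ne'
    simp only [Function.comp_apply, Pi.neg_apply]
    rw [hG, hlin, hprod]
    field_simp
    linear_combination -Real.cos (φ t) * hssq (φ t)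
  have hstart : ∀ t, φ t = 2 * Real.pi ∨ φ t = -(2 * Real.pi) → p (φ t) = r ∧ Y t = 0 := by
    rintro t (ht | ht)
    · refine ⟨?_, by simp [hY, ht]⟩
      rw [← hp0, ht]; simp [hp]
    · refine ⟨?_, by simp [hY, ht]⟩
      rw [← hp0, ht]; simp [hp]
  obtain ⟨T₀, hT₀⟩ := hφsurj (2 * Real.pi)
  obtain ⟨T₁, hT₁⟩ := hφsurj (-(2 * Real.pi))
  have hT₀pos : 0 < T₀ := by
    rw [← hφmono.lt_iff_lt, hφ0, hT₀]; exact Real.two_pi_pos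
  have hT₁neg : T₁ < 0 := by
    rw [← hφmono.lt_iff_lt, hφ0, hT₁]; linarith [Real.two_pi_pos]
  set hh : ℝ[X] → ℝ → ℝ := fun F θ => F.eval (p θ) * (w ^ 2 * Real.sin θ ^ 2 * s θ) with hhh
  have hhc : ∀ F, Continuous (hh F) := fun F => by
    have := F.continuous.comp hpc
    exact this.mul (by fun_prop)
  have hseven : ∀ θ, s (-θ) = s θ := fun θ => by simp [hs, hp]
  have hint : ∀ F, ∫ θ in (0 : ℝ)..Real.pi, hh F θ = √2 * mel G F l r := fun F => by
    have h1 := intervalIntegral.integral_comp_mul_deriv (a := 0) (b := Real.pi) (f := p)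
      (f' := fun θ => -(w * Real.sin θ)) (g := fun x => F.eval x * √(G.eval r - G.eval x))
      (fun θ _ => hpd θ) (by fun_prop)
      (F.continuous.mul (continuous_const.sub G.continuous).sqrt)
    rw [hp0, hppi, intervalIntegral.integral_symm l r] at h1
    have h2 : mel G F l r = - ∫ θ in (0 : ℝ)..Real.pi,
        ((fun x => F.eval x * √(G.eval r - G.eval x)) ∘ p) θ * -(w * Real.sin θ) := by
      rw [h1, neg_neg, mel]
    rw [h2, ← intervalIntegral.integral_neg, ← intervalIntegral.integral_const_mul]
    refine intervalIntegral.integral_congr fun θ hθ => ?_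
    rw [Set.uIcc_of_le Real.pi_pos.le] at hθ
    have hsin : 0 ≤ w * Real.sin θ := mul_nonneg hw0.le (Real.sin_nonneg_of_mem_Icc hθ)
    have h3 : √2 * √(G.eval r - G.eval (p θ)) = w * Real.sin θ * s θ := by
      rw [← Real.sqrt_mul zero_le_two, hQ, hprod]
      have : 2 * (w ^ 2 * Real.sin θ ^ 2 * Q.eval (p θ)) =
          (w * Real.sin θ) ^ 2 * (2 * Q.eval (p θ)) := by ring
      rw [this, Real.sqrt_mul (sq_nonneg _), Real.sqrt_sq hsin]
    simp only [hhh, Function.comp_apply]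
    linear_combination -F.eval (p θ) * w * Real.sin θ * h3
  have hEn : ∀ t, Y t ^ 2 / 2 + G.eval (p (φ t)) = G.eval r := fun t => by
    have h1 := hQ (p (φ t))
    rw [hprod] at h1
    simp only [hY]
    linear_combination -h1 + w ^ 2 * Real.sin (φ t) ^ 2 / 2 * hssq (φ t)
  refine ⟨fun t => p (φ t), Y, T₀, T₁, hT₀pos, hT₁neg, hXd, hYd, ?_, ?_, (hstart _ (.inl hT₀)).1,
    (hstart _ (.inl hT₀)).2, (hstart _ (.inr hT₁)).1, (hstart _ (.inr hT₁)).2,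
    fun t => ⟨hpmem _, hEn t⟩, fun T hT hXT _ => ?_⟩
  · simp only [hφ0, hp0]
  · simp [hY, hφ0]
  have hcos : Real.cos (φ T) = 1 := by
    rw [← hp0] at hXT
    simp only [hp, Real.cos_zero, mul_one, add_right_inj] at hXT
    exact mul_left_cancel₀ hw0.ne' (hXT.trans (mul_one w).symm)
  obtain ⟨k, hk⟩ := (Real.cos_eq_one_iff _).1 hcos
  have hkT : 0 < k / T := by
    rcases lt_or_gt_of_ne hT with hneg | hpos
    · have h1 := hφmono hneg
      rw [hφ0, ← hk] at h1
      refine div_pos_of_neg_of_neg ?_ hneg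
      by_contra hc
      exact absurd h1 (not_lt.2 (mul_nonneg (not_lt.1 hc) Real.two_pi_pos.le))
    · have h1 := hφmono hpos
      rw [hφ0, ← hk] at h1
      exact div_pos (pos_of_mul_pos_left h1 Real.two_pi_pos.le) hpos
  refine ⟨k / T * (2 * √2), by positivity, fun F => ?_⟩
  have h1 := intervalIntegral.integral_comp_mul_left (a := 0) (b := 1)
    (fun t => F.eval (p (φ t)) * Y t ^ 2) hT
  simp only [mul_zero, mul_one, smul_eq_mul] at h1
  rw [h1]
  have h2 := intervalIntegral.integral_comp_mul_deriv (a := 0) (b := T) (f := φ)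
    (f' := fun t => s (φ t)) (g := hh F) (fun t _ => hφd t) (hsc.comp hφc).continuousOn (hhc F)
  rw [hφ0, ← hk, integral_even_periodic (hhc F)
    (fun θ => by simp only [hhh, hpper θ, hsper θ, Real.sin_add_two_pi])
    (fun θ => by simp only [hhh, hseven θ, hp, Real.sin_neg, Real.cos_neg, neg_sq]), hint] at h2
  have h3 : ∫ t in (0 : ℝ)..T, F.eval (p (φ t)) * Y t ^ 2 =
      ∫ t in (0 : ℝ)..T, (hh F ∘ φ) t * s (φ t) := by
    refine intervalIntegral.integral_congr fun t _ => ?_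
    simp only [hhh, hY, Function.comp_apply]
    ring
  rw [h3, h2]
  field_simp

lemma contDiff_eval (g : ℝ[X]) : ContDiff ℝ 1 fun x => g.eval x := by
  simpa using Polynomial.contDiff_aeval g (𝕜 := ℝ) 1

lemma contDiff_lienard (f g : ℝ[X]) (ε : ℝ) : ContDiff ℝ 1 (lienard f g ε) := by
  have hg : ContDiff ℝ 1 fun p : ℝ × ℝ => g.eval p.1 := contDiff_eval g |>.comp contDiff_fst
  have hf : ContDiff ℝ 1 fun p : ℝ × ℝ => f.eval p.1 := contDiff_eval f |>.comp contDiff_fst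
  unfold lienard
  fun_prop

lemma eqOn_of_hasDerivAt {V : ℝ × ℝ → ℝ × ℝ} (hV : ContDiff ℝ 1 V) {T : ℝ} {α β : ℝ → ℝ × ℝ}
    (hα : ∀ t ∈ Set.Icc (0 : ℝ) 1, HasDerivAt α (T • V (α t)) t)
    (hβ : ∀ t ∈ Set.Icc (0 : ℝ) 1, HasDerivAt β (T • V (β t)) t) (h0 : α 0 = β 0) :
    Set.EqOn α β (Set.Icc 0 1) := by
  have hαc : ContinuousOn α (Set.Icc 0 1) := fun t ht => (hα t ht).continuousAt.continuousWithinAt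
  have hβc : ContinuousOn β (Set.Icc 0 1) := fun t ht => (hβ t ht).continuousAt.continuousWithinAt
  obtain ⟨R, hR⟩ := ((isCompact_Icc.image_of_continuousOn hαc).union
    (isCompact_Icc.image_of_continuousOn hβc)).isBounded.subset_closedBall 0
  obtain ⟨K, hK⟩ := ContDiffOn.exists_lipschitzOnWith (n := 1)
    (hV.const_smul T).contDiffOn one_ne_zero
    (convex_closedBall (0 : ℝ × ℝ) R) (isCompact_closedBall 0 R)
  exact ODE_solution_unique_of_mem_Icc_right (v := fun _ p => T • V p)
    (s := fun _ => Metric.closedBall 0 R) (fun _ _ => hK) hαc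
    (fun t ht => (hα t ⟨ht.1, ht.2.le⟩).hasDerivWithinAt)
    (fun t ht => hR (.inl ⟨t, ⟨ht.1, ht.2.le⟩, rfl⟩)) hβc
    (fun t ht => (hβ t ⟨ht.1, ht.2.le⟩).hasDerivWithinAt)
    (fun t ht => hR (.inr ⟨t, ⟨ht.1, ht.2.le⟩, rfl⟩)) h0

lemma hasDerivAt_comp_affine {V : ℝ × ℝ → ℝ × ℝ} {γ : ℝ → ℝ × ℝ}
    (hγ : ∀ t, HasDerivAt γ (V (γ t)) t) (s T t : ℝ) :
    HasDerivAt (fun t => γ (s + T * t)) (T • V (γ (s + T * t))) t := by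
  have h : HasDerivAt (fun t : ℝ => s + T * t) T t := by
    simpa using ((hasDerivAt_id t).const_mul T).const_add s
  exact (hγ (s + T * t)).scomp t h

lemma eq_of_hasDerivAt {V : ℝ × ℝ → ℝ × ℝ} (hV : ContDiff ℝ 1 V) {α β : ℝ → ℝ × ℝ}
    (hα : ∀ t, HasDerivAt α (V (α t)) t) (hβ : ∀ t, HasDerivAt β (V (β t)) t) {s s' : ℝ}
    (h0 : α s = β s') (T : ℝ) : α (s + T) = β (s' + T) := by
  have := eqOn_of_hasDerivAt hV (T := T) (α := fun t => α (s + T * t))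
    (β := fun t => β (s' + T * t)) (fun t _ => hasDerivAt_comp_affine hα s T t)
    (fun t _ => hasDerivAt_comp_affine hβ s' T t) (by simpa using h0)
    (Set.right_mem_Icc.2 zero_le_one)
  simpa using this

/-- A solution of the arc equation is a trajectory of the Liénard system. -/
lemma exists_trajectory {f g : ℝ[X]} {a ε T : ℝ} {x y : Curve}
    (h : arcMap f g ((a, ε), ((x, y), T)) = 0) :
    ∃ γ : ℝ → ℝ × ℝ, (∀ t ∈ Set.Icc (0 : ℝ) 1, HasDerivAt γ (T • lienard f g ε (γ t)) t) ∧
      (∀ t : unitInterval, γ t = (x t, y t)) ∧ γ 0 = (a, 0) ∧ (γ 1).2 = 0 := by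
  have h1 : x - algebraMap ℝ Curve a - T • primitive y = 0 := congrArg (fun z => z.1.1) h
  have h2 : y + T • primitive (aeval x g + ε • (aeval x f * y)) = 0 := congrArg (fun z => z.1.2) h
  have h3 : y 1 = 0 := congrArg (fun z => z.2) h
  set k : Curve := aeval x g + ε • (aeval x f * y) with hk
  have hx : ∀ t : unitInterval, a + T * (∫ s in (0 : ℝ)..t, extend y s) = x t := fun t => by
    have e : (algebraMap ℝ Curve a) t = a := by simp
    have := congrArg (fun u : Curve => u t) h1
    simp only [e, ContinuousMap.sub_apply, ContinuousMap.smul_apply, smul_eq_mul, primitive_apply,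
      ContinuousMap.zero_apply] at this
    linarith
  have hy : ∀ t : unitInterval, -(T * (∫ s in (0 : ℝ)..t, extend k s)) = y t := fun t => by
    have := congrArg (fun u : Curve => u t) h2
    simp only [ContinuousMap.add_apply, ContinuousMap.smul_apply, smul_eq_mul, primitive_apply,
      ContinuousMap.zero_apply] at this
    linarith
  have hd : ∀ (u : Curve) (t : ℝ),
      HasDerivAt (fun t => ∫ s in (0 : ℝ)..t, extend u s) (extend u t) t := fun u t =>
    intervalIntegral.integral_hasDerivAt_right ((continuous_extend u).intervalIntegrable _ _)
      ((continuous_extend u).stronglyMeasurableAtFilter _ _) (continuous_extend u).continuousAt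
  set γ : ℝ → ℝ × ℝ := fun t => (a + T * (∫ s in (0 : ℝ)..t, extend y s),
    -(T * (∫ s in (0 : ℝ)..t, extend k s))) with hγ
  have hγt : ∀ t : unitInterval, γ t = (x t, y t) := fun t => by simp only [hγ, hx, hy]
  refine ⟨γ, fun t ht => ?_, hγt, by simp [hγ], ?_⟩
  · have e1 := ((hd y t).const_mul T).const_add a
    have e2 := ((hd k t).const_mul T).neg
    have := hγt ⟨t, ht⟩
    simp only at this
    refine (e1.prodMk e2).congr_deriv ?_
    rw [this, extend_of_mem _ ht, extend_of_mem _ ht]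
    simp only [lienard, hk, ContinuousMap.add_apply, ContinuousMap.smul_apply,
      ContinuousMap.mul_apply, Polynomial.aeval_continuousMap_apply, Prod.smul_mk, smul_eq_mul]
    refine Prod.ext rfl ?_
    simp only
    ring
  · have := hγt 1
    simp only [Set.Icc.coe_one] at this
    rw [this, h3]

/-- The integral of `φ(x) y²` along an arc. -/
noncomputable def dissip (φ : ℝ[X]) (z : (Curve × Curve) × ℝ) : ℝ :=
  evalOne (primitive (aeval z.1.1 φ * z.1.2 ^ 2))

lemma contDiff_dissip (φ : ℝ[X]) : ContDiff ℝ 1 (dissip φ) := by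
  have hx : ContDiff ℝ 1 (fun z : (Curve × Curve) × ℝ => z.1.1) := by fun_prop
  have hy : ContDiff ℝ 1 (fun z : (Curve × Curve) × ℝ => z.1.2) := by fun_prop
  exact evalOne.contDiff.comp (primitive.contDiff.comp
    (((contDiff_aeval_curve φ 1).comp hx).mul (hy.pow 2)))

lemma dissip_eq_integral (φ : ℝ[X]) {x y : Curve} {T : ℝ} {γ : ℝ → ℝ × ℝ}
    (hγ : ∀ t : unitInterval, γ t = (x t, y t)) :
    dissip φ ((x, y), T) = ∫ t in (0 : ℝ)..1, φ.eval (γ t).1 * (γ t).2 ^ 2 := by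
  rw [dissip, evalOne_apply, primitive_apply, Set.Icc.coe_one]
  refine intervalIntegral.integral_congr fun t ht => ?_
  rw [Set.uIcc_of_le zero_le_one] at ht
  have := hγ ⟨t, ht⟩
  simp only at this
  simp only [extend_of_mem _ ht, this, ContinuousMap.mul_apply, ContinuousMap.pow_apply,
    Polynomial.aeval_continuousMap_apply]

lemma energy_drop {f G : ℝ[X]} {a ε T : ℝ} {x y : Curve}
    (h : arcMap f (derivative G) ((a, ε), ((x, y), T)) = 0) :
    G.eval (x 1) - G.eval a = -(ε * T * dissip f ((x, y), T)) := by
  obtain ⟨γ, hγ, hγt, h0, h1⟩ := exists_trajectory h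
  rw [dissip_eq_integral f hγt, ← intervalIntegral.integral_const_mul,
    ← intervalIntegral.integral_neg]
  have hx1 : (γ 1).1 = x 1 := by
    have := hγt 1
    simp only [Set.Icc.coe_one] at this
    rw [this]
  have hd : ∀ t ∈ Set.uIcc (0 : ℝ) 1, HasDerivAt
      (fun t => (γ t).2 ^ 2 / 2 + G.eval (γ t).1)
      (-(ε * T * (f.eval (γ t).1 * (γ t).2 ^ 2))) t := fun t ht => by
    rw [Set.uIcc_of_le zero_le_one] at ht
    have e := hγ t ht
    have e1 : HasDerivAt (fun t => (γ t).1) (T * (γ t).2) t := e.fst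
    have e2 : HasDerivAt (fun t => (γ t).2)
      (T * (-((derivative G).eval (γ t).1) - ε * (f.eval (γ t).1) * (γ t).2)) t := e.snd
    refine (((e2.pow 2).div_const 2).add ((G.hasDerivAt (γ t).1).comp t e1)).congr_deriv ?_
    simp
    ring
  have hγc : ContinuousOn γ (Set.uIcc 0 1) := fun t ht => by
    rw [Set.uIcc_of_le zero_le_one] at ht
    exact (hγ t ht).continuousAt.continuousWithinAt
  have := intervalIntegral.integral_eq_sub_of_hasDerivAt hd (ContinuousOn.intervalIntegrable (by
    have := f.continuous
    fun_prop))
  rw [this, h0, h1, hx1]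
  simp

/-- The closed level curve over `[l, r]`. -/
def ovalSet (G : ℝ[X]) (l r : ℝ) : Set (ℝ × ℝ) :=
  {p | p.1 ∈ Set.Icc l r ∧ p.2 ^ 2 / 2 + G.eval p.1 = G.eval r}

lemma exists_growth {G : ℝ[X]} {r : ℝ} (h : 0 < (derivative G).eval r) :
    ∃ η > 0, ∃ c > 0, (∀ x ∈ Metric.ball r η, 0 < (derivative G).eval x) ∧
      ∀ x ∈ Metric.ball r η, ∀ y ∈ Metric.ball r η, c * |x - y| ≤ |G.eval x - G.eval y| ∧
        (G.eval x < G.eval y ↔ x < y) := by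
  set c := (derivative G).eval r / 2 with hc
  have hc0 : 0 < c := by positivity
  have hev : ∀ᶠ x in 𝓝 r, c < (derivative G).eval x :=
    (derivative G).continuous.continuousAt.eventually_const_lt (by rw [hc]; linarith)
  obtain ⟨η, hη, hball⟩ := Metric.eventually_nhds_iff_ball.1 hev
  have hkey : ∀ x ∈ Metric.ball r η, ∀ y ∈ Metric.ball r η, x ≤ y →
      c * (y - x) ≤ G.eval y - G.eval x := fun x hx y hy hxy =>
    (convex_ball r η).mul_sub_le_image_sub_of_le_deriv G.continuous.continuousOn
      G.differentiable.differentiableOn (fun z hz => by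
        rw [Polynomial.deriv]
        exact (hball z (interior_subset hz)).le) x hx y hy hxy
  refine ⟨η, hη, c, hc0, fun x hx => hc0.trans (hball x hx), fun x hx y hy => ⟨?_, ?_⟩⟩
  · rcases le_total x y with hxy | hxy
    · have h1 := hkey x hx y hy hxy
      rw [abs_sub_comm x, abs_sub_comm (G.eval x), abs_of_nonneg (sub_nonneg.2 hxy)]
      exact h1.trans (le_abs_self _)
    · have h1 := hkey y hy x hx hxy
      rw [abs_of_nonneg (sub_nonneg.2 hxy)]
      exact h1.trans (le_abs_self _)
  · constructor
    · intro hlt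
      by_contra hc
      have h1 := hkey y hy x hx (not_lt.1 hc)
      have h2 : 0 ≤ c * (x - y) := mul_nonneg hc0.le (sub_nonneg.2 (not_lt.1 hc))
      linarith
    · intro hlt
      have h1 := hkey x hx y hy hlt.le
      have h2 : 0 < c * (y - x) := mul_pos hc0 (sub_pos.2 hlt)
      linarith

/-- The family of arcs near a closed orbit of the Hamiltonian system. -/
theorem exists_arcs {G : ℝ[X]} {L : ℝ → ℝ} {r : ℝ} (f : ℝ[X])
    (hL : ∀ᶠ a in 𝓝 r, IsOval G (L a) a) {σ : ℝ} (hσ : σ ≠ 0) :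
    ∃ S : ℝ × ℝ → (Curve × Curve) × ℝ, ContDiffAt ℝ 1 S (r, 0) ∧ 0 < σ * (S (r, 0)).2 ∧
      (∀ t, ((S (r, 0)).1.1 t, (S (r, 0)).1.2 t) ∈ ovalSet G (L r) r) ∧
      (S (r, 0)).1.1 1 = r ∧
      (∀ᶠ p in 𝓝 ((r, 0) : ℝ × ℝ), arcMap f (derivative G) (p, S p) = 0) ∧
      ∀ᶠ a in 𝓝 r, ∃ κ : ℝ, 0 < κ ∧ ∀ φ : ℝ[X],
        dissip φ (S (a, 0)) = κ * mel G φ (L a) a := by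
  have hr := hL.self_of_nhds
  obtain ⟨X, Y, T₀, T₁, hT₀, hT₁, hX, hY, hX0, hY0, hXT₀, hYT₀, hXT₁, hYT₁, hE, -⟩ :=
    hr.exists_loop
  obtain ⟨T, hσT, hXT, hYT⟩ : ∃ T, 0 < σ * T ∧ X T = r ∧ Y T = 0 := by
    rcases lt_or_gt_of_ne hσ with h | h
    · exact ⟨T₁, mul_pos_of_neg_of_neg h hT₁, hXT₁, hYT₁⟩
    · exact ⟨T₀, mul_pos h hT₀, hXT₀, hYT₀⟩
  have hT0 : T ≠ 0 := by rintro rfl; simp at hσT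
  have hlin : ∀ t : ℝ, HasDerivAt (fun t => T * t) T t := fun t => by
    simpa using (hasDerivAt_id t).const_mul T
  have hloop : IsLoop (derivative G) (fun t => X (T * t)) (fun t => Y (T * t)) T :=
    { hasDerivAt_fst := fun t => by
        have := (hX (T * t)).comp t (hlin t)
        rwa [mul_comm] at this
      hasDerivAt_snd := fun t => by
        have := (hY (T * t)).comp t (hlin t)
        refine this.congr_deriv (by ring)
      fst_one := by simp [hXT, hX0]
      snd_zero := by simp [hY0]
      snd_one := by simp [hYT] }
  have hstart : X (T * 0) = r := by simp [hX0]
  obtain ⟨S, hS, hS0, hSarc⟩ := exists_arc_family f hloop (by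
    simp only [hstart]; exact hr.deriv_right.ne')
  simp only [hstart] at hS hS0 hSarc
  have hS1 : (S (r, 0)).1.1 1 = r := by
    rw [hS0]
    simp [restr, hXT]
  refine ⟨S, hS, by rw [hS0]; exact hσT, fun t => ?_, hS1, hSarc, ?_⟩
  · rw [hS0]
    exact hE _
  obtain ⟨η, hη, c, -, -, hmono⟩ := exists_growth hr.deriv_right
  have hι : ContinuousAt (fun a : ℝ => (a, (0 : ℝ))) r := by fun_prop
  have hSι : ContinuousAt (fun a => S (a, 0)) r :=
    ContinuousAt.comp (g := S) (f := fun a : ℝ => (a, (0 : ℝ))) hS.continuousAt hι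
  have hne : ∀ᶠ a in 𝓝 r, (S (a, 0)).2 ≠ 0 := by
    have : ContinuousAt (fun a => (S (a, 0)).2) r := hSι.snd
    exact this.eventually_ne (by rw [hS0]; exact hT0)
  have hx1 : ∀ᶠ a in 𝓝 r, (S (a, 0)).1.1 1 ∈ Metric.ball r η := by
    have h1 : ContinuousAt (fun a => evalOne (S (a, 0)).1.1) r :=
      evalOne.continuous.continuousAt.comp hSι.fst.fst
    refine h1.eventually_mem ?_
    rw [evalOne_apply, hS1]
    exact Metric.ball_mem_nhds r hη
  filter_upwards [hL, hι.eventually hSarc, hne, hx1, Metric.ball_mem_nhds r hη]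
    with a ha harc hTa hxa hball
  obtain ⟨X', Y', -, -, -, -, hX', hY', hX0', hY0', -, -, -, -, -, hκ⟩ := ha.exists_loop
  obtain ⟨γ, hγ, hγt, hγ0, hγ1⟩ := exists_trajectory harc
  have hdrop := energy_drop harc
  rw [zero_mul, zero_mul, neg_zero, sub_eq_zero] at hdrop
  have hx1a : (S (a, 0)).1.1 1 = a := by
    have h1 := (hmono _ hxa _ hball).2
    have h2 := (hmono _ hball _ hxa).2
    rw [hdrop, lt_self_iff_false, false_iff, not_lt] at h1 h2
    exact le_antisymm h2 h1
  set T' := (S (a, 0)).2 with hT'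
  have hV : ∀ t, HasDerivAt (fun t => (X' t, Y' t))
      (lienard f (derivative G) 0 (X' t, Y' t)) t := fun t => by
    refine ((hX' t).prodMk (hY' t)).congr_deriv ?_
    simp [lienard]
  have heq := eqOn_of_hasDerivAt (contDiff_lienard f (derivative G) 0) (T := T') (α := γ)
    (β := fun t => (X' (0 + T' * t), Y' (0 + T' * t))) hγ
    (fun t _ => hasDerivAt_comp_affine hV 0 T' t) (by simp [hγ0, hX0', hY0'])
  simp only [zero_add] at heq
  have hγone := hγt 1
  rw [Set.Icc.coe_one] at hγone
  have h1 := heq (Set.right_mem_Icc.2 zero_le_one)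
  simp only [mul_one] at h1
  rw [hγone] at h1
  obtain ⟨κ, hκpos, hκ⟩ := hκ T' hTa (by rw [← hx1a]; exact (congrArg Prod.fst h1).symm) 
    ((congrArg Prod.snd h1).symm.trans ((congrArg Prod.snd hγone).symm.trans hγ1))
  refine ⟨κ, hκpos, fun φ => ?_⟩
  rw [← hκ φ, show S (a, 0) = (((S (a, 0)).1.1, (S (a, 0)).1.2), T') from rfl,
    dissip_eq_integral φ hγt]
  refine intervalIntegral.integral_congr fun t ht => ?_
  rw [Set.uIcc_of_le zero_le_one] at ht
  simp only [heq ht]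

lemma mel_one_pos {G : ℝ[X]} {l r : ℝ} (h : IsOval G l r) : 0 < mel G 1 l r := by
  refine intervalIntegral.intervalIntegral_pos_of_pos_on ?_ (fun x hx => ?_) h.lt
  · exact (Continuous.intervalIntegrable (by have := G.continuous; fun_prop) _ _)
  · rw [eval_one, one_mul]
    exact Real.sqrt_pos.2 (sub_pos.2 (h.eval_lt x hx))

/-- The quotient of Melnikov integrals, as a function of the right end of the oval. -/
noncomputable def melQuot (G f : ℝ[X]) (L : ℝ → ℝ) (a : ℝ) : ℝ :=
  mel G f (L a) a / mel G 1 (L a) a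

lemma dissip_family {G : ℝ[X]} {L : ℝ → ℝ} {r : ℝ} {S : ℝ × ℝ → (Curve × Curve) × ℝ}
    (hL : ∀ᶠ a in 𝓝 r, IsOval G (L a) a)
    (h : ∀ᶠ a in 𝓝 r, ∃ κ : ℝ, 0 < κ ∧ ∀ φ : ℝ[X], dissip φ (S (a, 0)) = κ * mel G φ (L a) a)
    (f : ℝ[X]) : ∀ᶠ a in 𝓝 r, 0 < dissip 1 (S (a, 0)) ∧
      dissip f (S (a, 0)) = dissip 1 (S (a, 0)) * melQuot G f L a := by
  filter_upwards [hL, h] with a ha ⟨κ, hκ, hκ'⟩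
  have h1 := mel_one_pos ha
  rw [hκ', hκ', melQuot]
  exact ⟨mul_pos hκ h1, by field_simp⟩

lemma differentiableAt_dissip {r : ℝ} {S : ℝ × ℝ → (Curve × Curve) × ℝ}
    (hS : ContDiffAt ℝ 1 S (r, 0)) (f : ℝ[X]) :
    DifferentiableAt ℝ (fun a => dissip f (S (a, 0))) r := by
  have h1 : ContDiffAt ℝ 1 (fun p => dissip f (S p)) (r, 0) :=
    (contDiff_dissip f).contDiffAt.comp (r, 0) hS
  exact (h1.differentiableAt one_ne_zero).comp r
    (f := fun a : ℝ => (a, (0 : ℝ))) (by fun_prop)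

theorem differentiableAt_melQuot {G : ℝ[X]} {L : ℝ → ℝ} {r : ℝ} (f : ℝ[X])
    (hL : ∀ᶠ a in 𝓝 r, IsOval G (L a) a) : DifferentiableAt ℝ (melQuot G f L) r := by
  obtain ⟨S, hS, -, -, -, -, hκ⟩ := exists_arcs f hL one_ne_zero
  have h := dissip_family hL hκ f
  have h0 := h.self_of_nhds.1.ne'
  refine ((differentiableAt_dissip hS f).div (differentiableAt_dissip hS 1)
    h0).congr_of_eventuallyEq
    ?_
  filter_upwards [h] with a ha
  have := ha.1.ne'
  rw [Pi.div_apply, ha.2]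
  field_simp

/-- A closed arc extends to a periodic solution. -/
lemma exists_periodic {V : ℝ × ℝ → ℝ × ℝ} (hV : Continuous V) {T : ℝ} (hT : T ≠ 0)
    {γ : ℝ → ℝ × ℝ} (hγ : ∀ t ∈ Set.Icc (0 : ℝ) 1, HasDerivAt γ (T • V (γ t)) t)
    (h01 : γ 1 = γ 0) :
    ∃ u : ℝ → ℝ × ℝ, (∀ t, HasDerivAt u (V (u t)) t) ∧ Function.Periodic u |T| ∧ u 0 = γ 0 ∧
      Set.range u = γ '' Set.Icc 0 1 := by
  have hγc : ContinuousOn γ (Set.Icc 0 1) := fun t ht => (hγ t ht).continuousAt.continuousWithinAt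
  have hvc : Continuous fun t => γ (Int.fract t) := by
    refine ContinuousOn.comp_fract (f := fun _ : ℝ => γ) (s := fun t : ℝ => t) ?_ continuous_id ?_
    · exact hγc.comp continuousOn_snd fun p hp => hp.2
    · exact fun _ => h01.symm
  set k : ℝ → ℝ × ℝ := fun t => T • V (γ (Int.fract t)) with hk
  have hkc : Continuous k := (hV.comp hvc).const_smul T
  have hki : ∀ a b, IntervalIntegrable k MeasureTheory.volume a b := hkc.intervalIntegrable
  have hkper : Function.Periodic k 1 := fun t => by simp only [hk, Int.fract_add_one]
  have hkγ : ∀ t ∈ Set.Icc (0 : ℝ) 1, k t = T • V (γ t) := fun t ht => by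
    rcases ht.2.eq_or_lt with rfl | h
    · simp only [hk, Int.fract_one, h01]
    · simp only [hk, Int.fract_eq_self.2 ⟨ht.1, h⟩]
  set w : ℝ → ℝ × ℝ := fun t => γ 0 + ∫ s in (0 : ℝ)..t, k s with hw
  have hwd : ∀ t, HasDerivAt w (k t) t := fun t =>
    (intervalIntegral.integral_hasDerivAt_right (hki _ _) (hkc.stronglyMeasurableAtFilter _ _)
      hkc.continuousAt).const_add _
  have hwγ : ∀ t ∈ Set.Icc (0 : ℝ) 1, w t = γ t := fun t ht => by
    have hsub : Set.uIcc 0 t ⊆ Set.Icc (0 : ℝ) 1 := by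
      rw [Set.uIcc_of_le ht.1]; exact Set.Icc_subset_Icc_right ht.2
    have := intervalIntegral.integral_eq_sub_of_hasDerivAt (f := γ) (f' := k) (a := 0) (b := t)
      (fun s hs => by rw [hkγ s (hsub hs)]; exact hγ s (hsub hs)) (hki _ _)
    simp only [hw, this, add_sub_cancel]
  have hwper : Function.Periodic w 1 := fun t => by
    have h1 := hkper.intervalIntegral_add_eq t 0
    have h2 := intervalIntegral.integral_add_adjacent_intervals (hki 0 t) (hki t (t + 1))
    have h3 : ∫ s in (0 : ℝ)..0 + 1, k s = 0 := by
      have := hwγ 1 (Set.right_mem_Icc.2 zero_le_one)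
      rw [h01] at this
      simpa [hw] using this
    simp only [hw]
    rw [← h2, h1, h3, add_zero]
  have hwfract : ∀ t, w t = γ (Int.fract t) := fun t => by
    rw [← hwγ _ ⟨Int.fract_nonneg t, (Int.fract_lt_one t).le⟩]
    have := hwper.sub_int_mul_eq (x := t) ⌊t⌋
    rw [mul_one] at this
    rw [← this]; rfl
  have hwV : ∀ t, HasDerivAt w (T • V (w t)) t := fun t => by
    rw [hwfract]; exact hwd t
  refine ⟨fun t => w (T⁻¹ * t), fun t => ?_, fun t => ?_, ?_, ?_⟩
  · have h1 : HasDerivAt (fun t => T⁻¹ * t) T⁻¹ t := by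
      simpa using (hasDerivAt_id t).const_mul T⁻¹
    have := (hwV (T⁻¹ * t)).scomp t h1
    rwa [inv_smul_smul₀ hT] at this
  · simp only
    rcases abs_choice T with h | h
    · rw [h, mul_add, inv_mul_cancel₀ hT, hwper]
    · rw [h, mul_add, mul_neg, inv_mul_cancel₀ hT, ← sub_eq_add_neg, hwper.sub_eq]
  · simp [hw]
  · ext p
    constructor
    · rintro ⟨t, rfl⟩
      simp only [hwfract]
      exact ⟨_, ⟨Int.fract_nonneg _, (Int.fract_lt_one _).le⟩, rfl⟩
    · rintro ⟨t, ht, rfl⟩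
      exact ⟨T * t, by simp only [inv_mul_cancel_left₀ hT, hwγ t ht]⟩

/-- On a periodic orbit, the rightmost point lies on the axis and the restoring force is
nonnegative there. -/
lemma exists_rightmost {f g : ℝ[X]} {ε : ℝ} {u : ℝ → ℝ × ℝ} {T : ℝ} (hT : 0 < T)
    (hu : ∀ t, HasDerivAt u (lienard f g ε (u t)) t) (hper : Function.Periodic u T) :
    ∃ t₀, (u t₀).2 = 0 ∧ 0 ≤ g.eval (u t₀).1 := by
  have huc : Continuous u := continuous_iff_continuousAt.2 fun t => (hu t).continuousAt
  have hcomp : IsCompact (Set.range u) := hper.compact_of_continuous hT.ne' huc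
  obtain ⟨_, ⟨t₀, rfl⟩, hmax⟩ := hcomp.exists_isMaxOn (Set.range_nonempty u)
    continuous_fst.continuousOn
  have hmax' : ∀ t, (u t).1 ≤ (u t₀).1 := fun t => hmax ⟨t, rfl⟩
  have hx : ∀ t, HasDerivAt (fun t => (u t).1) (u t).2 t := fun t => (hu t).fst
  have hy : ∀ t, HasDerivAt (fun t => (u t).2)
    (-(g.eval (u t).1) - ε * (f.eval (u t).1) * (u t).2) t := fun t => (hu t).snd
  have hlocmax : IsLocalMax (fun t => (u t).1) t₀ := Eventually.of_forall hmax'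
  have hy0 : (u t₀).2 = 0 := hlocmax.hasDerivAt_eq_zero (hx t₀)
  refine ⟨t₀, hy0, ?_⟩
  by_contra hneg
  have hderiv : deriv (fun t => (u t).1) = fun t => (u t).2 := funext fun t => (hx t).deriv
  have hyd := hy t₀
  rw [hy0, mul_zero, sub_zero] at hyd
  have hmin : IsLocalMin (fun t => (u t).1) t₀ := by
    refine isLocalMin_of_deriv_deriv_pos ?_ ?_ (hx t₀).continuousAt
    · rw [hderiv, hyd.deriv]; linarith
    · rw [hderiv]; exact hy0
  have hconst : (fun t => (u t).1) =ᶠ[𝓝 t₀] fun _ => (u t₀).1 := by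
    filter_upwards [hmin] with t ht
    exact le_antisymm (hmax' t) ht
  have hzero : (fun t => (u t).2) =ᶠ[𝓝 t₀] fun _ => 0 := by
    filter_upwards [hconst.deriv] with t ht
    rw [hderiv] at ht
    simpa using ht
  have := hyd.unique ((hasDerivAt_const t₀ (0 : ℝ)).congr_of_eventuallyEq hzero)
  linarith

/-- A closed arc attracting the nearby arcs is a limit cycle. -/
theorem isLimitCycle_of_contraction {f g : ℝ[X]} {ε a ρ : ℝ} {T P : ℝ → ℝ}
    {γ : ℝ → ℝ → ℝ × ℝ}
    (hγ : ∀ b ∈ Metric.ball a ρ, ∀ t ∈ Set.Icc (0 : ℝ) 1,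
      HasDerivAt (γ b) (T b • lienard f g ε (γ b t)) t)
    (hγ0 : ∀ b ∈ Metric.ball a ρ, γ b 0 = (b, 0)) (hγ1 : ∀ b ∈ Metric.ball a ρ, γ b 1 = (P b, 0))
    (hρ : 0 < ρ) (hT : T a ≠ 0) (hga : g.eval a ≠ 0) (hPa : P a = a)
    (hP : ∀ b ∈ Metric.ball a ρ, b ≠ a → |P b - a| < |b - a|)
    (hU : ∀ t ∈ Set.Icc (0 : ℝ) 1,
      (γ a t).2 ≠ 0 ∨ (γ a t).1 ∈ Metric.ball a ρ ∨ g.eval (γ a t).1 < 0) :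
    IsLimitCycle (lienard f g ε) (γ a '' Set.Icc 0 1) := by
  have ha : a ∈ Metric.ball a ρ := Metric.mem_ball_self hρ
  have hV := contDiff_lienard f g ε
  obtain ⟨u, hu, huper, hu0, hur⟩ := exists_periodic hV.continuous hT (hγ a ha)
    (by rw [hγ0 a ha, hγ1 a ha, hPa])
  rw [hγ0 a ha] at hu0
  refine ⟨⟨u, hu, ⟨|T a|, abs_pos.2 hT, huper⟩, ?_, hur.symm⟩,
    {p | p.2 ≠ 0 ∨ p.1 ∈ Metric.ball a ρ ∨ g.eval p.1 < 0}, ?_, ?_, ?_⟩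
  · by_contra hcon
    push Not at hcon
    have h1 : u = fun _ => u 0 := funext fun t => hcon t 0
    have h2 := hu 0
    rw [h1] at h2
    have h3 := h2.unique (hasDerivAt_const (0 : ℝ) (u 0))
    rw [hu0] at h3
    have h4 := congrArg Prod.snd h3
    simp [lienard] at h4
    exact hga h4
  · exact (isOpen_ne.preimage continuous_snd).union
      ((Metric.isOpen_ball.preimage continuous_fst).union
        (isOpen_Iio.preimage (g.continuous.comp continuous_fst)))
  · rintro _ ⟨t, ht, rfl⟩
    exact hU t ht
  · rintro Γ' ⟨v, hv, ⟨T', hT', hvper⟩, -, rfl⟩ hsub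
    have hvc : Continuous v := continuous_iff_continuousAt.2 fun t => (hv t).continuousAt
    have hcomp : IsCompact (Set.range v) := hvper.compact_of_continuous hT'.ne' hvc
    obtain ⟨t₀, hy0, hg0⟩ := exists_rightmost hT' hv hvper
    have hmem : (v t₀).1 ∈ Metric.ball a ρ := by
      rcases hsub ⟨t₀, rfl⟩ with h | h | h
      · exact absurd hy0 h
      · exact h
      · exact absurd h (not_lt.2 hg0)
    set K : Set ℝ := (fun b : ℝ => (b, (0 : ℝ))) ⁻¹' Set.range v ∩
      Metric.closedBall a (dist (v t₀).1 a) with hK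
    have hKc : IsCompact K := (isCompact_closedBall _ _).inter_left
      (hcomp.isClosed.preimage (by fun_prop))
    have hKne : K.Nonempty := ⟨(v t₀).1, ⟨t₀, by rw [← hy0]⟩, Metric.mem_closedBall.2 le_rfl⟩
    obtain ⟨b, hb, hbmin⟩ := hKc.exists_isMinOn hKne (f := fun b => |b - a|)
      (by fun_prop)
    have hbball : b ∈ Metric.ball a ρ :=
      Metric.mem_ball.2 ((Metric.mem_closedBall.1 hb.2).trans_lt (Metric.mem_ball.1 hmem))
    obtain ⟨s, hs⟩ := hb.1
    have hba : b = a := by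
      by_contra hne
      have hlt := hP b hbball hne
      have heq := eqOn_of_hasDerivAt hV (hγ b hbball)
        (fun t _ => hasDerivAt_comp_affine hv s (T b) t) (by simp [hγ0 b hbball, hs])
        (Set.right_mem_Icc.2 zero_le_one)
      rw [hγ1 b hbball] at heq
      have hPK : P b ∈ K := by
        refine ⟨⟨_, heq.symm⟩, ?_⟩
        rw [Metric.mem_closedBall, Real.dist_eq]
        exact hlt.le.trans (by rw [← Real.dist_eq]; exact hb.2)
      exact absurd (hbmin hPK) (not_le.2 hlt)
    rw [← hur]
    have hvu : v s = u 0 := by rw [hs, hu0, hba]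
    ext p
    constructor
    · rintro ⟨t, rfl⟩
      refine ⟨0 + (t - s), ?_⟩
      rw [← eq_of_hasDerivAt hV hv hu hvu (t - s)]
      simp
    · rintro ⟨t, rfl⟩
      refine ⟨s + t, ?_⟩
      rw [eq_of_hasDerivAt hV hv hu hvu t]
      simp

lemma eventually_curve_mem {S : ℝ × ℝ → (Curve × Curve) × ℝ} {p₀ : ℝ × ℝ}
    (hS : ContinuousAt S p₀) {W : Set (ℝ × ℝ)} (hW : IsOpen W)
    (h : ∀ t, ((S p₀).1.1 t, (S p₀).1.2 t) ∈ W) :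
    ∀ᶠ p in 𝓝 p₀, ∀ t, ((S p).1.1 t, (S p).1.2 t) ∈ W := by
  have hK : IsCompact (Set.range fun t => ((S p₀).1.1 t, (S p₀).1.2 t)) :=
    isCompact_range ((S p₀).1.1.continuous.prodMk (S p₀).1.2.continuous)
  obtain ⟨δ, hδ, hsub⟩ := hK.exists_thickening_subset_open hW (Set.range_subset_iff.2 h)
  filter_upwards [hS.fst (Metric.ball_mem_nhds _ hδ)] with p hp t
  refine hsub (Metric.mem_thickening_iff.2 ⟨_, ⟨t, rfl⟩, ?_⟩)
  rw [Set.mem_preimage, Metric.mem_ball, Prod.dist_eq] at hp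
  refine lt_of_le_of_lt ?_ hp
  rw [Prod.dist_eq]
  exact max_le_max (ContinuousMap.dist_apply_le_dist t) (ContinuousMap.dist_apply_le_dist t)

/-- A simple zero of a `C¹` function of two variables in the first variable persists, with uniform
linear bounds. -/
lemma exists_zero_of_strict {θ : ℝ × ℝ → ℝ} {r m : ℝ} (hθ : ContDiffAt ℝ 1 θ (r, 0))
    (h0 : θ (r, 0) = 0) (hm : 0 < m) (hd : HasDerivAt (fun a => θ (a, 0)) m r) :
    ∀ᶠ δ in 𝓝[>] (0 : ℝ), ∀ δ' > 0, ∃ ε₁ > 0, ∀ ε, |ε| < ε₁ →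
      ∃ a ∈ Metric.ball r δ', θ (a, ε) = 0 ∧ ∀ b ∈ Metric.ball r δ,
        |θ (b, ε)| ≤ 2 * m * |b - a| ∧ (b < a → θ (b, ε) < 0) ∧ (a < b → 0 < θ (b, ε)) := by
  have hst : HasStrictFDerivAt θ (fderiv ℝ θ (r, 0)) (r, 0) := hθ.hasStrictFDerivAt one_ne_zero
  have hdm : fderiv ℝ θ (r, 0) (1, 0) = m := by
    have h1 : HasDerivAt (fun a : ℝ => (a, (0 : ℝ))) (1, 0) r :=
      (hasDerivAt_id r).prodMk (hasDerivAt_const r 0)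
    exact (hst.hasFDerivAt.comp_hasDerivAt r h1).unique hd
  obtain ⟨K, s, hs, hK⟩ := hst.exists_lipschitzOnWith
  have hlo := hst.isLittleO.def (show 0 < m / 2 by positivity)
  rw [nhds_prod_eq] at hlo
  obtain ⟨s', hs', hlo⟩ := mem_prod_self_iff.1 hlo
  obtain ⟨R, hR, hball⟩ := Metric.mem_nhds_iff.1 (inter_mem hs hs')
  have hbd : ∀ a b ε, |a - r| < R → |b - r| < R → |ε| < R →
      |θ (a, ε) - θ (b, ε) - m * (a - b)| ≤ m / 2 * |a - b| := fun a b ε ha hb hε => by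
    have hmem : ∀ a, |a - r| < R → (a, ε) ∈ s ∩ s' := fun a ha => hball (by
      rw [Metric.mem_ball, Prod.dist_eq]
      simpa [Real.dist_eq] using ⟨ha, hε⟩)
    have := hlo (Set.mk_mem_prod (hmem a ha).2 (hmem b hb).2)
    simp only [Set.mem_ofPred_eq, Prod.mk_sub_mk, sub_self] at this
    have e1 : ((a - b, 0) : ℝ × ℝ) = (a - b) • (1, 0) := by simp
    rw [e1, map_smul, hdm, norm_smul] at this
    simpa [mul_comm m, Real.norm_eq_abs] using this
  have hlip : ∀ a ε, |a - r| < R → |ε| < R → |θ (a, ε) - θ (a, 0)| ≤ K * |ε| :=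
    fun a ε ha hε => by
      have hmem : ∀ ε, |ε| < R → (a, ε) ∈ s := fun ε hε => (hball (by
        rw [Metric.mem_ball, Prod.dist_eq]
        simpa [Real.dist_eq] using ⟨ha, hε⟩)).1
      have := hK.dist_le_mul _ (hmem ε hε) _ (hmem 0 (by simpa using hR))
      rw [Prod.dist_eq] at this
      simpa [Real.dist_eq] using this
  filter_upwards [Ioo_mem_nhdsGT hR] with δ hδ δ' hδ'
  set d := min δ δ' / 2 with hdd
  have hd0 : 0 < d := half_pos (lt_min hδ.1 hδ')
  have hdδ : d < δ := (half_lt_self (lt_min hδ.1 hδ')).trans_le (min_le_left _ _)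
  have hdδ' : d < δ' := (half_lt_self (lt_min hδ.1 hδ')).trans_le (min_le_right _ _)
  have hdR : d < R := hdδ.trans hδ.2
  refine ⟨min R (m * d / 4 / (K + 1)), lt_min hR (by positivity), fun ε hε => ?_⟩
  have hεR := hε.trans_le (min_le_left _ _)
  have hεK : K * |ε| ≤ m * d / 4 := by
    have h1 := (lt_div_iff₀ (by positivity)).1 (hε.trans_le (min_le_right _ _))
    nlinarith [abs_nonneg ε]
  have hR0 : |(0 : ℝ)| < R := by simpa using hR
  have hrr : |r - r| < R := by simpa using hR
  have hpd : |r + d - r| < R := by rw [add_sub_cancel_left, abs_of_pos hd0]; exact hdR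
  have hmd : |r - d - r| < R := by
    rw [sub_sub_cancel_left, abs_neg, abs_of_pos hd0]; exact hdR
  have hright : 0 ≤ θ (r + d, ε) := by
    have h1 := abs_le.1 (hbd _ _ _ hpd hrr hR0)
    have h2 := abs_le.1 (hlip _ _ hpd hεR)
    rw [h0, add_sub_cancel_left, abs_of_pos hd0] at h1
    nlinarith
  have hleft : θ (r - d, ε) ≤ 0 := by
    have h1 := abs_le.1 (hbd _ _ _ hmd hrr hR0)
    have h2 := abs_le.1 (hlip _ _ hmd hεR)
    rw [h0, sub_sub_cancel_left, abs_neg, abs_of_pos hd0] at h1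
    nlinarith
  have hcont : ContinuousOn (fun a => θ (a, ε)) (Set.Icc (r - d) (r + d)) := by
    refine hK.continuousOn.comp (by fun_prop) fun a ha => (hball ?_).1
    have : |a - r| < R := by rw [abs_lt]; constructor <;> linarith [ha.1, ha.2]
    rw [Metric.mem_ball, Prod.dist_eq]
    simpa [Real.dist_eq] using ⟨this, hεR⟩
  obtain ⟨a, ha, ha0⟩ := intermediate_value_Icc (by linarith) hcont ⟨hleft, hright⟩
  have haδ : |a - r| < δ := by rw [abs_lt]; constructor <;> linarith [ha.1, ha.2]
  have haδ' : |a - r| < δ' := by rw [abs_lt]; constructor <;> linarith [ha.1, ha.2]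
  refine ⟨a, by rwa [Metric.mem_ball, Real.dist_eq], ha0, fun b hb => ?_⟩
  rw [Metric.mem_ball, Real.dist_eq] at hb
  have hba := hbd b a ε (hb.trans hδ.2) (haδ.trans hδ.2) hεR
  simp only at ha0
  rw [ha0, sub_zero] at hba
  refine ⟨?_, fun hlt => ?_, fun hlt => ?_⟩
  · have h1 := abs_sub_abs_le_abs_sub (θ (b, ε)) (m * (b - a))
    rw [abs_mul m, abs_of_pos hm] at h1
    nlinarith [mul_nonneg hm.le (abs_nonneg (b - a))]
  · rw [abs_of_neg (sub_neg.2 hlt)] at hba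
    nlinarith [(abs_le.1 hba).2]
  · rw [abs_of_pos (sub_pos.2 hlt)] at hba
    nlinarith [(abs_le.1 hba).1]

lemma IsOval.eq_or_eq {G : ℝ[X]} {l r x : ℝ} (h : IsOval G l r) (hx : x ∈ Set.Icc l r)
    (hG : G.eval x = G.eval r) : x = l ∨ x = r := by
  by_contra hne
  push Not at hne
  exact (h.eval_lt x ⟨lt_of_le_of_ne hx.1 (Ne.symm hne.1), lt_of_le_of_ne hx.2 hne.2⟩).ne hG

/-- A simple zero of the quotient of Melnikov integrals gives rise to a limit cycle. -/
theorem exists_limitCycle {G f : ℝ[X]} {L : ℝ → ℝ} {r d : ℝ}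
    (hL : ∀ᶠ a in 𝓝 r, IsOval G (L a) a) (h0 : melQuot G f L r = 0)
    (hd : HasDerivAt (melQuot G f L) d r) (hd0 : d ≠ 0) {V : Set (ℝ × ℝ)} (hV : IsOpen V)
    (hsub : ovalSet G (L r) r ⊆ V) :
    ∃ ε₀ > 0, ∀ ε, 0 < ε → ε ≤ ε₀ →
      ∃ Γ, IsLimitCycle (lienard f (derivative G) ε) Γ ∧ Γ ⊆ V := by
  have hr := hL.self_of_nhds
  obtain ⟨S, hS, hσ, hcurve, hx1, harc, hκ⟩ := exists_arcs f hL hd0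
  have hD := dissip_family hL hκ f
  set θ : ℝ × ℝ → ℝ := fun p => (S p).2 * dissip f (S p) with hθ
  have hθc : ContDiffAt ℝ 1 θ (r, 0) :=
    (contDiff_snd.contDiffAt.comp (r, 0) hS).mul ((contDiff_dissip f).contDiffAt.comp (r, 0) hS)
  set m := (S (r, 0)).2 * dissip 1 (S (r, 0)) * d with hm
  have hm0 : 0 < m := by
    have := mul_pos hσ hD.self_of_nhds.1
    rw [hm]; linarith
  have hθ0 : θ (r, 0) = 0 := by
    simp only [hθ]; rw [hD.self_of_nhds.2, h0, mul_zero, mul_zero]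
  have hθd : HasDerivAt (fun a => θ (a, 0)) m r := by
    have h1 : DifferentiableAt ℝ (fun a => (S (a, 0)).2) r :=
      (((contDiff_snd.contDiffAt.comp (r, 0) hS :
        ContDiffAt ℝ 1 (fun p => (S p).2) (r, 0))).differentiableAt one_ne_zero).comp r
        (f := fun a : ℝ => (a, (0 : ℝ))) (by fun_prop)
    have h2 := ((h1.mul (differentiableAt_dissip hS 1)).hasDerivAt).mul hd
    have h3 : (fun a => θ (a, 0)) =ᶠ[𝓝 r]
        ((fun a => (S (a, 0)).2) * fun a => dissip 1 (S (a, 0))) * melQuot G f L := by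
      filter_upwards [hD] with a ha
      simp only [hθ, Pi.mul_apply, ha.2]
      ring
    refine (h2.congr_of_eventuallyEq h3).congr_deriv ?_
    rw [h0]
    simp [hm]
  obtain ⟨η, hη, c, hc, hgpos, hgrow⟩ := exists_growth hr.deriv_right
  have hT : ∀ᶠ p in 𝓝 ((r, 0) : ℝ × ℝ), (S p).2 ≠ 0 :=
    hS.continuousAt.snd.eventually_ne (right_ne_zero_of_mul hσ.ne')
  have hend : ∀ᶠ p in 𝓝 ((r, 0) : ℝ × ℝ), (S p).1.1 1 ∈ Metric.ball r η := by
    have h1 : ContinuousAt (fun p => evalOne (S p).1.1) (r, 0) :=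
      evalOne.continuous.continuousAt.comp hS.continuousAt.fst.fst
    refine h1.eventually_mem ?_
    rw [evalOne_apply, hx1]
    exact Metric.ball_mem_nhds r hη
  obtain ⟨R, hR, hball⟩ := Metric.eventually_nhds_iff_ball.1 (harc.and (hT.and hend))
  have hI : ∀ᶠ δ in 𝓝[>] (0 : ℝ), δ ∈ Set.Ioo 0 (min R η) := Ioo_mem_nhdsGT (lt_min hR hη)
  obtain ⟨δ, ⟨hδ0, hδR⟩, hzero⟩ := (hI.and (exists_zero_of_strict hθc hθ0 hm0 hθd)).exists
  set W : Set (ℝ × ℝ) := V ∩ {p | p.2 ≠ 0 ∨ p.1 ∈ Metric.ball r (δ / 4) ∨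
    (derivative G).eval p.1 < 0} with hW
  have hWo : IsOpen W := hV.inter ((isOpen_ne.preimage continuous_snd).union
    ((Metric.isOpen_ball.preimage continuous_fst).union
      (isOpen_Iio.preimage ((derivative G).continuous.comp continuous_fst))))
  have hWsub : ∀ t, ((S (r, 0)).1.1 t, (S (r, 0)).1.2 t) ∈ W := fun t => by
    have ht := hcurve t
    refine ⟨hsub ht, ?_⟩
    by_cases hy : (S (r, 0)).1.2 t = 0
    · have h1 : G.eval ((S (r, 0)).1.1 t) = G.eval r := by
        have := ht.2
        simp only [hy] at this
        simpa using this
      rcases hr.eq_or_eq ht.1 h1 with h | h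
      · simp only at h
        refine .inr (.inr ?_)
        simp only [h]
        exact hr.deriv_left
      · simp only at h
        refine .inr (.inl ?_)
        simp only [h]
        exact Metric.mem_ball_self (by positivity)
    · exact .inl hy
  obtain ⟨R₂, hR₂, hball₂⟩ := Metric.eventually_nhds_iff_ball.1
    (eventually_curve_mem hS.continuousAt hWo hWsub)
  obtain ⟨ε₁, hε₁, hzero⟩ := hzero (min R₂ (δ / 4)) (lt_min hR₂ (by positivity))
  have hmemR : ∀ {b ε R' : ℝ}, |b - r| < R' → |ε| < R' → (b, ε) ∈ Metric.ball (r, (0 : ℝ)) R' :=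
    fun hb hε => by
      rw [Metric.mem_ball, Prod.dist_eq]
      simpa [Real.dist_eq] using ⟨hb, hε⟩
  refine ⟨min (min (ε₁ / 2) (min (R / 2) (R₂ / 2))) (c / (4 * m)), by positivity,
    fun ε hε hε₀ => ?_⟩
  have hεpos : |ε| = ε := abs_of_pos hε
  obtain ⟨⟨hεε₁, hεR, hεR₂⟩, hεc⟩ :
      (ε ≤ ε₁ / 2 ∧ ε ≤ R / 2 ∧ ε ≤ R₂ / 2) ∧ ε ≤ c / (4 * m) := by
    simpa only [le_min_iff] using hε₀
  obtain ⟨a, ha, ha0, hab⟩ := hzero ε (by rw [hεpos]; linarith)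
  rw [Metric.mem_ball, Real.dist_eq] at ha
  have haδ := ha.trans_le (min_le_right _ _)
  have haR₂ := ha.trans_le (min_le_left _ _)
  have hmin := hδR
  have hδR : δ < R := hmin.trans_le (min_le_left _ _)
  have hδη : δ < η := hmin.trans_le (min_le_right _ _)
  have hnear : ∀ b ∈ Metric.ball a (δ / 2), |b - r| < δ := fun b hb => by
    rw [Metric.mem_ball, Real.dist_eq] at hb
    have := abs_sub_le b a r
    linarith
  have hev : ∀ b ∈ Metric.ball a (δ / 2), arcMap f (derivative G) ((b, ε), S (b, ε)) = 0 ∧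
      (S (b, ε)).2 ≠ 0 ∧ (S (b, ε)).1.1 1 ∈ Metric.ball r η := fun b hb =>
    hball _ (hmemR ((hnear b hb).trans hδR) (by rw [hεpos]; linarith))
  have htraj : ∀ b, ∃ γ : ℝ → ℝ × ℝ, b ∈ Metric.ball a (δ / 2) →
      (∀ t ∈ Set.Icc (0 : ℝ) 1, HasDerivAt γ
        ((S (b, ε)).2 • lienard f (derivative G) ε (γ t)) t) ∧
      (∀ t : unitInterval, γ t = ((S (b, ε)).1.1 t, (S (b, ε)).1.2 t)) ∧
      γ 0 = (b, 0) ∧ (γ 1).2 = 0 := fun b => by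
    by_cases hb : b ∈ Metric.ball a (δ / 2)
    · obtain ⟨γ, h⟩ := exists_trajectory (hev b hb).1
      exact ⟨γ, fun _ => h⟩
    · exact ⟨0, fun h => absurd h hb⟩
  choose γ hγ using htraj
  have hγ1 : ∀ b ∈ Metric.ball a (δ / 2), γ b 1 = ((S (b, ε)).1.1 1, 0) := fun b hb => by
    have h1 := (hγ b hb).2.1 1
    rw [Set.Icc.coe_one] at h1
    rw [← (hγ b hb).2.2.2, h1]
  have hdrop : ∀ b ∈ Metric.ball a (δ / 2),
      G.eval ((S (b, ε)).1.1 1) - G.eval b = -(ε * θ (b, ε)) := fun b hb => by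
    rw [energy_drop (hev b hb).1]
    simp only [hθ]; ring
  have hbη : ∀ b ∈ Metric.ball a (δ / 2), b ∈ Metric.ball r η := fun b hb => by
    rw [Metric.mem_ball, Real.dist_eq]; exact (hnear b hb).trans hδη
  have haa : a ∈ Metric.ball a (δ / 2) := Metric.mem_ball_self (by positivity)
  have hPa : (S (a, ε)).1.1 1 = a := by
    have h1 := hdrop a haa
    rw [ha0, mul_zero, neg_zero] at h1
    have h2 := (hgrow _ (hev a haa).2.2 _ (hbη a haa)).1
    rw [h1, abs_zero] at h2
    have h3 := abs_nonneg ((S (a, ε)).1.1 1 - a)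
    have h4 : |(S (a, ε)).1.1 1 - a| = 0 := by
      rcases h3.eq_or_lt with h | h
      · exact h.symm
      · nlinarith
    exact sub_eq_zero.1 (abs_eq_zero.1 h4)
  have hP : ∀ b ∈ Metric.ball a (δ / 2), b ≠ a → |(S (b, ε)).1.1 1 - a| < |b - a| := by
    intro b hb hba
    have hbδ : b ∈ Metric.ball r δ := by
      rw [Metric.mem_ball, Real.dist_eq]; exact hnear b hb
    obtain ⟨hbd, hneg, hpos⟩ := hab b hbδ
    have h1 := hdrop b hb
    have h2 := hgrow _ (hev b hb).2.2 _ (hbη b hb)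
    have h3 := hgrow _ (hbη b hb) _ (hev b hb).2.2
    have hlt : |(S (b, ε)).1.1 1 - b| < |b - a| := by
      have h4 := h2.1
      rw [h1, abs_neg, abs_mul, hεpos] at h4
      have h5 : 0 < |b - a| := abs_pos.2 (sub_ne_zero.2 hba)
      have h6 : ε * |θ (b, ε)| ≤ c / (4 * m) * (2 * m * |b - a|) :=
        mul_le_mul hεc hbd (abs_nonneg _) (by positivity)
      have h7 : c / (4 * m) * (2 * m * |b - a|) = c * (|b - a| / 2) := by field_simp; ring
      rw [h7] at h6
      have h8 := le_of_mul_le_mul_left (h4.trans h6) hc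
      linarith
    rcases lt_or_gt_of_ne hba with hlt' | hgt
    · have h4 := hneg hlt'
      have h5 : b < (S (b, ε)).1.1 1 := by
        rw [← h3.2]
        nlinarith [mul_pos_of_neg_of_neg h4 (neg_neg_of_pos hε)]
      rw [abs_of_neg (sub_neg.2 hlt')] at hlt ⊢
      rw [abs_of_pos (sub_pos.2 h5)] at hlt
      rw [abs_lt]
      constructor <;> linarith
    · have h4 := hpos hgt
      have h5 : (S (b, ε)).1.1 1 < b := by
        rw [← h2.2]
        nlinarith [mul_pos h4 hε]
      rw [abs_of_pos (sub_pos.2 hgt)] at hlt ⊢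
      rw [abs_of_neg (sub_neg.2 h5)] at hlt
      rw [abs_lt]
      constructor <;> linarith
  have hmemW : ∀ t ∈ Set.Icc (0 : ℝ) 1, γ a t ∈ W := fun t ht => by
    have h1 := (hγ a haa).2.1 ⟨t, ht⟩
    simp only at h1
    rw [h1]
    exact hball₂ _ (hmemR haR₂ (by rw [hεpos]; linarith)) _
  refine ⟨_, isLimitCycle_of_contraction (a := a) (ρ := δ / 2) (γ := γ)
    (T := fun b => (S (b, ε)).2) (P := fun b => (S (b, ε)).1.1 1) (fun b hb => (hγ b hb).1)
    (fun b hb => (hγ b hb).2.2.1) hγ1 (by positivity) (hev a haa).2.1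
    (hgpos a (hbη a haa)).ne' hPa hP fun t ht => ?_, ?_⟩
  · rcases (hmemW t ht).2 with h | h | h
    · exact .inl h
    · refine .inr (.inl ?_)
      rw [Metric.mem_ball, Real.dist_eq] at h ⊢
      have := abs_sub_le (γ a t).1 r a
      rw [abs_sub_comm r a] at this
      linarith
    · exact .inr (.inr h)
  · rintro _ ⟨t, ht, rfl⟩
    exact (hmemW t ht).1

lemma mel_add (G f e : ℝ[X]) (l r : ℝ) : mel G (f + e) l r = mel G f l r + mel G e l r := by
  have hG := G.continuous
  have hf := f.continuous
  have he := e.continuous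
  rw [mel, mel, mel, ← intervalIntegral.integral_add]
  · exact intervalIntegral.integral_congr fun x _ => by simp only [eval_add]; ring
  · exact Continuous.intervalIntegrable (by fun_prop) _ _
  · exact Continuous.intervalIntegrable (by fun_prop) _ _

lemma mel_C_mul (G f : ℝ[X]) (c l r : ℝ) : mel G (C c * f) l r = c * mel G f l r := by
  rw [mel, mel, ← intervalIntegral.integral_const_mul]
  exact intervalIntegral.integral_congr fun x _ => by simp only [eval_mul, eval_C]; ring

lemma continuous_mel (G f : ℝ[X]) : Continuous fun p : ℝ × ℝ => mel G f p.1 p.2 := by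
  have hG := G.continuous
  have hf := f.continuous
  have hint : ∀ a b r : ℝ, IntervalIntegrable (fun x => f.eval x * √(G.eval r - G.eval x))
      MeasureTheory.volume a b := fun a b r => Continuous.intervalIntegrable (by fun_prop) _ _
  have hcont : Continuous (Function.uncurry
      fun (p : ℝ × ℝ) (x : ℝ) => f.eval x * √(G.eval p.2 - G.eval x)) := by
    unfold Function.uncurry
    fun_prop
  have h1 := intervalIntegral.continuous_parametric_intervalIntegral_of_continuous
    (μ := MeasureTheory.volume) (a₀ := 0) hcont continuous_snd
  have h2 := intervalIntegral.continuous_parametric_intervalIntegral_of_continuous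
    (μ := MeasureTheory.volume) (a₀ := 0) hcont continuous_fst
  refine (h1.sub h2).congr fun p => ?_
  rw [mel, Pi.sub_apply, intervalIntegral.integral_interval_sub_left (hint _ _ _) (hint _ _ _)]

/-- A monotone family of closed level curves, between the ones over `[l₁, r₁]` and `[l₂, r₂]`,
at the ends of which the Melnikov integral of `f` has opposite signs. -/
structure SignChange (G f : ℝ[X]) (l₂ l₁ r₁ r₂ : ℝ) : Prop where
  left_lt : l₂ < l₁
  right_lt : r₁ < r₂
  inner : IsOval G l₁ r₁
  outer : IsOval G l₂ r₂
  deriv_neg : ∀ x ∈ Set.Icc l₂ l₁, (derivative G).eval x < 0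
  deriv_pos : ∀ x ∈ Set.Icc r₁ r₂, 0 < (derivative G).eval x
  mel_mul_neg : mel G f l₁ r₁ * mel G f l₂ r₂ < 0

lemma strictAntiOn_eval {G : ℝ[X]} {a b : ℝ}
    (h : ∀ x ∈ Set.Icc a b, (derivative G).eval x < 0) :
    StrictAntiOn (fun x => G.eval x) (Set.Icc a b) :=
  strictAntiOn_of_deriv_neg (convex_Icc a b) G.continuous.continuousOn fun x hx => by
    rw [G.deriv]; exact h x (interior_subset hx)

lemma strictMonoOn_eval {G : ℝ[X]} {a b : ℝ}
    (h : ∀ x ∈ Set.Icc a b, 0 < (derivative G).eval x) :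
    StrictMonoOn (fun x => G.eval x) (Set.Icc a b) :=
  strictMonoOn_of_deriv_pos (convex_Icc a b) G.continuous.continuousOn fun x hx => by
    rw [G.deriv]; exact h x (interior_subset hx)

lemma IsOval.expand {G : ℝ[X]} {l₁ r₁ l r : ℝ} (h : IsOval G l₁ r₁) (hl : l ≤ l₁) (hr : r₁ ≤ r)
    (hneg : ∀ x ∈ Set.Icc l l₁, (derivative G).eval x < 0)
    (hpos : ∀ x ∈ Set.Icc r₁ r, 0 < (derivative G).eval x) (heq : G.eval l = G.eval r) :
    IsOval G l r where
  lt := hl.trans_lt (h.lt.trans_le hr)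
  eval_eq := heq
  eval_lt x hx := by
    rcases le_or_gt x l₁ with h1 | h1
    · rw [← heq]
      exact strictAntiOn_eval hneg ⟨le_rfl, hl⟩ ⟨hx.1.le, h1⟩ hx.1
    · rcases le_or_gt r₁ x with h2 | h2
      · exact strictMonoOn_eval hpos ⟨h2, hx.2.le⟩ ⟨hr, le_rfl⟩ hx.2
      · exact (h.eval_lt x ⟨h1, h2⟩).trans_le
          ((strictMonoOn_eval hpos).monotoneOn ⟨le_rfl, hr⟩ ⟨hr, le_rfl⟩ hr)
  deriv_left := hneg l ⟨le_rfl, hl⟩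
  deriv_right := hpos r ⟨hr, le_rfl⟩

lemma eventually_mul_neg {X : Type*} {F : Filter X} {a b : X → ℝ} {x y : ℝ} (hx : Tendsto a F (𝓝 x))
    (hxy : x * y < 0) (hb : Tendsto b F (𝓝 y)) : ∀ᶠ t in F, a t * b t < 0 :=
  (hx.mul hb).eventually (gt_mem_nhds hxy)

namespace SignChange

variable {G f : ℝ[X]} {l₂ l₁ r₁ r₂ : ℝ}

lemma exists_left (h : SignChange G f l₂ l₁ r₁ r₂) :
    ∃ L : ℝ → ℝ, ∀ r ∈ Set.Icc r₁ r₂, L r ∈ Set.Icc l₂ l₁ ∧ G.eval (L r) = G.eval r := by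
  have hm := (strictMonoOn_eval h.deriv_pos).monotoneOn
  have key : ∀ r, ∃ l, r ∈ Set.Icc r₁ r₂ → l ∈ Set.Icc l₂ l₁ ∧ G.eval l = G.eval r := fun r => by
    by_cases hr : r ∈ Set.Icc r₁ r₂
    · obtain ⟨l, hl, hl'⟩ := intermediate_value_Icc' h.left_lt.le G.continuous.continuousOn
        (show G.eval r ∈ Set.Icc (G.eval l₁) (G.eval l₂) from
          ⟨h.inner.eval_eq ▸ hm ⟨le_rfl, h.right_lt.le⟩ hr hr.1,
            h.outer.eval_eq ▸ hm hr ⟨h.right_lt.le, le_rfl⟩ hr.2⟩)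
      exact ⟨l, fun _ => ⟨hl, hl'⟩⟩
    · exact ⟨0, fun h' => absurd h' hr⟩
  choose L hL using key
  exact ⟨L, hL⟩

lemma isOval (h : SignChange G f l₂ l₁ r₁ r₂) {l r : ℝ} (hr : r ∈ Set.Icc r₁ r₂)
    (hl : l ∈ Set.Icc l₂ l₁) (heq : G.eval l = G.eval r) : IsOval G l r :=
  h.inner.expand hl.2 hr.1 (fun x hx => h.deriv_neg x ⟨hl.1.trans hx.1, hx.2⟩)
    (fun x hx => h.deriv_pos x ⟨hx.1, hx.2.trans hr.2⟩) heq

/-- The quotient of Melnikov integrals changes sign in the interior of the family. -/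
lemma exists_melQuot (h : SignChange G f l₂ l₁ r₁ r₂) :
    ∃ (L : ℝ → ℝ) (s₁ s₂ : ℝ), r₁ < s₁ ∧ s₁ < s₂ ∧ s₂ < r₂ ∧
      (∀ a ∈ Set.Ioo r₁ r₂, IsOval G (L a) a) ∧ melQuot G f L s₁ * melQuot G f L s₂ < 0 := by
  obtain ⟨L, hL⟩ := h.exists_left
  have hanti := strictAntiOn_eval h.deriv_neg
  have hG := G.continuous
  have hleft : Tendsto L (𝓝[>] r₁) (𝓝 l₁) := by
    refine tendsto_order.2 ⟨fun b hb => ?_, fun b hb => ?_⟩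
    · have hmax : max b l₂ < l₁ := max_lt hb h.left_lt
      have h1 : G.eval r₁ < G.eval (max b l₂) := by
        rw [← h.inner.eval_eq]
        exact hanti ⟨le_max_right _ _, hmax.le⟩ ⟨h.left_lt.le, le_rfl⟩ hmax
      filter_upwards [nhdsWithin_le_nhds (hG.continuousAt.eventually (gt_mem_nhds h1)),
        Ioo_mem_nhdsGT h.right_lt] with r hr hr'
      obtain ⟨h2, h3⟩ := hL r ⟨hr'.1.le, hr'.2.le⟩
      rw [← h3] at hr
      refine (le_max_left b l₂).trans_lt (lt_of_not_ge fun hle => ?_)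
      exact hr.not_ge (hanti.antitoneOn h2 ⟨le_max_right _ _, hmax.le⟩ hle)
    · filter_upwards [Ioo_mem_nhdsGT h.right_lt] with r hr
      exact (hL r ⟨hr.1.le, hr.2.le⟩).1.2.trans_lt hb
  have hright : Tendsto L (𝓝[<] r₂) (𝓝 l₂) := by
    refine tendsto_order.2 ⟨fun b hb => ?_, fun b hb => ?_⟩
    · filter_upwards [Ioo_mem_nhdsLT h.right_lt] with r hr
      exact hb.trans_le (hL r ⟨hr.1.le, hr.2.le⟩).1.1
    · have hmin : l₂ < min b l₁ := lt_min hb h.left_lt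
      have h1 : G.eval (min b l₁) < G.eval r₂ := by
        rw [← h.outer.eval_eq]
        exact hanti ⟨le_rfl, h.left_lt.le⟩ ⟨hmin.le, min_le_right _ _⟩ hmin
      filter_upwards [nhdsWithin_le_nhds (hG.continuousAt.eventually (lt_mem_nhds h1)),
        Ioo_mem_nhdsLT h.right_lt] with r hr hr'
      obtain ⟨h2, h3⟩ := hL r ⟨hr'.1.le, hr'.2.le⟩
      rw [← h3] at hr
      refine (lt_of_not_ge fun hle => ?_ : L r < min b l₁).trans_le (min_le_left _ _)
      exact hr.not_ge (hanti.antitoneOn ⟨hmin.le, min_le_right _ _⟩ h2 hle)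
  have hm₁ : Tendsto (fun r => mel G f (L r) r) (𝓝[>] r₁) (𝓝 (mel G f l₁ r₁)) :=
    ((continuous_mel G f).tendsto (l₁, r₁)).comp
      (hleft.prodMk_nhds (tendsto_id.mono_left nhdsWithin_le_nhds))
  have hm₂ : Tendsto (fun r => mel G f (L r) r) (𝓝[<] r₂) (𝓝 (mel G f l₂ r₂)) :=
    ((continuous_mel G f).tendsto (l₂, r₂)).comp
      (hright.prodMk_nhds (tendsto_id.mono_left nhdsWithin_le_nhds))
  have hmid : r₁ < (r₁ + r₂) / 2 ∧ (r₁ + r₂) / 2 < r₂ := by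
    have := h.right_lt
    constructor <;> linarith
  obtain ⟨s₁, hs₁, hs₁'⟩ := ((eventually_mul_neg hm₁ h.mel_mul_neg tendsto_const_nhds).and
    (Ioo_mem_nhdsGT hmid.1)).exists
  have hneg : mel G f (L s₁) s₁ * mel G f l₂ r₂ < 0 := hs₁
  obtain ⟨s₂, hs₂, hs₂'⟩ := ((eventually_mul_neg tendsto_const_nhds hneg hm₂).and
    (Ioo_mem_nhdsLT hmid.2)).exists
  have hov : ∀ a ∈ Set.Ioo r₁ r₂, IsOval G (L a) a := fun a ha =>
    h.isOval ⟨ha.1.le, ha.2.le⟩ (hL a ⟨ha.1.le, ha.2.le⟩).1 (hL a ⟨ha.1.le, ha.2.le⟩).2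
  refine ⟨L, s₁, s₂, hs₁'.1, hs₁'.2.trans hs₂'.1, hs₂'.2, hov, ?_⟩
  rw [melQuot, melQuot, div_mul_div_comm]
  exact div_neg_of_neg_of_pos hs₂ (mul_pos
    (mel_one_pos (hov s₁ ⟨hs₁'.1, hs₁'.2.trans hmid.2⟩))
    (mel_one_pos (hov s₂ ⟨hmid.1.trans hs₂'.1, hs₂'.2⟩)))

end SignChange

lemma volume_criticalValues {q : ℝ → ℝ} {s : Set ℝ} (hq : ∀ x ∈ s, DifferentiableAt ℝ q x) :
    MeasureTheory.volume (q '' {x ∈ s | deriv q x = 0}) = 0 := by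
  refine MeasureTheory.addHaar_image_eq_zero_of_det_fderivWithin_eq_zero _
    (f' := fun x => fderiv ℝ q x) (fun x hx => (hq x hx.1).hasFDerivAt.hasFDerivWithinAt)
    fun x hx => ?_
  rw [← toSpanSingleton_deriv, hx.2]
  simp

/-- Finitely many differentiable functions that change sign can be made to have simple zeros
by subtracting a common constant. -/
lemma exists_const_simple_zeros {ι : Type*} [Finite ι] {q : ι → ℝ → ℝ} {s₁ s₂ : ι → ℝ}
    (hs : ∀ i, s₁ i < s₂ i) (hq : ∀ i, ∀ x ∈ Set.Icc (s₁ i) (s₂ i), DifferentiableAt ℝ (q i) x)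
    (hneg : ∀ i, q i (s₁ i) * q i (s₂ i) < 0) :
    ∃ c : ℝ, ∀ i, ∃ x ∈ Set.Ioo (s₁ i) (s₂ i), q i x = c ∧ deriv (q i) x ≠ 0 := by
  have hdense : Dense {c : ℝ | ∀ i, c ∉ q i '' {x ∈ Set.Icc (s₁ i) (s₂ i) | deriv (q i) x = 0}} :=
    MeasureTheory.Measure.dense_of_ae (μ := MeasureTheory.volume)
      (MeasureTheory.ae_all_iff.2 fun i => MeasureTheory.measure_eq_zero_iff_ae_notMem.1
        (volume_criticalValues (hq i)))
  have hev : ∀ᶠ c in 𝓝 (0 : ℝ), ∀ i, (q i (s₁ i) - c) * (q i (s₂ i) - c) < 0 :=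
    eventually_all.2 fun i => by
      have h : Continuous fun c : ℝ => (q i (s₁ i) - c) * (q i (s₂ i) - c) := by fun_prop
      exact h.continuousAt.eventually (gt_mem_nhds (by simpa using hneg i))
  obtain ⟨c, hc, hc'⟩ := hdense.inter_nhds_nonempty hev
  refine ⟨c, fun i => ?_⟩
  have hcont : ContinuousOn (q i) (Set.Icc (s₁ i) (s₂ i)) := fun x hx =>
    (hq i x hx).continuousAt.continuousWithinAt
  have hex : ∃ x ∈ Set.Ioo (s₁ i) (s₂ i), q i x = c := by
    rcases mul_neg_iff.1 (hc' i) with ⟨h1, h2⟩ | ⟨h1, h2⟩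
    · exact intermediate_value_Ioo' (hs i).le hcont ⟨sub_neg.1 h2, sub_pos.1 h1⟩
    · exact intermediate_value_Ioo (hs i).le hcont ⟨sub_neg.1 h1, sub_pos.1 h2⟩
  obtain ⟨x, hx, hxc⟩ := hex
  exact ⟨x, hx, hxc, fun h0 => hc i ⟨x, ⟨Set.Ioo_subset_Icc_self hx, h0⟩, hxc⟩⟩

lemma isCompact_ovalSet (G : ℝ[X]) (l r : ℝ) : IsCompact (ovalSet G l r) := by
  have hG := G.continuous
  obtain ⟨m, hm⟩ := isCompact_Icc.bddBelow_image (K := Set.Icc l r) hG.continuousOn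
  have hclosed : IsClosed (ovalSet G l r) :=
    (isClosed_Icc.preimage continuous_fst).inter (isClosed_eq (by fun_prop) continuous_const)
  refine (isCompact_Icc.prod (isCompact_Icc (a := -(G.eval r - m + 1))
    (b := G.eval r - m + 1))).of_isClosed_subset hclosed fun p hp => ⟨hp.1, ?_⟩
  have h1 := hm ⟨p.1, hp.1, rfl⟩
  have h2 := hp.2
  rw [Set.mem_Icc, ← abs_le]
  simp only at h1
  refine abs_le_of_sq_le_sq ?_ ?_ <;> nlinarith [sq_nonneg (G.eval r - m), sq_nonneg p.2]

lemma disjoint_ovalSet_of_lt {G : ℝ[X]} {l r l' r' : ℝ} (h : IsOval G l r) (h' : IsOval G l' r')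
    (hlt : r < r') : Disjoint (ovalSet G l r) (ovalSet G l' r') := by
  refine Set.disjoint_left.2 fun p hp hp' => ?_
  have h1 : G.eval r = G.eval r' := hp.2.symm.trans hp'.2
  rcases h'.eq_or_eq ⟨hp'.1.1.trans hp.1.2, hlt.le⟩ h1 with h2 | h2
  · have := h.deriv_right
    rw [h2] at this
    exact this.not_gt h'.deriv_left
  · exact hlt.ne h2

lemma disjoint_ovalSet {G : ℝ[X]} {l r l' r' : ℝ} (h : IsOval G l r) (h' : IsOval G l' r')
    (hne : r ≠ r') : Disjoint (ovalSet G l r) (ovalSet G l' r') := by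
  rcases lt_or_gt_of_ne hne with hlt | hlt
  · exact disjoint_ovalSet_of_lt h h' hlt
  · exact (disjoint_ovalSet_of_lt h' h hlt).symm

lemma melQuot_sub_C {G : ℝ[X]} {L : ℝ → ℝ} {a : ℝ} (h : IsOval G (L a) a) (f : ℝ[X]) (c : ℝ) :
    melQuot G (f - C c) L a = melQuot G f L a - c := by
  have h1 : f - C c = f + C (-c) * 1 := by rw [C_neg]; ring
  have h2 := (mel_one_pos h).ne'
  rw [melQuot, melQuot, h1, mel_add, mel_C_mul]
  field_simp
  ring

/-- Sign changes of the Melnikov integral in disjoint families of closed level curves give rise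
to as many limit cycles. -/
theorem HGe_of_signChange {G f : ℝ[X]} {n m : ℕ} {ι : Type*} [Fintype ι] {l₂ l₁ r₁ r₂ : ι → ℝ}
    (hf : f.natDegree ≤ n) (hG : G.natDegree ≤ m + 1)
    (h : ∀ i, SignChange G f (l₂ i) (l₁ i) (r₁ i) (r₂ i))
    (hdisj : Pairwise fun i j => Disjoint (Set.Ioo (r₁ i) (r₂ i)) (Set.Ioo (r₁ j) (r₂ j))) :
    HGe n m (Fintype.card ι) := by
  classical
  choose L s₁ s₂ hs₁ hs hs₂ hov hneg using fun i => (h i).exists_melQuot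
  have hnear : ∀ i, ∀ x ∈ Set.Ioo (r₁ i) (r₂ i), ∀ᶠ a in 𝓝 x, IsOval G (L i a) a :=
    fun i x hx => (isOpen_Ioo.eventually_mem hx).mono (hov i)
  obtain ⟨c, hc⟩ := exists_const_simple_zeros hs (fun i x hx => differentiableAt_melQuot f
    (hnear i x ⟨(hs₁ i).trans_le hx.1, hx.2.trans_lt (hs₂ i)⟩)) hneg
  choose x hx hxc hxd using hc
  have hxI : ∀ i, x i ∈ Set.Ioo (r₁ i) (r₂ i) := fun i =>
    ⟨(hs₁ i).trans (hx i).1, (hx i).2.trans (hs₂ i)⟩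
  have hxne : ∀ i j, i ≠ j → x i ≠ x j := fun i j hij heq =>
    Set.disjoint_left.1 (hdisj hij) (hxI i) (heq ▸ hxI j)
  have hxo : ∀ i, IsOval G (L i (x i)) (x i) := fun i => hov i _ (hxI i)
  obtain ⟨V, hV, hVd⟩ := Pairwise.exists_mem_filter_of_disjoint
    (l := fun i => 𝓝ˢ (ovalSet G (L i (x i)) (x i))) fun i j hij =>
      (SeparatedNhds.of_isCompact_isCompact (isCompact_ovalSet _ _ _) (isCompact_ovalSet _ _ _)
        (disjoint_ovalSet (hxo i) (hxo j) (hxne i j hij))).disjoint_nhdsSet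
  have hcycle : ∀ i, ∃ ε₀ > 0, ∀ ε, 0 < ε → ε ≤ ε₀ →
      ∃ Γ, IsLimitCycle (lienard (f - C c) (derivative G) ε) Γ ∧ Γ ⊆ V i := fun i => by
    obtain ⟨U, hU, hsub, hUV⟩ := mem_nhdsSet_iff_exists.1 (hV i)
    have hq : melQuot G (f - C c) (L i) =ᶠ[𝓝 (x i)] fun a => melQuot G f (L i) a - c :=
      (hnear i _ (hxI i)).mono fun a ha => melQuot_sub_C ha f c
    obtain ⟨ε₀, hε₀, hΓ⟩ := exists_limitCycle (hnear i _ (hxI i))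
      (by rw [melQuot_sub_C (hxo i), hxc i, sub_self])
      (((differentiableAt_melQuot f (hnear i _ (hxI i))).hasDerivAt.sub_const
        c).congr_of_eventuallyEq
        hq) (hxd i) hU hsub
    exact ⟨ε₀, hε₀, fun ε h1 h2 => (hΓ ε h1 h2).imp fun Γ hΓ => ⟨hΓ.1, hΓ.2.trans hUV⟩⟩
  choose ε₀ hε₀ hcycle using hcycle
  obtain ⟨ε₁, hε₁, hle⟩ : ∃ ε₁ > 0, ∀ i, ε₁ ≤ ε₀ i := by
    rcases isEmpty_or_nonempty ι with hι | hι
    · exact ⟨1, one_pos, fun i => hι.elim i⟩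
    · obtain ⟨i₀, hi₀⟩ := Finite.exists_min ε₀
      exact ⟨ε₀ i₀, hε₀ i₀, hi₀⟩
  refine ⟨f - C c, derivative G, by simpa using hf, ?_, ε₁, hε₁, fun ε hε hεε₁ => ?_⟩
  · have := natDegree_derivative_le G
    omega
  choose Γ hΓ hΓV using fun i => hcycle i ε hε (hεε₁.trans (hle i))
  have hinj : Function.Injective Γ := fun i j hij => by
    by_contra hne
    obtain ⟨⟨γ, -, -, -, hγ⟩, -⟩ := hΓ i
    have hmem : γ 0 ∈ Γ i := hγ ▸ Set.mem_range_self 0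
    exact Set.disjoint_left.1 (hVd hne) (hΓV i hmem) (hΓV j (hij ▸ hmem))
  refine ⟨Finset.univ.image Γ, fun Γ' hΓ' => ?_, ?_⟩
  · obtain ⟨i, -, rfl⟩ := Finset.mem_image.1 hΓ'
    exact hΓ i
  · rw [Finset.card_image_of_injective _ hinj, Finset.card_univ]

/-- A separating family of linear functionals, indexed by reals, can take alternating values
at as many points as the dimension. -/
lemma exists_alternating {E : Type*} [AddCommGroup E] [Module ℝ E] [FiniteDimensional ℝ E]
    {N : ℕ} (hN : Module.finrank ℝ E = N) (φ : ℝ → E →ₗ[ℝ] ℝ) {S : Set ℝ}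
    (hS : ∀ v ≠ 0, ∃ r ∈ S, φ r v ≠ 0) :
    ∃ r : Fin N → ℝ, StrictMono r ∧ (∀ i, r i ∈ S) ∧ ∃ v, ∀ i, φ (r i) v = (-1) ^ (i : ℕ) := by
  classical
  obtain ⟨κ, a, ha, hspan, hli⟩ := exists_linearIndependent' ℝ fun r : S => φ r
  have : Finite κ := hli.finite
  have := Fintype.ofFinite κ
  have hker : ∀ v, (∀ k, φ (a k) v = 0) → v = 0 := fun v hv => by
    by_contra hne
    obtain ⟨r, hr, hrv⟩ := hS v hne
    have hle : Submodule.span ℝ (Set.range ((fun r : S => φ r) ∘ a)) ≤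
        LinearMap.ker (Module.Dual.eval ℝ E v) :=
      Submodule.span_le.2 (by rintro _ ⟨k, rfl⟩; exact hv k)
    rw [hspan] at hle
    exact hrv (hle (Submodule.subset_span ⟨⟨r, hr⟩, rfl⟩))
  have hcard : Fintype.card κ = N := by
    refine le_antisymm ?_ ?_
    · rw [← hN, ← Subspace.dual_finrank_eq]
      exact hli.fintype_card_le_finrank
    · have hinj : Function.Injective (LinearMap.pi fun k => φ (a k) : E →ₗ[ℝ] κ → ℝ) := by
        rw [← LinearMap.ker_eq_bot, LinearMap.ker_eq_bot']
        exact fun v hv => hker v fun k => congrFun hv k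
      rw [← hN, ← Module.finrank_fintype_fun_eq_card ℝ]
      exact LinearMap.finrank_le_finrank_of_injective hinj
  have ha' : Function.Injective fun k => (a k : ℝ) := Subtype.val_injective.comp ha
  set T : Finset ℝ := Finset.univ.image fun k => (a k : ℝ) with hT
  have hTcard : T.card = N := by
    rw [hT, Finset.card_image_of_injective _ ha', Finset.card_univ, hcard]
  have hmem : ∀ x ∈ T, x ∈ S := fun x hx => by
    obtain ⟨k, -, rfl⟩ := Finset.mem_image.1 hx
    exact (a k).2
  refine ⟨T.orderEmbOfFin hTcard, (T.orderEmbOfFin hTcard).strictMono,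
    fun i => hmem _ (Finset.orderEmbOfFin_mem T hTcard i), ?_⟩
  have hinj : Function.Injective
      (LinearMap.pi fun i => φ (T.orderEmbOfFin hTcard i) : E →ₗ[ℝ] Fin N → ℝ) := by
    rw [← LinearMap.ker_eq_bot, LinearMap.ker_eq_bot']
    refine fun v hv => hker v fun k => ?_
    have hk : (a k : ℝ) ∈ Set.range (T.orderEmbOfFin hTcard) := by
      rw [Finset.range_orderEmbOfFin]
      exact Finset.mem_coe.2 (Finset.mem_image_of_mem _ (Finset.mem_univ k))
    obtain ⟨i, hi⟩ := hk
    have := congrFun hv i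
    simpa [hi] using this
  obtain ⟨v, hv⟩ := (LinearMap.injective_iff_surjective_of_finrank_eq_finrank
    (by rw [hN, Module.finrank_fin_fun])).1 hinj fun i => (-1) ^ (i : ℕ)
  exact ⟨v, fun i => congrFun hv i⟩

lemma exists_pos_le_eval {P : ℝ[X]} (h : 0 < P.leadingCoeff) :
    ∃ c > 0, ∀ᶠ x in atTop, c ≤ P.eval x := by
  rcases Nat.eq_zero_or_pos P.natDegree with h0 | h0
  · rw [eq_C_of_natDegree_eq_zero h0] at h ⊢
    rw [leadingCoeff_C] at h
    exact ⟨_, h, Eventually.of_forall fun x => by rw [eval_C]⟩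
  · exact ⟨1, one_pos, (P.tendsto_atTop_of_leadingCoeff_nonneg (natDegree_pos_iff_degree_pos.1 h0)
      h.le).eventually_ge_atTop 1⟩

lemma eval_derivative_neg_of_even {H : ℝ[X]} (h : ∀ x, H.eval (-x) = H.eval x) (x : ℝ) :
    (derivative H).eval (-x) = -(derivative H).eval x := by
  have h1 : H.comp (-X) = H := Polynomial.funext fun x => by simp [h]
  have h2 := congrArg (fun p => (derivative p).eval x) h1
  simp only [derivative_comp, eval_mul, eval_comp] at h2
  simp at h2
  linarith

/-- The level curves of an even potential are ovals near infinity. -/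
lemma exists_outer_ovals {H : ℝ[X]} (heven : ∀ x, H.eval (-x) = H.eval x)
    (hd : 0 < H.natDegree) (hl : 0 < H.leadingCoeff) :
    ∃ R > 0, (∀ x ≥ R, 0 < (derivative H).eval x) ∧ ∀ r ≥ R, IsOval H (-r) r := by
  have hl' : 0 < (derivative H).leadingCoeff := by
    rw [leadingCoeff_derivative]
    positivity
  obtain ⟨c, hc, hev⟩ := exists_pos_le_eval hl'
  obtain ⟨R₁, hR₁⟩ := eventually_atTop.1 (hev.and (eventually_gt_atTop 0))
  have hpos : ∀ x ≥ R₁, 0 < (derivative H).eval x := fun x hx => hc.trans_le (hR₁ x hx).1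
  have hR₁0 : 0 < R₁ := (hR₁ R₁ le_rfl).2
  obtain ⟨K, hK⟩ := isCompact_Icc.bddAbove_image (K := Set.Icc 0 R₁) H.continuous.continuousOn
  obtain ⟨R₂, hR₂⟩ := eventually_atTop.1
    ((H.tendsto_atTop_of_leadingCoeff_nonneg (natDegree_pos_iff_degree_pos.1 hd)
      hl.le).eventually_gt_atTop K)
  refine ⟨max R₁ R₂, hR₁0.trans_le (le_max_left _ _),
    fun x hx => hpos x ((le_max_left _ _).trans hx), fun r hr => ?_⟩
  have hr₁ : R₁ ≤ r := (le_max_left _ _).trans hr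
  refine ⟨by linarith, heven r, fun x hx => ?_, ?_, hpos r hr₁⟩
  · have habs : H.eval x = H.eval |x| := by
      rcases abs_cases x with ⟨h, -⟩ | ⟨h, -⟩ <;> rw [h]
      rw [heven]
    have hlt : |x| < r := abs_lt.2 hx
    rw [habs]
    rcases le_or_gt |x| R₁ with h | h
    · exact (hK ⟨|x|, ⟨abs_nonneg x, h⟩, rfl⟩).trans_lt (hR₂ r ((le_max_right _ _).trans hr))
    · exact strictMonoOn_eval (a := R₁) (b := r) (fun y hy => hpos y hy.1) ⟨h.le, hlt.le⟩
        ⟨hr₁, le_rfl⟩ hlt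
  · rw [eval_derivative_neg_of_even heven, neg_lt_zero]
    exact hpos r hr₁

lemma eventually_mel_pos {H e : ℝ[X]} (hH : Tendsto (fun x => H.eval x) atTop atTop) {M : ℝ}
    (hM : 0 ≤ M) (hint : 0 < ∫ x in -M..M, e.eval x) (he : ∀ x, M ≤ |x| → 0 ≤ e.eval x) :
    ∀ᶠ r in atTop, 0 < mel H e (-r) r := by
  have hHc := H.continuous
  have hec := e.continuous
  have hJ : Continuous fun t : ℝ => ∫ x in -M..M, e.eval x * √(1 - t * H.eval x) := by
    refine intervalIntegral.continuous_parametric_intervalIntegral_of_continuous' ?_ _ _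
    unfold Function.uncurry
    fun_prop
  have hlim := (hJ.tendsto 0).comp hH.inv_tendsto_atTop
  have h0 : 0 < ∫ x in -M..M, e.eval x * √(1 - 0 * H.eval x) := by simpa using hint
  filter_upwards [hlim.eventually (lt_mem_nhds h0), hH.eventually_gt_atTop 0,
    eventually_ge_atTop M] with r hr hr0 hrM
  have hii : ∀ a b : ℝ, IntervalIntegrable (fun x => e.eval x * √(H.eval r - H.eval x))
      MeasureTheory.volume a b := fun a b => Continuous.intervalIntegrable (by fun_prop) _ _
  rw [mel, ← intervalIntegral.integral_add_adjacent_intervals (hii (-r) (-M)) (hii (-M) r),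
    ← intervalIntegral.integral_add_adjacent_intervals (hii (-M) M) (hii M r)]
  have h1 : 0 ≤ ∫ x in -r..-M, e.eval x * √(H.eval r - H.eval x) :=
    intervalIntegral.integral_nonneg (by linarith) fun x hx => mul_nonneg
      (he x (by rw [abs_of_nonpos (by linarith [hx.2])]; linarith [hx.2])) (Real.sqrt_nonneg _)
  have h2 : 0 ≤ ∫ x in M..r, e.eval x * √(H.eval r - H.eval x) :=
    intervalIntegral.integral_nonneg hrM fun x hx => mul_nonneg
      (he x (hx.1.trans (le_abs_self x))) (Real.sqrt_nonneg _)
  have h3 : ∫ x in -M..M, e.eval x * √(H.eval r - H.eval x) =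
      √(H.eval r) * ∫ x in -M..M, e.eval x * √(1 - (H.eval r)⁻¹ * H.eval x) := by
    rw [← intervalIntegral.integral_const_mul]
    refine intervalIntegral.integral_congr fun x _ => ?_
    have h4 : H.eval r - H.eval x = H.eval r * (1 - (H.eval r)⁻¹ * H.eval x) := by
      field_simp
    rw [h4, Real.sqrt_mul hr0.le]
    ring
  have h5 := mul_pos (Real.sqrt_pos.2 hr0) hr
  simp only [Function.comp_apply, Pi.inv_apply] at h5
  rw [h3]
  linarith

lemma exists_integral_pos {P : ℝ[X]} (h : 0 < P.leadingCoeff) :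
    ∃ M : ℝ, 0 ≤ M ∧ 0 < (∫ x in -M..M, (P.comp (X ^ 2)).eval x) ∧
      ∀ x, M ≤ |x| → 0 ≤ (P.comp (X ^ 2)).eval x := by
  obtain ⟨c, hc, hev⟩ := exists_pos_le_eval h
  obtain ⟨U, hU⟩ := eventually_atTop.1 (hev.and (eventually_ge_atTop 1))
  have hU1 : 1 ≤ U := (hU U le_rfl).2
  have hle : ∀ x, U ≤ |x| → c ≤ (P.comp (X ^ 2)).eval x := fun x hx => by
    rw [eval_comp, eval_pow, eval_X]
    refine (hU _ ?_).1
    rw [← sq_abs]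
    nlinarith
  set K := ∫ x in -U..U, (P.comp (X ^ 2)).eval x with hK
  set M := U + |K| / c + 1 with hM
  have hdiv : 0 ≤ |K| / c := by positivity
  have hUM : U ≤ M := by linarith
  have hii : ∀ a b : ℝ, IntervalIntegrable (fun x => (P.comp (X ^ 2)).eval x)
      MeasureTheory.volume a b := fun a b => (P.comp (X ^ 2)).continuous.intervalIntegrable _ _
  refine ⟨M, by linarith, ?_, fun x hx => hc.le.trans (hle x (hUM.trans hx))⟩
  rw [← intervalIntegral.integral_add_adjacent_intervals (hii (-M) (-U)) (hii (-U) M),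
    ← intervalIntegral.integral_add_adjacent_intervals (hii (-U) U) (hii U M), ← hK]
  have h1 : c * (M - U) ≤ ∫ x in -M..-U, (P.comp (X ^ 2)).eval x := by
    have := intervalIntegral.integral_mono_on (a := -M) (b := -U) (f := fun _ => c)
      (by linarith) (by simp) (hii _ _) fun x hx => hle x (by
        rw [abs_of_nonpos (by linarith [hx.2])]; linarith [hx.2])
    rw [intervalIntegral.integral_const, smul_eq_mul] at this
    linarith
  have h2 : c * (M - U) ≤ ∫ x in U..M, (P.comp (X ^ 2)).eval x := by
    have := intervalIntegral.integral_mono_on (a := U) (b := M) (f := fun _ => c)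
      hUM (by simp) (hii _ _) fun x hx => hle x (hx.1.trans (le_abs_self x))
    rw [intervalIntegral.integral_const, smul_eq_mul] at this
    linarith
  have h3 : c * (M - U) = |K| + c := by rw [hM]; field_simp; ring
  linarith [neg_abs_le K, abs_nonneg K]

lemma eventually_mel_ne_zero {H P : ℝ[X]} (hH : Tendsto (fun x => H.eval x) atTop atTop)
    (hP : P ≠ 0) : ∀ᶠ r in atTop, mel H (P.comp (X ^ 2)) (-r) r ≠ 0 := by
  rcases lt_or_gt_of_ne (leadingCoeff_ne_zero.2 hP) with h | h
  · obtain ⟨M, hM, h1, h2⟩ := exists_integral_pos (P := C (-1) * P) (by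
      rw [leadingCoeff_mul, leadingCoeff_C]; linarith)
    refine (eventually_mel_pos hH hM h1 h2).mono fun r hr h0 => ?_
    rw [mul_comp, C_comp, mel_C_mul, h0, mul_zero] at hr
    exact hr.false
  · obtain ⟨M, hM, h1, h2⟩ := exists_integral_pos h
    exact (eventually_mel_pos hH hM h1 h2).mono fun r hr => hr.ne'

/-- The Melnikov integral as a linear functional. -/
noncomputable def melLin (G : ℝ[X]) (l r : ℝ) : ℝ[X] →ₗ[ℝ] ℝ where
  toFun f := mel G f l r
  map_add' f e := mel_add G f e l r
  map_smul' c f := by rw [smul_eq_C_mul, mel_C_mul]; rfl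

/-- Even polynomials of degree at most `2 k` with Melnikov integrals alternating along the outer
ovals of an even potential. -/
lemma exists_even_alternating {H : ℝ[X]} (hH : Tendsto (fun x => H.eval x) atTop atTop) (R : ℝ)
    (k : ℕ) : ∃ (e : ℝ[X]) (r : Fin (k + 1) → ℝ), e.natDegree ≤ 2 * k ∧ StrictMono r ∧
      (∀ i, R ≤ r i) ∧ ∀ i, mel H e (-(r i)) (r i) = (-1) ^ (i : ℕ) := by
  have hfin : Module.finrank ℝ (degreeLT ℝ (k + 1)) = k + 1 := by
    rw [(degreeLTEquiv ℝ (k + 1)).finrank_eq, Module.finrank_fin_fun]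
  have : FiniteDimensional ℝ (degreeLT ℝ (k + 1)) :=
    Module.Finite.equiv (degreeLTEquiv ℝ (k + 1)).symm
  obtain ⟨r, hr, hrR, P, hP⟩ := exists_alternating (S := Set.Ici R) hfin
    (fun r => melLin H (-r) r ∘ₗ (aeval (X ^ 2 : ℝ[X])).toLinearMap ∘ₗ
      (degreeLT ℝ (k + 1)).subtype) fun P hP => by
      obtain ⟨r, hr, hrR⟩ := ((eventually_mel_ne_zero hH (P := P)
        (fun h => hP (Subtype.ext h))).and (eventually_ge_atTop R)).exists
      exact ⟨r, hrR, hr⟩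
  refine ⟨(P : ℝ[X]).comp (X ^ 2), r, ?_, hr, hrR, hP⟩
  have h1 : (P : ℝ[X]).natDegree ≤ k := natDegree_le_iff_coeff_eq_zero.2
    ((degree_lt_iff_coeff_zero _ _).1 (mem_degreeLT.1 P.2))
  rw [natDegree_comp, natDegree_X_pow]
  omega

lemma eval_derivative_comp_sq_sub (G : ℝ[X]) (a x : ℝ) :
    (derivative (G.comp (X ^ 2 - C a))).eval x = 2 * x * (derivative G).eval (x ^ 2 - a) := by
  rw [derivative_comp]
  simp [eval_comp, one_add_one_eq_two]

lemma mel_comp_sq_sub (G f : ℝ[X]) (a u v : ℝ) :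
    mel (G.comp (X ^ 2 - C a)) (C 2 * X * f.comp (X ^ 2 - C a)) u v =
      ∫ x in u ^ 2 - a..v ^ 2 - a, f.eval x * √(G.eval (v ^ 2 - a) - G.eval x) := by
  have hG := G.continuous
  have hf := f.continuous
  rw [← intervalIntegral.integral_comp_mul_deriv (f := fun x => x ^ 2 - a) (f' := fun x => 2 * x)
    (g := fun x => f.eval x * √(G.eval (v ^ 2 - a) - G.eval x))
    (fun x _ => by simpa using (hasDerivAt_pow 2 x).sub_const a) (by fun_prop) (by fun_prop), mel]
  refine intervalIntegral.integral_congr fun x _ => ?_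
  simp [eval_comp]
  ring

lemma IsOval.comp_sq_sub {G : ℝ[X]} {a p q : ℝ} (h : IsOval G (p ^ 2 - a) (q ^ 2 - a))
    (hp : 0 < p) (hq : 0 < q) : IsOval (G.comp (X ^ 2 - C a)) p q where
  lt := lt_of_pow_lt_pow_left₀ 2 hq.le (by linarith [h.lt])
  eval_eq := by simpa [eval_comp] using h.eval_eq
  eval_lt x hx := by
    have hx0 : 0 < x := hp.trans hx.1
    simpa [eval_comp] using h.eval_lt (x ^ 2 - a)
      ⟨by nlinarith [hx.1], by nlinarith [hx.2]⟩
  deriv_left := by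
    rw [eval_derivative_comp_sq_sub]
    exact mul_neg_of_pos_of_neg (by linarith) h.deriv_left
  deriv_right := by
    rw [eval_derivative_comp_sq_sub]
    exact mul_pos (by linarith) h.deriv_right

lemma IsOval.reflect {H : ℝ[X]} {l r : ℝ} (heven : ∀ x, H.eval (-x) = H.eval x)
    (h : IsOval H l r) : IsOval H (-r) (-l) where
  lt := neg_lt_neg h.lt
  eval_eq := by rw [heven, heven, h.eval_eq]
  eval_lt x hx := by
    rw [heven, h.eval_eq, ← heven]
    exact h.eval_lt (-x) ⟨lt_neg_of_lt_neg hx.2, neg_lt_of_neg_lt hx.1⟩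
  deriv_left := by
    rw [eval_derivative_neg_of_even heven]
    exact neg_neg_of_pos h.deriv_right
  deriv_right := by
    rw [eval_derivative_neg_of_even heven]
    exact neg_pos_of_neg h.deriv_left

lemma mel_reflect {H F : ℝ[X]} {l r : ℝ} (heven : ∀ x, H.eval (-x) = H.eval x)
    (hodd : ∀ x, F.eval (-x) = -F.eval x) (h : H.eval l = H.eval r) :
    mel H F (-r) (-l) = -mel H F l r := by
  rw [mel, mel, ← intervalIntegral.integral_comp_neg, ← intervalIntegral.integral_neg]
  refine intervalIntegral.integral_congr fun x _ => ?_
  simp only [heven, hodd, h]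
  ring

namespace SignChange

variable {G f : ℝ[X]} {l₂ l₁ r₁ r₂ : ℝ}

lemma comp_sq_sub {a p₂ p₁ q₁ q₂ : ℝ} (hp₂ : 0 < p₂) (hp₁ : 0 < p₁) (hq₁ : 0 < q₁) (hq₂ : 0 < q₂)
    (h : SignChange G f (p₂ ^ 2 - a) (p₁ ^ 2 - a) (q₁ ^ 2 - a) (q₂ ^ 2 - a)) :
    SignChange (G.comp (X ^ 2 - C a)) (C 2 * X * f.comp (X ^ 2 - C a)) p₂ p₁ q₁ q₂ where
  left_lt := lt_of_pow_lt_pow_left₀ 2 hp₁.le (by linarith [h.left_lt])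
  right_lt := lt_of_pow_lt_pow_left₀ 2 hq₂.le (by linarith [h.right_lt])
  inner := h.inner.comp_sq_sub hp₁ hq₁
  outer := h.outer.comp_sq_sub hp₂ hq₂
  deriv_neg x hx := by
    rw [eval_derivative_comp_sq_sub]
    exact mul_neg_of_pos_of_neg (by linarith [hx.1])
      (h.deriv_neg _ ⟨by nlinarith [hx.1], by nlinarith [hx.1, hx.2]⟩)
  deriv_pos x hx := by
    rw [eval_derivative_comp_sq_sub]
    exact mul_pos (by linarith [hx.1])
      (h.deriv_pos _ ⟨by nlinarith [hx.1], by nlinarith [hx.1, hx.2]⟩)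
  mel_mul_neg := by
    rw [mel_comp_sq_sub, mel_comp_sq_sub]
    exact h.mel_mul_neg

lemma reflect (h : SignChange G f l₂ l₁ r₁ r₂) (heven : ∀ x, G.eval (-x) = G.eval x)
    (hodd : ∀ x, f.eval (-x) = -f.eval x) : SignChange G f (-r₂) (-r₁) (-l₁) (-l₂) where
  left_lt := neg_lt_neg h.right_lt
  right_lt := neg_lt_neg h.left_lt
  inner := h.inner.reflect heven
  outer := h.outer.reflect heven
  deriv_neg x hx := by
    have := h.deriv_pos (-x) ⟨le_neg_of_le_neg hx.2, neg_le_of_neg_le hx.1⟩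
    rw [eval_derivative_neg_of_even heven] at this
    exact neg_pos.1 this
  deriv_pos x hx := by
    have := h.deriv_neg (-x) ⟨le_neg_of_le_neg hx.2, neg_le_of_neg_le hx.1⟩
    rw [eval_derivative_neg_of_even heven] at this
    exact neg_lt_zero.1 this
  mel_mul_neg := by
    rw [mel_reflect heven hodd h.inner.eval_eq, mel_reflect heven hodd h.outer.eval_eq, neg_mul_neg]
    exact h.mel_mul_neg

lemma eventually_add (h : SignChange G f l₂ l₁ r₁ r₂) (e : ℝ[X]) :
    ∀ᶠ δ in 𝓝 (0 : ℝ), SignChange G (f + C δ * e) l₂ l₁ r₁ r₂ := by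
  have hc : Continuous fun δ : ℝ => mel G (f + C δ * e) l₁ r₁ * mel G (f + C δ * e) l₂ r₂ := by
    simp only [mel_add, mel_C_mul]
    fun_prop
  filter_upwards [hc.continuousAt.eventually (gt_mem_nhds (by simpa using h.mel_mul_neg))]
    with δ hδ
  exact ⟨h.left_lt, h.right_lt, h.inner, h.outer, h.deriv_neg, h.deriv_pos, hδ⟩

lemma exists_right (h : SignChange G f l₂ l₁ r₁ r₂) {l : ℝ} (hl : l ∈ Set.Ioo l₂ l₁) :
    ∃ r ∈ Set.Ioo r₁ r₂, IsOval G l r := by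
  have hanti := strictAntiOn_eval h.deriv_neg
  obtain ⟨r, hr, hr'⟩ := intermediate_value_Ioo h.right_lt.le G.continuous.continuousOn
    (show G.eval l ∈ Set.Ioo (G.eval r₁) (G.eval r₂) from
      ⟨h.inner.eval_eq ▸ hanti ⟨hl.1.le, hl.2.le⟩ ⟨h.left_lt.le, le_rfl⟩ hl.2,
        h.outer.eval_eq ▸ hanti ⟨le_rfl, h.left_lt.le⟩ ⟨hl.1.le, hl.2.le⟩ hl.1⟩)
  exact ⟨r, hr, h.isOval ⟨hr.1.le, hr.2.le⟩ ⟨hl.1.le, hl.2.le⟩ hr'.symm⟩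

lemma disjoint_left {f' : ℝ[X]} {l₂' l₁' r₁' r₂' : ℝ} (h : SignChange G f l₂ l₁ r₁ r₂)
    (h' : SignChange G f' l₂' l₁' r₁' r₂') (hd : Disjoint (Set.Ioo r₁ r₂) (Set.Ioo r₁' r₂')) :
    Disjoint (Set.Ioo l₂ l₁) (Set.Ioo l₂' l₁') := by
  refine Set.disjoint_left.2 fun x hx hx' => ?_
  obtain ⟨r, hr, hro⟩ := h.exists_right hx
  obtain ⟨r', hr', hro'⟩ := h'.exists_right hx'
  rcases lt_trichotomy r r' with hlt | rfl | hlt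
  · exact (hro'.eval_lt r ⟨hro.lt, hlt⟩).ne (hro.eval_eq.symm.trans hro'.eval_eq)
  · exact Set.disjoint_left.1 hd hr hr'
  · exact (hro.eval_lt r' ⟨hro'.lt, hlt⟩).ne (hro'.eval_eq.symm.trans hro.eval_eq)

end SignChange

/-- There are a polynomial `f` of degree at most `n` and a potential of degree `d` such that the
Melnikov integral of `f` changes sign in `N` disjoint families of closed level curves. -/
def Alternates (n d N : ℕ) : Prop :=
  ∃ f G : ℝ[X], f.natDegree ≤ n ∧ G.natDegree = d ∧ 0 < G.leadingCoeff ∧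
    ∃ (ι : Type) (_ : Fintype ι) (l₂ l₁ r₁ r₂ : ι → ℝ), Fintype.card ι = N ∧
      (∀ i, SignChange G f (l₂ i) (l₁ i) (r₁ i) (r₂ i)) ∧
      Pairwise fun i j => Disjoint (Set.Ioo (r₁ i) (r₂ i)) (Set.Ioo (r₁ j) (r₂ j))

lemma Alternates.hge {n d N m : ℕ} (h : Alternates n d N) (hd : d ≤ m + 1) : HGe n m N := by
  obtain ⟨f, G, hf, hG, -, ι, _, l₂, l₁, r₁, r₂, rfl, hs, hdisj⟩ := h
  exact HGe_of_signChange hf (hG ▸ hd) hs hdisj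

lemma alternates_zero (n d : ℕ) : Alternates n d 0 :=
  ⟨0, X ^ d, by simp, natDegree_X_pow d, by simp, Empty, inferInstance, Empty.elim, Empty.elim,
    Empty.elim, Empty.elim, by simp, fun i => i.elim, fun i => i.elim⟩

lemma disjoint_Ioo_of_le {a b c d : ℝ} (h : b ≤ c) : Disjoint (Set.Ioo a b) (Set.Ioo c d) :=
  Set.disjoint_left.2 fun _ hx hx' => (hx.2.trans_le h).not_gt hx'.1

lemma pairwise_disjoint_outer {k : ℕ} {r : Fin (k + 1) → ℝ} (hr : StrictMono r) :
    Pairwise fun i j : Fin k => Disjoint (Set.Ioo (r i.castSucc) (r i.succ))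
      (Set.Ioo (r j.castSucc) (r j.succ)) := by
  have key : ∀ i j : Fin k, i < j → Disjoint (Set.Ioo (r i.castSucc) (r i.succ))
      (Set.Ioo (r j.castSucc) (r j.succ)) := fun i j hij =>
    disjoint_Ioo_of_le (hr.monotone (by
      rw [Fin.le_def, Fin.val_succ, Fin.val_castSucc]
      exact hij))
  intro i j hij
  rcases lt_or_gt_of_ne hij with h | h
  · exact key i j h
  · exact (key j i h).symm

/-- Precomposing with `x ↦ x ^ 2 - a` doubles the families and adds new outer ones. -/
theorem Alternates.double {n₀ d N n : ℕ} (h : Alternates n₀ d N) (hd : 1 ≤ d)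
    (hn : 2 * n₀ + 1 ≤ n) : Alternates n (d * 2) (2 * N + n / 2) := by
  obtain ⟨f, G, hf, hG, hlead, ι, _, l₂, l₁, r₁, r₂, hcard, hs, hdisj⟩ := h
  obtain ⟨a, ha⟩ : ∃ a : ℝ, ∀ i, -(l₂ i) < a :=
    (eventually_all.2 fun i => eventually_gt_atTop (-(l₂ i))).exists
  set H := G.comp (X ^ 2 - C a) with hH
  set F := C 2 * X * f.comp (X ^ 2 - C a) with hF
  have hq : (X ^ 2 - C a : ℝ[X]).natDegree = 2 := natDegree_X_pow_sub_C
  have hql : (X ^ 2 - C a : ℝ[X]).leadingCoeff = 1 := leadingCoeff_X_pow_sub_C two_pos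
  have hHd : H.natDegree = d * 2 := by rw [hH, natDegree_comp, hq, hG]
  have hHl : 0 < H.leadingCoeff := by
    rw [hH, leadingCoeff_comp (by rw [hq]; exact two_ne_zero), hql, one_pow, mul_one]
    exact hlead
  have heven : ∀ x, H.eval (-x) = H.eval x := fun x => by simp [hH, eval_comp]
  have hodd : ∀ x, F.eval (-x) = -F.eval x := fun x => by simp [hF, eval_comp]
  have hHd0 : 0 < H.natDegree := by omega
  obtain ⟨R, hR, hRpos, hRoval⟩ := exists_outer_ovals heven hHd0 hHl
  obtain ⟨R', hR'⟩ : ∃ R' : ℝ, ∀ i, √(r₂ i + a) ≤ R' :=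
    (eventually_all.2 fun i => eventually_ge_atTop (√(r₂ i + a))).exists
  obtain ⟨e, r, he, hr, hrR, hre⟩ := exists_even_alternating
    (H.tendsto_atTop_of_leadingCoeff_nonneg (natDegree_pos_iff_degree_pos.1 hHd0) hHl.le)
    (max R R') (n / 2)
  have hpos : ∀ i, 0 < l₂ i + a ∧ 0 < l₁ i + a ∧ 0 < r₁ i + a ∧ 0 < r₂ i + a := fun i => by
    have h1 := ha i
    have h2 := (hs i).left_lt
    have h3 := (hs i).inner.lt
    have h4 := (hs i).right_lt
    exact ⟨by linarith, by linarith, by linarith, by linarith⟩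
  have hright : ∀ i, SignChange H F (√(l₂ i + a)) (√(l₁ i + a)) (√(r₁ i + a)) (√(r₂ i + a)) :=
    fun i => by
      obtain ⟨h1, h2, h3, h4⟩ := hpos i
      refine SignChange.comp_sq_sub (Real.sqrt_pos.2 h1) (Real.sqrt_pos.2 h2) (Real.sqrt_pos.2 h3)
        (Real.sqrt_pos.2 h4) ?_
      rw [Real.sq_sqrt h1.le, Real.sq_sqrt h2.le, Real.sq_sqrt h3.le, Real.sq_sqrt h4.le]
      simpa using hs i
  have hleft := fun i => (hright i).reflect heven hodd
  obtain ⟨δ, ⟨hδr, hδl⟩, hδ⟩ := (((eventually_all.2 fun i => (hright i).eventually_add e).and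
    (eventually_all.2 fun i => (hleft i).eventually_add e)).filter_mono
      (nhdsWithin_le_nhds (s := Set.Ioi 0))).and self_mem_nhdsWithin |>.exists
  have hFzero : ∀ x, mel H F (-x) x = 0 := fun x => by
    rw [hH, hF, mel_comp_sq_sub, neg_sq, intervalIntegral.integral_same]
  have houter : ∀ i : Fin (n / 2), SignChange H (F + C δ * e) (-(r i.succ)) (-(r i.castSucc))
      (r i.castSucc) (r i.succ) := fun i => by
    have h1 : R ≤ r i.castSucc := (le_max_left _ _).trans (hrR _)
    have h2 : r i.castSucc < r i.succ := hr i.castSucc_lt_succ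
    refine ⟨neg_lt_neg h2, h2, hRoval _ h1, hRoval _ (h1.trans h2.le), fun x hx => ?_,
      fun x hx => hRpos x (h1.trans hx.1), ?_⟩
    · have h3 := hRpos (-x) (h1.trans (le_neg_of_le_neg hx.2))
      rw [eval_derivative_neg_of_even heven] at h3
      exact neg_pos.1 h3
    · rw [mel_add, mel_add, mel_C_mul, mel_C_mul, hFzero, hFzero, hre, hre, Fin.val_castSucc,
        Fin.val_succ, pow_succ]
      have h4 : ((-1 : ℝ) ^ (i : ℕ)) ^ 2 = 1 := by rw [← pow_mul, mul_comm, pow_mul]; simp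
      have h5 : 0 < δ ^ 2 := pow_pos hδ 2
      nlinarith
  have hlr : ∀ i, 0 < √(r₁ i + a) := fun i => Real.sqrt_pos.2 (hpos i).2.2.1
  refine ⟨F + C δ * e, H, ?_, hHd, hHl, ι ⊕ (ι ⊕ Fin (n / 2)), inferInstance,
    Sum.elim (fun i => √(l₂ i + a)) (Sum.elim (fun i => -√(r₂ i + a)) fun i => -(r i.succ)),
    Sum.elim (fun i => √(l₁ i + a)) (Sum.elim (fun i => -√(r₁ i + a)) fun i => -(r i.castSucc)),
    Sum.elim (fun i => √(r₁ i + a)) (Sum.elim (fun i => -√(l₁ i + a)) fun i => r i.castSucc),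
    Sum.elim (fun i => √(r₂ i + a)) (Sum.elim (fun i => -√(l₂ i + a)) fun i => r i.succ),
    ?_, ?_, ?_⟩
  · refine (natDegree_add_le _ _).trans (max_le ?_ ((natDegree_C_mul_le _ _).trans (by omega)))
    refine natDegree_mul_le.trans ?_
    have h1 : (C 2 * X : ℝ[X]).natDegree ≤ 1 := (natDegree_C_mul_le _ _).trans natDegree_X_le
    rw [natDegree_comp, hq]
    omega
  · rw [Fintype.card_sum, Fintype.card_sum, hcard, Fintype.card_fin]
    omega
  · rintro (i | i | i)
    · exact hδr i
    · exact hδl i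
    · exact houter i
  · have hrr : ∀ i j, i ≠ j → Disjoint (Set.Ioo √(r₁ i + a) √(r₂ i + a))
        (Set.Ioo √(r₁ j + a) √(r₂ j + a)) := fun i j hij => by
      have hsq : ∀ k, ∀ x ∈ Set.Ioo √(r₁ k + a) √(r₂ k + a),
          x ^ 2 - a ∈ Set.Ioo (r₁ k) (r₂ k) := fun k x hx => by
        have h0 := (hlr k).trans hx.1
        exact ⟨by linarith [(Real.sqrt_lt' h0).1 hx.1],
          by linarith [(Real.lt_sqrt h0.le).1 hx.2]⟩
      exact Set.disjoint_left.2 fun x hx hx' =>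
        Set.disjoint_left.1 (hdisj hij) (hsq i x hx) (hsq j x hx')
    have hll : ∀ i j, i ≠ j → Disjoint (Set.Ioo (-√(l₁ i + a)) (-√(l₂ i + a)))
        (Set.Ioo (-√(l₁ j + a)) (-√(l₂ j + a))) := fun i j hij => by
      have h1 := (hright i).disjoint_left (hright j) (hrr i j hij)
      have hneg : ∀ k, ∀ x ∈ Set.Ioo (-√(l₁ k + a)) (-√(l₂ k + a)),
          -x ∈ Set.Ioo √(l₂ k + a) √(l₁ k + a) := fun k x hx =>
        ⟨lt_neg_of_lt_neg hx.2, neg_lt_of_neg_lt hx.1⟩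
      exact Set.disjoint_left.2 fun x hx hx' =>
        Set.disjoint_left.1 h1 (hneg i x hx) (hneg j x hx')
    have hlr' : ∀ i j, Disjoint (Set.Ioo (-√(l₁ i + a)) (-√(l₂ i + a)))
        (Set.Ioo √(r₁ j + a) √(r₂ j + a)) := fun i j =>
      disjoint_Ioo_of_le (by linarith [hlr j, Real.sqrt_nonneg (l₂ i + a)])
    have hro : ∀ i (j : Fin (n / 2)), Disjoint (Set.Ioo √(r₁ i + a) √(r₂ i + a))
        (Set.Ioo (r j.castSucc) (r j.succ)) := fun i j =>
      disjoint_Ioo_of_le ((hR' i).trans ((le_max_right _ _).trans (hrR _)))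
    have hlo : ∀ i (j : Fin (n / 2)), Disjoint (Set.Ioo (-√(l₁ i + a)) (-√(l₂ i + a)))
        (Set.Ioo (r j.castSucc) (r j.succ)) := fun i j =>
      disjoint_Ioo_of_le (by
        linarith [Real.sqrt_nonneg (l₂ i + a), (le_max_left _ _).trans (hrR j.castSucc)])
    rintro (i | i | i) (j | j | j) hij
    · exact hrr i j fun h => hij (h ▸ rfl)
    · exact (hlr' j i).symm
    · exact hro i j
    · exact hlr' i j
    · exact hll i j fun h => hij (h ▸ rfl)
    · exact hlo i j
    · exact (hro j i).symm
    · exact (hlo j i).symm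
    · exact pairwise_disjoint_outer hr fun h => hij (h ▸ rfl)

/-- Parametrization of the level curves of `x ^ 3 - 3 x` around `1`, by half of the difference of
the arguments of their ends. -/
noncomputable def cubicArc (t : ℝ) : ℝ := Real.cos t + √3 * Real.sin t

/-- A potential of degree three. -/
noncomputable def cubic : ℝ[X] := X ^ 3 - C 3 * X

lemma eval_cubic (x : ℝ) : cubic.eval x = x ^ 3 - 3 * x := by simp [cubic]

lemma eval_derivative_cubic (x : ℝ) : (derivative cubic).eval x = 3 * (x ^ 2 - 1) := by
  simp [cubic]
  ring

lemma natDegree_cubic : cubic.natDegree = 3 := by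
  rw [cubic]
  compute_degree!

lemma leadingCoeff_cubic : cubic.leadingCoeff = 1 := by
  rw [leadingCoeff, natDegree_cubic, cubic]
  simp

lemma cubicArc_eq (t : ℝ) : cubicArc t = 2 * Real.cos (Real.pi / 3 - t) := by
  rw [cubicArc, Real.cos_sub, Real.cos_pi_div_three, Real.sin_pi_div_three]
  ring

lemma cubicArc_neg (t : ℝ) : cubicArc (-t) = Real.cos t - √3 * Real.sin t := by
  rw [cubicArc, Real.cos_neg, Real.sin_neg]
  ring

lemma strictMonoOn_cubicArc :
    StrictMonoOn cubicArc (Set.Icc (-(Real.pi / 6)) (Real.pi / 6)) := fun s hs t ht hst => by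
  rw [cubicArc_eq, cubicArc_eq]
  have := Real.strictAntiOn_cos (a := Real.pi / 3 - t) (b := Real.pi / 3 - s)
    ⟨by linarith [ht.2, Real.pi_pos], by linarith [ht.1, Real.pi_pos]⟩
    ⟨by linarith [hs.2, Real.pi_pos], by linarith [hs.1, Real.pi_pos]⟩ (by linarith)
  linarith

lemma cubicArc_bounds {t : ℝ} (ht : t ∈ Set.Ioo 0 (Real.pi / 6)) :
    0 < cubicArc (-t) ∧ cubicArc (-t) < 1 ∧ 1 < cubicArc t := by
  have h0 : cubicArc 0 = 1 := by simp [cubicArc]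
  have h1 : cubicArc (-(Real.pi / 6)) = 0 := by
    rw [cubicArc_eq, show Real.pi / 3 - -(Real.pi / 6) = Real.pi / 2 by ring, Real.cos_pi_div_two,
      mul_zero]
  have hp := Real.pi_pos
  rw [← h0]
  refine ⟨?_, strictMonoOn_cubicArc ⟨?_, ?_⟩ ⟨?_, ?_⟩ ?_,
    strictMonoOn_cubicArc ⟨?_, ?_⟩ ⟨?_, ?_⟩ ?_⟩
  · rw [← h1]
    exact strictMonoOn_cubicArc ⟨le_rfl, by linarith⟩ ⟨by linarith [ht.2], by linarith [ht.1]⟩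
      (by linarith [ht.2])
  all_goals linarith [ht.1, ht.2]

lemma eval_cubic_sub (t x : ℝ) : cubic.eval x - cubic.eval (cubicArc t) =
    (x - cubicArc t) * (x - cubicArc (-t)) * (x + cubicArc t + cubicArc (-t)) := by
  have h3 : √3 ^ 2 = (3 : ℝ) := Real.sq_sqrt (by norm_num)
  have h1 := Real.sin_sq_add_cos_sq t
  have h : cubicArc t ^ 2 + cubicArc t * cubicArc (-t) + cubicArc (-t) ^ 2 = 3 := by
    rw [cubicArc_neg, cubicArc]
    linear_combination 3 * h1 + Real.sin t ^ 2 * h3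
  rw [eval_cubic, eval_cubic]
  linear_combination (x - cubicArc t) * h

lemma eval_cubic_arc_neg (t : ℝ) : cubic.eval (cubicArc (-t)) = cubic.eval (cubicArc t) :=
  sub_eq_zero.1 (by rw [eval_cubic_sub]; ring)

lemma eval_cubic_arc (t : ℝ) : cubic.eval (cubicArc t) = -2 * Real.cos (3 * t) := by
  have h3 : √3 ^ 2 = (3 : ℝ) := Real.sq_sqrt (by norm_num)
  have h := Real.cos_three_mul (Real.pi / 3 - t)
  rw [show 3 * (Real.pi / 3 - t) = Real.pi - 3 * t by ring, Real.cos_pi_sub] at h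
  rw [eval_cubic, cubicArc_eq]
  linear_combination -2 * h

lemma eval_cubic_cos (t : ℝ) : cubic.eval (-(2 * Real.cos t)) = cubic.eval (cubicArc t) :=
  sub_eq_zero.1 (by rw [eval_cubic_sub, cubicArc_neg, cubicArc]; ring)

lemma isOval_cubic {t : ℝ} (ht : t ∈ Set.Ioo 0 (Real.pi / 6)) :
    IsOval cubic (cubicArc (-t)) (cubicArc t) := by
  obtain ⟨h0, h1, h2⟩ := cubicArc_bounds ht
  refine ⟨h1.trans h2, eval_cubic_arc_neg t, fun x hx => ?_, ?_, ?_⟩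
  · have h := eval_cubic_sub t x
    have h3 : 0 < (cubicArc t - x) * (x - cubicArc (-t)) * (x + cubicArc t + cubicArc (-t)) :=
      mul_pos (mul_pos (sub_pos.2 hx.2) (sub_pos.2 hx.1)) (by linarith [hx.1])
    linarith
  · rw [eval_derivative_cubic]
    nlinarith
  · rw [eval_derivative_cubic]
    nlinarith

lemma hasDerivAt_cubicArc (t : ℝ) :
    HasDerivAt cubicArc (-Real.sin t + √3 * Real.cos t) t :=
  (Real.hasDerivAt_cos t).add ((Real.hasDerivAt_sin t).const_mul _)

lemma continuous_cubicArc : Continuous cubicArc := by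
  unfold cubicArc
  fun_prop

/-- The derivative of `F (x t) - F (x (-t))` along the arc `x`. -/
noncomputable def arcDeriv (F : ℝ[X]) (t : ℝ) : ℝ :=
  (derivative F).eval (cubicArc t) * (-Real.sin t + √3 * Real.cos t) +
    (derivative F).eval (cubicArc (-t)) * (Real.sin t + √3 * Real.cos t)

lemma hasDerivAt_arc_sub (F : ℝ[X]) (t : ℝ) :
    HasDerivAt (fun t => F.eval (cubicArc t) - F.eval (cubicArc (-t))) (arcDeriv F t) t := by
  have h1 := (F.hasDerivAt (cubicArc t)).comp t (hasDerivAt_cubicArc t)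
  have h2 := (F.hasDerivAt (cubicArc (-t))).comp t
    ((hasDerivAt_cubicArc (-t)).comp t (hasDerivAt_neg t))
  refine (h1.sub h2).congr_deriv ?_
  rw [arcDeriv, Real.cos_neg, Real.sin_neg]
  ring

lemma continuous_arcDeriv (F : ℝ[X]) : Continuous (arcDeriv F) := by
  have h1 := continuous_cubicArc
  have h2 := (derivative F).continuous
  unfold arcDeriv
  fun_prop

lemma analyticOnNhd_arcDeriv (F : ℝ[X]) : AnalyticOnNhd ℝ (arcDeriv F) Set.univ := fun t _ => by
  have h1 : ∀ s, AnalyticAt ℝ cubicArc s := fun s => by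
    unfold cubicArc
    fun_prop
  have h2 : ∀ x, AnalyticAt ℝ (fun x => (derivative F).eval x) x := fun x => by
    simpa using AnalyticAt.aeval_polynomial (analyticAt_id (𝕜 := ℝ) (z := x)) (derivative F)
  have h3 : AnalyticAt ℝ (fun t => cubicArc (-t)) t := (h1 (-t)).fun_comp (by fun_prop)
  have h4 := (h2 (cubicArc t)).fun_comp (h1 t)
  have h5 := AnalyticAt.fun_comp (f := fun t => cubicArc (-t)) (h2 (cubicArc (-t))) h3
  unfold arcDeriv
  fun_prop

lemma mel_cubic (F : ℝ[X]) (T : ℝ) :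
    mel cubic (derivative F) (cubicArc (-T)) (cubicArc T) =
      ∫ t in 0..T, arcDeriv F t * √(2 * Real.cos (3 * t) - 2 * Real.cos (3 * T)) := by
  have h1 := continuous_cubicArc
  have h2 := (derivative F).continuous
  have h3 := cubic.continuous
  set u : ℝ → ℝ := fun t => (derivative F).eval (cubicArc t) *
    √(2 * Real.cos (3 * t) - 2 * Real.cos (3 * T)) * (-Real.sin t + √3 * Real.cos t) with hu
  have hii : ∀ a b : ℝ, IntervalIntegrable u MeasureTheory.volume a b := fun a b =>
    Continuous.intervalIntegrable (by fun_prop) _ _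
  have hii' : ∀ a b : ℝ, IntervalIntegrable (fun t => u (-t)) MeasureTheory.volume a b :=
    fun a b => Continuous.intervalIntegrable (by fun_prop) _ _
  have key : mel cubic (derivative F) (cubicArc (-T)) (cubicArc T) = ∫ t in (-T)..T, u t := by
    rw [mel, ← intervalIntegral.integral_comp_mul_deriv (f := cubicArc)
      (f' := fun t => -Real.sin t + √3 * Real.cos t) (fun t _ => hasDerivAt_cubicArc t)
      (by fun_prop) (by fun_prop)]
    refine intervalIntegral.integral_congr fun t _ => ?_
    simp only [hu, Function.comp_apply, eval_cubic_arc]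
    ring_nf
  have hneg : ∫ t in (-T)..0, u t = ∫ t in 0..T, u (-t) := by
    rw [intervalIntegral.integral_comp_neg, neg_zero]
  rw [key, ← intervalIntegral.integral_add_adjacent_intervals (hii (-T) 0) (hii 0 T), hneg,
    ← intervalIntegral.integral_add (hii' 0 T) (hii 0 T)]
  refine intervalIntegral.integral_congr fun t _ => ?_
  simp only [hu, arcDeriv, mul_neg, Real.cos_neg, Real.sin_neg]
  ring

lemma integral_ne_zero_of_ne_zero {h : ℝ → ℝ} {a b : ℝ} (hab : a < b) (hc : Continuous h)
    (hne : ∀ t ∈ Set.Ioo a b, h t ≠ 0) : ∫ t in a..b, h t ≠ 0 := by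
  by_cases hpos : ∀ t ∈ Set.Ioo a b, 0 < h t
  · exact (intervalIntegral.intervalIntegral_pos_of_pos_on (hc.intervalIntegrable _ _) hpos hab).ne'
  push Not at hpos
  obtain ⟨s, hs, hs0⟩ := hpos
  have hneg : ∀ t ∈ Set.Ioo a b, 0 < -h t := fun t ht => by
    by_contra hle
    obtain ⟨x, hx, hx0⟩ := isPreconnected_Ioo.intermediate_value hs ht hc.continuousOn
      (show (0 : ℝ) ∈ Set.Icc (h s) (h t) from ⟨hs0, by linarith⟩)
    exact hne x hx hx0
  have := intervalIntegral.intervalIntegral_pos_of_pos_on (hc.neg.intervalIntegrable _ _) hneg hab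
  intro h0
  rw [Pi.neg_def, intervalIntegral.integral_neg, h0, neg_zero] at this
  exact this.false

/-- The polynomials `X * B (G) + X ^ 2 * C (G)`, for the cubic potential `G`. -/
noncomputable def cubicLin (a b : ℕ) : degreeLT ℝ a × degreeLT ℝ b →ₗ[ℝ] ℝ[X] :=
  (LinearMap.mulLeft ℝ X ∘ₗ (aeval cubic).toLinearMap ∘ₗ (degreeLT ℝ a).subtype).coprod
    (LinearMap.mulLeft ℝ (X ^ 2) ∘ₗ (aeval cubic).toLinearMap ∘ₗ (degreeLT ℝ b).subtype)

lemma cubicLin_apply {a b : ℕ} (v : degreeLT ℝ a × degreeLT ℝ b) :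
    cubicLin a b v = X * (v.1 : ℝ[X]).comp cubic + X ^ 2 * (v.2 : ℝ[X]).comp cubic := rfl

lemma natDegree_comp_cubic_le {a : ℕ} (P : degreeLT ℝ a) :
    ((P : ℝ[X]).comp cubic).natDegree ≤ 3 * (a - 1) := by
  rw [natDegree_comp, natDegree_cubic, mul_comm]
  refine Nat.mul_le_mul_left 3 (natDegree_le_iff_coeff_eq_zero.2 fun k hk => ?_)
  exact (degree_lt_iff_coeff_zero _ _).1 (mem_degreeLT.1 P.2) k (by omega)

lemma natDegree_cubicLin_le {n : ℕ} (v : degreeLT ℝ (n / 3 + 1) × degreeLT ℝ ((n + 2) / 3)) :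
    (cubicLin _ _ v).natDegree ≤ n + 1 := by
  rw [cubicLin_apply]
  refine (natDegree_add_le _ _).trans (max_le ?_ ?_)
  · refine natDegree_mul_le.trans ?_
    have := natDegree_comp_cubic_le v.1
    rw [natDegree_X]
    omega
  · rcases Nat.eq_zero_or_pos ((n + 2) / 3) with h | h
    · have h0 : (v.2 : ℝ[X]) = 0 := Polynomial.ext fun k =>
        (degree_lt_iff_coeff_zero _ _).1 (mem_degreeLT.1 v.2.2) k (by omega)
      simp [h0]
    · refine natDegree_mul_le.trans ?_
      have := natDegree_comp_cubic_le v.2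
      rw [natDegree_X_pow]
      omega

lemma comp_cubic_eq_zero {P : ℝ[X]} (h : P.comp cubic = 0) : P = 0 := by
  refine (comp_eq_zero_iff.1 h).resolve_right fun h' => ?_
  have := congrArg natDegree h'.2
  rw [natDegree_cubic, natDegree_C] at this
  omega

lemma eq_zero_of_comp_cubic {B D : ℝ[X]} (h : B.comp cubic = X * D.comp cubic) :
    B = 0 ∧ D = 0 := by
  have hD : D = 0 := by
    by_contra hD
    have := congrArg natDegree h
    rw [natDegree_X_mul fun h0 => hD (comp_cubic_eq_zero h0), natDegree_comp, natDegree_comp,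
      natDegree_cubic] at this
    omega
  rw [hD, zero_comp, mul_zero] at h
  exact ⟨comp_cubic_eq_zero h, hD⟩

lemma arcDeriv_cubicLin_ne_zero {a b : ℕ} {v : degreeLT ℝ a × degreeLT ℝ b} (hv : v ≠ 0) :
    ∃ t, arcDeriv (cubicLin a b v) t ≠ 0 := by
  by_contra! h0
  set F := cubicLin a b v with hF
  have hconst : ∀ t, F.eval (cubicArc t) - F.eval (cubicArc (-t)) = 0 := fun t => by
    have := is_const_of_deriv_eq_zero (fun t => (hasDerivAt_arc_sub F t).differentiableAt)
      (fun t => (hasDerivAt_arc_sub F t).deriv.trans (h0 t)) t 0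
    simpa using this
  refine hv (Prod.ext_iff.2 ?_)
  obtain ⟨h1, h2⟩ : (v.1 : ℝ[X]) = 0 ∧ (v.2 : ℝ[X]) = 0 := by
    refine eq_zero_of_comp_cubic (eq_of_infinite_eval_eq _ _ ((Set.Ioo_infinite
      (show (-1 : ℝ) < 1 by norm_num)).mono fun z hz => ?_))
    set t := Real.arccos (-z / 2) with ht
    have hz' : z = -(2 * Real.cos t) := by
      rw [ht, Real.cos_arccos (by linarith [hz.2]) (by linarith [hz.1])]
      ring
    have hs : 0 < Real.sin t := by
      rw [ht, Real.sin_arccos]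
      exact Real.sqrt_pos.2 (by nlinarith [hz.1, hz.2])
    have h := hconst t
    simp only [hF, cubicLin_apply, eval_add, eval_mul, eval_pow, eval_X, eval_comp,
      eval_cubic_arc_neg] at h
    rw [cubicArc_neg, cubicArc] at h
    have h3 : 2 * √3 * Real.sin t ≠ 0 := by positivity
    simp only [Set.mem_ofPred_eq, eval_mul, eval_X, eval_comp, hz', eval_cubic_cos]
    refine mul_left_cancel₀ h3 ?_
    rw [cubicArc]
    linear_combination h
  exact ⟨Subtype.ext h1, Subtype.ext h2⟩

lemma exists_mel_cubicLin_ne_zero {a b : ℕ} {v : degreeLT ℝ a × degreeLT ℝ b} (hv : v ≠ 0) :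
    ∃ T ∈ Set.Ioo 0 (Real.pi / 6),
      mel cubic (derivative (cubicLin a b v)) (cubicArc (-T)) (cubicArc T) ≠ 0 := by
  obtain ⟨s, hs⟩ := arcDeriv_cubicLin_ne_zero hv
  set F := cubicLin a b v
  have hev : ∀ᶠ t in 𝓝[≠] (0 : ℝ), arcDeriv F t ≠ 0 := by
    refine (analyticOnNhd_arcDeriv F 0 (Set.mem_univ _)).eventually_eq_zero_or_eventually_ne_zero
      |>.resolve_left fun h => hs ?_
    exact (analyticOnNhd_arcDeriv F).eqOn_zero_of_preconnected_of_eventuallyEq_zero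
      isPreconnected_univ (Set.mem_univ 0) h (Set.mem_univ s)
  obtain ⟨δ, hδ, hne⟩ := mem_nhdsGT_iff_exists_Ioo_subset.1
    (hev.filter_mono (nhdsWithin_mono _ fun t (ht : 0 < t) => ht.ne'))
  have hp := Real.pi_pos
  have hδ' : (0 : ℝ) < δ := hδ
  set T := min δ (Real.pi / 6) / 2 with hT
  have hmin : 0 < min δ (Real.pi / 6) := lt_min hδ' (by linarith)
  have hT0 : 0 < T := half_pos hmin
  have hT1 : T < δ := by linarith [min_le_left δ (Real.pi / 6)]
  have hT2 : T < Real.pi / 6 := by linarith [min_le_right δ (Real.pi / 6)]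
  refine ⟨T, ⟨hT0, hT2⟩, ?_⟩
  have hcont := continuous_arcDeriv F
  rw [mel_cubic]
  refine integral_ne_zero_of_ne_zero hT0 (by fun_prop) fun t ht =>
    mul_ne_zero (hne ⟨ht.1, ht.2.trans hT1⟩) (Real.sqrt_pos.2 ?_).ne'
  have := Real.strictAntiOn_cos (a := 3 * t) (b := 3 * T) ⟨by linarith [ht.1], by linarith [ht.2]⟩
    ⟨by linarith, by linarith⟩ (by linarith [ht.2])
  linarith

lemma strictMono_cubicArc_comp {ι : Type*} [Preorder ι] {t : ι → ℝ} (ht : StrictMono t)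
    (hmem : ∀ i, t i ∈ Set.Ioo 0 (Real.pi / 6)) :
    (StrictMono fun i => cubicArc (t i)) ∧ StrictAnti fun i => cubicArc (-(t i)) := by
  have hp := Real.pi_pos
  refine ⟨fun i j hij => strictMonoOn_cubicArc ?_ ?_ (ht hij),
    fun i j hij => strictMonoOn_cubicArc ?_ ?_ (neg_lt_neg (ht hij))⟩ <;>
  constructor <;> linarith [(hmem i).1, (hmem i).2, (hmem j).1, (hmem j).2]

theorem alternates_cubic (n : ℕ) : Alternates n 3 (n / 3 + (n + 2) / 3) := by
  set N := n / 3 + (n + 2) / 3 with hN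
  have hfd : ∀ k, FiniteDimensional ℝ (degreeLT ℝ k) := fun k =>
    Module.Finite.equiv (degreeLTEquiv ℝ k).symm
  have hrank : ∀ k, Module.finrank ℝ (degreeLT ℝ k) = k := fun k => by
    rw [(degreeLTEquiv ℝ k).finrank_eq, Module.finrank_fin_fun]
  have hfin : Module.finrank ℝ (degreeLT ℝ (n / 3 + 1) × degreeLT ℝ ((n + 2) / 3)) = N + 1 := by
    rw [Module.finrank_prod, hrank, hrank]
    omega
  obtain ⟨t, ht, htS, v, hv⟩ := exists_alternating (S := Set.Ioo 0 (Real.pi / 6)) hfin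
    (fun t => melLin cubic (cubicArc (-t)) (cubicArc t) ∘ₗ derivative ∘ₗ cubicLin _ _)
    fun v hv => exists_mel_cubicLin_ne_zero hv
  obtain ⟨hmono, hanti⟩ := strictMono_cubicArc_comp ht htS
  refine ⟨derivative (cubicLin _ _ v), cubic, ?_, natDegree_cubic, ?_, Fin N, inferInstance,
    fun i => cubicArc (-(t i.succ)), fun i => cubicArc (-(t i.castSucc)),
    fun i => cubicArc (t i.castSucc), fun i => cubicArc (t i.succ), Fintype.card_fin N,
    fun i => ⟨hanti i.castSucc_lt_succ, hmono i.castSucc_lt_succ, isOval_cubic (htS _),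
      isOval_cubic (htS _), fun x hx => ?_, fun x hx => ?_, ?_⟩, pairwise_disjoint_outer hmono⟩
  · exact (natDegree_derivative_le _).trans (by have := natDegree_cubicLin_le v; omega)
  · rw [leadingCoeff_cubic]
    exact one_pos
  · have h1 := (cubicArc_bounds (htS i.succ)).1
    have h2 := (cubicArc_bounds (htS i.castSucc)).2.1
    rw [eval_derivative_cubic]
    nlinarith [hx.1, hx.2]
  · have h2 := (cubicArc_bounds (htS i.castSucc)).2.2
    rw [eval_derivative_cubic]
    nlinarith [hx.1]
  · have h1 := hv i.castSucc
    have h2 := hv i.succ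
    simp only [LinearMap.comp_apply, melLin, LinearMap.coe_mk, AddHom.coe_mk] at h1 h2
    rw [h1, h2, Fin.val_castSucc, Fin.val_succ, pow_succ]
    have h4 : ((-1 : ℝ) ^ (i : ℕ)) ^ 2 = 1 := by rw [← pow_mul, mul_comm, pow_mul]; simp
    nlinarith

/-- Lower bound, affine in `n`, for the number of families in `Alternates n d`. -/
def AlternatesSlope (d : ℕ) (σ β : ℝ) : Prop :=
  ∀ n : ℕ, ∃ N : ℕ, Alternates n d N ∧ σ * n - β ≤ N

lemma AlternatesSlope.double {d : ℕ} {σ β : ℝ} (h : AlternatesSlope d σ β) (hd : 1 ≤ d)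
    (hσ : 0 ≤ σ) (hβ : 0 ≤ 2 * σ + 2 * β) :
    AlternatesSlope (d * 2) (σ + 1 / 2) (2 * β + 2 * σ + 1 / 2) := fun n => by
  rcases Nat.eq_zero_or_pos n with rfl | hn
  · refine ⟨0, alternates_zero _ _, ?_⟩
    push_cast
    linarith
  obtain ⟨N, hN, hle⟩ := h ((n - 1) / 2)
  refine ⟨_, hN.double hd (by omega), ?_⟩
  have h1 : (n : ℝ) ≤ 2 * (((n - 1) / 2 : ℕ) : ℝ) + 2 := by
    exact_mod_cast (by omega : n ≤ 2 * ((n - 1) / 2) + 2)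
  have h2 : (n : ℝ) ≤ 2 * ((n / 2 : ℕ) : ℝ) + 1 := by
    exact_mod_cast (by omega : n ≤ 2 * (n / 2) + 1)
  rw [Nat.cast_add, Nat.cast_mul, Nat.cast_ofNat]
  linarith [mul_le_mul_of_nonneg_left h1 hσ]

lemma AlternatesSlope.iterate {d : ℕ} {σ β : ℝ} (h : AlternatesSlope d σ β) (hd : 1 ≤ d)
    (hσ : 0 ≤ σ) (hβ : 0 ≤ β) (k : ℕ) : AlternatesSlope (d * 2 ^ k) (σ + k / 2)
      (2 ^ k * (β + 2 * σ + 3 / 2) - 2 * (σ + k / 2) - 3 / 2) := by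
  induction k with
  | zero => convert h using 1 <;> push_cast <;> ring
  | succ k ih =>
    have hpow : ((k : ℝ) + 1) ≤ 2 ^ k := by exact_mod_cast Nat.lt_two_pow_self
    have := ih.double (Nat.mul_pos hd (pow_pos two_pos k)) (by positivity) (by nlinarith)
    rw [mul_assoc, ← pow_succ] at this
    convert this using 1 <;> push_cast <;> ring

lemma AlternatesSlope.hge {d : ℕ} {σ β c : ℝ} (h : AlternatesSlope d σ β) {n m : ℕ}
    (hd : d ≤ m + 1) (hc : c ≤ σ * n - β) : HGe n m c := by
  obtain ⟨N, hN, hle⟩ := h n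
  obtain ⟨f, g, hf, hg, ε₀, hε₀, hcyc⟩ := hN.hge hd
  refine ⟨f, g, hf, hg, ε₀, hε₀, fun ε hε hε' => ?_⟩
  obtain ⟨s, hs, hcard⟩ := hcyc ε hε hε'
  exact ⟨s, hs, (hc.trans hle).trans hcard⟩

lemma alternatesSlope_linear : AlternatesSlope 1 0 0 := fun n => ⟨0, alternates_zero _ _, by simp⟩

lemma alternatesSlope_cubic : AlternatesSlope 3 (2 / 3) (2 / 3) := fun n => by
  refine ⟨_, alternates_cubic n, ?_⟩
  have h : 2 * (n : ℝ) ≤ 3 * ((n / 3 + (n + 2) / 3 : ℕ) : ℝ) + 2 := by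
    exact_mod_cast (by omega : 2 * n ≤ 3 * (n / 3 + (n + 2) / 3) + 2)
  linarith

lemma log_three_le : 3 * Real.log 3 ≤ 5 * Real.log 2 := by
  have := Real.log_le_log (by norm_num) (show (3 : ℝ) ^ 3 ≤ 2 ^ 5 by norm_num)
  rw [Real.log_pow, Real.log_pow] at this
  exact_mod_cast this

theorem hge_of_two_le {m n : ℕ} (hm : 2 ≤ m) :
    HGe n m ((Real.log ((m : ℝ) + 2) / (2 * Real.log 2) - 1 / 3) * n - 2 * ((m : ℝ) + 1)) := by
  have hlog : 0 < Real.log 2 := Real.log_pos one_lt_two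
  obtain ⟨k, hk⟩ : ∃ k, Nat.log 2 (m + 1) = k + 1 :=
    Nat.exists_eq_succ_of_ne_zero (Nat.log_pos one_lt_two (by omega)).ne'
  have hlo : 2 ^ (k + 1) ≤ m + 1 := hk ▸ Nat.pow_log_le_self 2 (by omega)
  have hhi : m + 1 < 2 ^ (k + 1 + 1) := hk ▸ Nat.lt_pow_succ_log_self one_lt_two (m + 1)
  have slope : ∀ σ : ℝ, Real.log ((m : ℝ) + 2) ≤ (2 * σ + 2 / 3) * Real.log 2 →
      (Real.log ((m : ℝ) + 2) / (2 * Real.log 2) - 1 / 3) * n ≤ σ * n := fun σ hσ => by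
    refine mul_le_mul_of_nonneg_right ?_ n.cast_nonneg
    rw [sub_le_iff_le_add, div_le_iff₀ (by positivity)]
    linarith
  have hm2 : (0 : ℝ) < (m : ℝ) + 2 := by positivity
  rcases lt_or_ge (m + 1) (3 * 2 ^ k) with h | h
  · refine (alternatesSlope_linear.iterate le_rfl le_rfl le_rfl (k + 1)).hge
      (by rwa [one_mul]) ?_
    have h1 : ((2 : ℝ) ^ (k + 1)) ≤ (m : ℝ) + 1 := by exact_mod_cast hlo
    have h2 : (m : ℝ) + 2 ≤ 3 * 2 ^ k := by exact_mod_cast h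
    have h3 := Real.log_le_log hm2 h2
    rw [Real.log_mul three_ne_zero (by positivity), Real.log_pow] at h3
    have h4 := slope (0 + ((k + 1 : ℕ) : ℝ) / 2) (by push_cast; linarith [log_three_le])
    have h5 : (0 : ℝ) ≤ ((k + 1 : ℕ) : ℝ) := Nat.cast_nonneg _
    linarith
  · refine (alternatesSlope_cubic.iterate (by norm_num) (by norm_num) (by norm_num) k).hge h ?_
    have h1 : 3 * ((2 : ℝ) ^ k) ≤ (m : ℝ) + 1 := by exact_mod_cast h
    have h2 : (m : ℝ) + 2 ≤ 2 ^ (k + 2) := by exact_mod_cast hhi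
    have h3 := Real.log_le_log hm2 h2
    rw [Real.log_pow] at h3
    push_cast at h3
    have h4 := slope (2 / 3 + (k : ℝ) / 2) (by linarith)
    have h5 : (0 : ℝ) ≤ k := k.cast_nonneg
    linarith

lemma tendsto_two_mul_div_mul_log :
    Tendsto (fun m : ℕ => 2 * ((m : ℝ) + 1) / (((m : ℝ) + 1) * Real.log ((m : ℝ) + 1)))
      atTop (𝓝 0) := by
  have h1 : Tendsto (fun m : ℕ => (m : ℝ) + 1) atTop atTop :=
    tendsto_atTop_add_const_right _ _ tendsto_natCast_atTop_atTop
  refine ((tendsto_const_nhds (x := (2 : ℝ))).div_atTop (Real.tendsto_log_atTop.comp h1)).congr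
    fun m => ?_
  rw [mul_comm 2, mul_div_mul_left _ _ (by positivity), Function.comp_apply]

end LienardCycles

theorem stmt5 :
    ∃ γ : ℕ → ℝ,
      (∀ m : ℕ, 7 ≤ m → 0 < γ m) ∧
      limsup (fun m : ℕ => γ m / (((m : ℝ) + 1) * Real.log ((m : ℝ) + 1))) atTop
        ≤ 1 / (4 * Real.log 2) ∧
      ∀ m n : ℕ, 7 ≤ m → m ≤ n →
        HGe n m ((Real.log ((m : ℝ) + 2) / (2 * Real.log 2) - 1 / 3) * n - γ m) := by
  refine ⟨fun m => 2 * ((m : ℝ) + 1), fun m _ => by positivity, ?_, fun m n hm _ =>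
    LienardCycles.hge_of_two_le (by omega)⟩
  rw [LienardCycles.tendsto_two_mul_div_mul_log.limsup_eq]
  have := Real.log_pos one_lt_two
  positivity
end

section
/- Let n₀ ≥ 1 and k₀ ≥ 0 be integers. Define n_{p,i} (p ≥ 1, 1 ≤ i ≤ 2^p) by n_{1,1} = 2n₀ + 1, n_{1,2} = 2n₀ + 2, n_{i+1,2l−1} = 2n_{i,l} + 1, n_{i+1,2l} = 2n_{i,l} + 2, and define k_{p,i} by k_{1,1} = 2k₀ + n₀, k_{1,2} = 2k₀ + n₀ + 1, and for i ≥ 1, 1 ≤ l ≤ 2^i: k_{i+1,2l−1} = 2k_{i,l} + n_{i,l}, k_{i+1,2l} = 2k_{i,l} + n_{i,l} + 1. Then for all p ≥ 1: k_{p,1} = 2^p(k₀ − 1) + p·2^{p−1}(n₀ + 1) + 1, k_{p,2^p} = 2^p(k₀ − 1) + p·2^{p−1}(n₀ + 2) + 1, and k_{p,1} ≤ k_{p,2} ≤ ⋯ ≤ k_{p,2^p}. -/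
/-- Row `p` of the array `N` is an arithmetic progression with common difference one. -/
theorem row_eq_of_rec (n₀ : ℤ) (N : ℕ → ℕ → ℤ)
    (hN11 : N 1 1 = 2 * n₀ + 1) (hN12 : N 1 2 = 2 * n₀ + 2)
    (hNrec : ∀ i l : ℕ, 1 ≤ i → 1 ≤ l → l ≤ 2 ^ i →
      N (i + 1) (2 * l - 1) = 2 * N i l + 1 ∧ N (i + 1) (2 * l) = 2 * N i l + 2)
    (p : ℕ) (hp : 1 ≤ p) :
    ∀ i : ℕ, 1 ≤ i → i ≤ 2 ^ p → N p i = 2 ^ p * (n₀ + 1) + i - 2 := by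
  induction p, hp using Nat.le_induction with
  | base =>
    intro i hi hi'
    obtain rfl | rfl : i = 1 ∨ i = 2 := by omega
    · rw [hN11]; push_cast; ring
    · rw [hN12]; push_cast; ring
  | succ p hp ih =>
    intro i hi hi'
    rw [pow_succ] at hi'
    obtain ⟨l, rfl | rfl⟩ : ∃ l, i = 2 * (l + 1) - 1 ∨ i = 2 * (l + 1) :=
      ⟨(i - 1) / 2, by omega⟩
    · rw [(hNrec p (l + 1) hp (by omega) (by omega)).1, ih (l + 1) (by omega) (by omega),
        show 2 * (l + 1) - 1 = 2 * l + 1 by omega]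
      push_cast; ring
    · rw [(hNrec p (l + 1) hp (by omega) (by omega)).2, ih (l + 1) (by omega) (by omega)]
      push_cast; ring

/-- Consecutive entries of each row of the array `K` are weakly increasing. -/
theorem row_le_succ_of_rec (N K : ℕ → ℕ → ℤ)
    (hN : ∀ p l : ℕ, 1 ≤ p → 1 ≤ l → l + 1 ≤ 2 ^ p → N p (l + 1) = N p l + 1)
    (hK1 : K 1 1 ≤ K 1 2)
    (hKrec : ∀ i l : ℕ, 1 ≤ i → 1 ≤ l → l ≤ 2 ^ i →
      K (i + 1) (2 * l - 1) = 2 * K i l + N i l ∧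
      K (i + 1) (2 * l) = 2 * K i l + N i l + 1)
    (p : ℕ) (hp : 1 ≤ p) :
    ∀ i : ℕ, 1 ≤ i → i + 1 ≤ 2 ^ p → K p i ≤ K p (i + 1) := by
  induction p, hp using Nat.le_induction with
  | base =>
    intro i hi hi'
    obtain rfl : i = 1 := by omega
    exact hK1
  | succ p hp ih =>
    intro i hi hi'
    rw [pow_succ] at hi'
    obtain ⟨l, rfl | rfl⟩ : ∃ l, i = 2 * (l + 1) - 1 ∨ i = 2 * (l + 1) :=
      ⟨(i - 1) / 2, by omega⟩
    · have h := hKrec p (l + 1) hp (by omega) (by omega)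
      rw [h.1, show 2 * (l + 1) - 1 + 1 = 2 * (l + 1) by omega, h.2]
      omega
    · have h := hKrec p (l + 1) hp (by omega) (by omega)
      have h' := hKrec p (l + 2) hp (by omega) (by omega)
      have hle := ih (l + 1) (by omega) (by omega)
      have hNl := hN p (l + 1) hp (by omega) (by omega)
      rw [h.2, show 2 * (l + 1) + 1 = 2 * (l + 2) - 1 by omega, h'.1]
      rw [add_assoc] at hle hNl
      linarith

theorem stmt7 (n₀ k₀ : ℤ) (hn₀ : 1 ≤ n₀) (hk₀ : 0 ≤ k₀)
    (N K : ℕ → ℕ → ℤ)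
    (hN11 : N 1 1 = 2 * n₀ + 1) (hN12 : N 1 2 = 2 * n₀ + 2)
    (hNrec : ∀ i l : ℕ, 1 ≤ i → 1 ≤ l → l ≤ 2 ^ i →
      N (i + 1) (2 * l - 1) = 2 * N i l + 1 ∧ N (i + 1) (2 * l) = 2 * N i l + 2)
    (hK11 : K 1 1 = 2 * k₀ + n₀) (hK12 : K 1 2 = 2 * k₀ + n₀ + 1)
    (hKrec : ∀ i l : ℕ, 1 ≤ i → 1 ≤ l → l ≤ 2 ^ i →
      K (i + 1) (2 * l - 1) = 2 * K i l + N i l ∧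
      K (i + 1) (2 * l) = 2 * K i l + N i l + 1) :
    ∀ p : ℕ, 1 ≤ p →
      K p 1 = 2 ^ p * (k₀ - 1) + (p : ℤ) * 2 ^ (p - 1) * (n₀ + 1) + 1 ∧
      K p (2 ^ p) = 2 ^ p * (k₀ - 1) + (p : ℤ) * 2 ^ (p - 1) * (n₀ + 2) + 1 ∧
      ∀ i j : ℕ, 1 ≤ i → i ≤ j → j ≤ 2 ^ p → K p i ≤ K p j := by
  intro p hp
  have hN := row_eq_of_rec n₀ N hN11 hN12 hNrec
  have hstep := row_le_succ_of_rec N K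
    (fun p l hp hl hl' => by
      rw [hN p hp l hl (by omega), hN p hp (l + 1) (by omega) hl']; push_cast; ring)
    (by linarith) hKrec p hp
  refine ⟨?_, ?_, ?_⟩
  · clear hstep
    induction p, hp using Nat.le_induction with
    | base => rw [hK11]; norm_num; ring
    | succ p hp ih =>
      have h := (hKrec p 1 hp le_rfl Nat.one_le_two_pow).1
      rw [show 2 * 1 - 1 = 1 from rfl] at h
      rw [h, ih, hN p hp 1 le_rfl Nat.one_le_two_pow]
      obtain ⟨m, rfl⟩ := Nat.exists_eq_add_of_le' hp
      simp only [Nat.add_sub_cancel]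
      push_cast; ring
  · clear hstep
    induction p, hp using Nat.le_induction with
    | base => norm_num; rw [hK12]; ring
    | succ p hp ih =>
      rw [pow_succ', (hKrec p (2 ^ p) hp Nat.one_le_two_pow le_rfl).2, ih,
        hN p hp (2 ^ p) Nat.one_le_two_pow le_rfl]
      obtain ⟨m, rfl⟩ := Nat.exists_eq_add_of_le' hp
      simp only [Nat.add_sub_cancel]
      push_cast; ring
  · intro i j hi hij
    induction j, hij using Nat.le_induction with
    | base => exact fun _ => le_rfl
    | succ j hij ih => exact fun hj => (ih (by omega)).trans (hstep j (by omega) hj)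
end
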